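/- Let F be an algebraically closed field of characteristic 0, let F₁ and F₂ be finitely generated field extensions of F, and let F̄₁ be an algebraic closure of F₁. Then the Picard group of the commutative ring F̄₁ ⊗_F F₂ is divisible: for every invertible module M over F̄₁ ⊗_F F₂ and every integer n ≥ 1, there exists an invertible module N over F̄₁ ⊗_F F₂ with N^{⊗n} isomorphic to M. -/

import Mathlib

open scoped TensorProduct

universe u

/-- An invertible module over a commutative ring `R`, bundled with a witness of its inverse:
a module `carrier` together with a module `inverse` such that `carrier ⊗[R] inverse ≃ R`.
These are exactly the representatives of elements of the Picard group of `R`. -/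
structure InvertibleModule (R : Type u) [CommRing R] : Type (u + 1) where
  carrier : Type u
  [addCommGroup : AddCommGroup carrier]
  [module : Module R carrier]
  inverse : Type u
  [addCommGroupInv : AddCommGroup inverse]
  [moduleInv : Module R inverse]
  equiv : Nonempty (TensorProduct R carrier inverse ≃ₗ[R] R)

attribute [instance] InvertibleModule.addCommGroup InvertibleModule.module
  InvertibleModule.addCommGroupInv InvertibleModule.moduleInv

namespace PD
open scoped TensorProduct

/-- Nullstellensatz: specialization of finite type domains. -/
theorem exists_specialization {k Ω S : Type*} [Field k] [Field Ω] [Algebra k Ω] [IsAlgClosed Ω]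
    [CommRing S] [IsDomain S] [Algebra k S] [Algebra.FiniteType k S] (c : S) (hc : c ≠ 0) :
    ∃ φ : S →ₐ[k] Ω, φ c ≠ 0 := by
  let T := Localization.Away c
  have : Nontrivial T := (IsLocalization.injective (M := Submonoid.powers c) T
    (powers_le_nonZeroDivisors_of_noZeroDivisors hc)).nontrivial
  have hT : Algebra.FiniteType k T := inferInstance
  obtain ⟨m, hm⟩ := Ideal.exists_maximal T
  let _ : Field (T ⧸ m) := Ideal.Quotient.field m
  have : Module.Finite k (T ⧸ m) := finite_of_finite_type_of_isJacobsonRing k (T ⧸ m)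
  let ψ : (T ⧸ m) →ₐ[k] Ω := IsAlgClosed.lift
  refine ⟨(ψ.comp (Ideal.Quotient.mkₐ k m)).comp (IsScalarTower.toAlgHom k S T), ?_⟩
  have hu : IsUnit (algebraMap S T c) := IsLocalization.Away.algebraMap_isUnit c
  exact (hu.map ((ψ.comp (Ideal.Quotient.mkₐ k m)))).ne_zero

/-- left tensor map -/
noncomputable abbrev tmap {E A B : Type*} (N : Type*) [CommRing E] [CommRing A] [CommRing B] [CommRing N]
    [Algebra E A] [Algebra E B] [Algebra E N] (φ : A →ₐ[E] B) : A ⊗[E] N →ₐ[E] B ⊗[E] N :=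
  Algebra.TensorProduct.map φ (AlgHom.id E N)

theorem tmap_injective {E A B N : Type*} [Field E] [CommRing A] [CommRing B] [CommRing N]
    [Algebra E A] [Algebra E B] [Algebra E N] (φ : A →ₐ[E] B) (h : Function.Injective φ) :
    Function.Injective (tmap N φ) :=
  Module.Flat.rTensor_preserves_injective_linearMap (M := N) φ.toLinearMap h

theorem tmap_comp_apply {E A B C N : Type*} [CommRing E] [CommRing A] [CommRing B] [CommRing N]
    [CommRing C] [Algebra E C]
    [Algebra E A] [Algebra E B] [Algebra E N] (φ : A →ₐ[E] B) (ψ : B →ₐ[E] C) (x : A ⊗[E] N) :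
    tmap N ψ (tmap N φ x) = tmap N (ψ.comp φ) x := by
  induction x with
  | zero => simp
  | tmul a n => simp
  | add x y hx hy => rw [map_add, map_add, hx, hy, map_add]

theorem exists_fg_subalgebra {E L K N : Type*} [CommRing E] [CommRing L] [CommRing K]
    [CommRing N] [Algebra E L] [Algebra L K] [Algebra E K] [IsScalarTower E L K] [Algebra E N]
    (x : K ⊗[E] N) : ∃ S : Subalgebra L K, S.FG ∧ 
      ∃ y : S ⊗[E] N, tmap N (S.val.restrictScalars E) y = x := by
  induction x with
  | zero => exact ⟨⊥, Subalgebra.fg_bot, 0, map_zero _⟩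
  | tmul a n =>
    refine ⟨Algebra.adjoin L {a}, ⟨{a}, by simp⟩,
      (⟨a, Algebra.self_mem_adjoin_singleton L a⟩ : Algebra.adjoin L {a}) ⊗ₜ n, by simp⟩
  | add x y hx hy =>
    obtain ⟨S, hS, x', rfl⟩ := hx
    obtain ⟨T, hT, y', rfl⟩ := hy
    refine ⟨S ⊔ T, hS.sup hT, tmap N ((Subalgebra.inclusion le_sup_left).restrictScalars E) x' +
      tmap N ((Subalgebra.inclusion le_sup_right).restrictScalars E) y', ?_⟩
    rw [map_add, tmap_comp_apply, tmap_comp_apply]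
    rfl

theorem exists_specialization_tensor {E L S N Ω : Type*} [Field E] [Field L] [CommRing S]
    [IsDomain S] [CommRing N] [Algebra E L] [Algebra L S] [Algebra E S] [IsScalarTower E L S]
    [Algebra.FiniteType L S] [Algebra E N]
    [Field Ω] [IsAlgClosed Ω] [Algebra L Ω] [Algebra E Ω] [IsScalarTower E L Ω]
    (x y : S ⊗[E] N) (hx : x ≠ 0) (hy : y ≠ 0) :
    ∃ φ : S →ₐ[L] Ω, tmap N (φ.restrictScalars E) x ≠ 0 ∧ tmap N (φ.restrictScalars E) y ≠ 0 := by
  let b := Module.Basis.ofVectorSpace E N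
  let bS := b.baseChange S
  let bΩ := b.baseChange Ω
  have key : ∀ (φ : S →ₐ[L] Ω) (z : S ⊗[E] N) (i), 
      bΩ.repr (tmap N (φ.restrictScalars E) z) i = φ (bS.repr z i) := by
    intro φ z i
    induction z with
    | zero => simp
    | tmul a n => 
      simp only [bΩ, bS, tmap, Algebra.TensorProduct.map_tmul, Module.Basis.baseChange_repr_tmul]
      simp [Algebra.smul_def]
    | add x y hx hy => simp only [map_add, Finsupp.add_apply, hx, hy]
  have h1 : ∃ i, bS.repr x i ≠ 0 := by
    by_contra! h
    exact hx (bS.repr.injective (by ext i; simp [h i]))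
  have h2 : ∃ i, bS.repr y i ≠ 0 := by
    by_contra! h
    exact hy (bS.repr.injective (by ext i; simp [h i]))
  obtain ⟨i, hi⟩ := h1
  obtain ⟨j, hj⟩ := h2
  obtain ⟨φ, hφ⟩ := exists_specialization (k := L) (Ω := Ω) _ (mul_ne_zero hi hj)
  rw [map_mul] at hφ
  refine ⟨φ, fun h => ?_, fun h => ?_⟩
  · have := key φ x i
    rw [h, map_zero] at this
    exact left_ne_zero_of_mul hφ this.symm
  · have := key φ y j
    rw [h, map_zero] at this
    exact right_ne_zero_of_mul hφ this.symm

/-- Tensor products of domains over an algebraically closed field are domains. -/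
theorem isDomain_tensor (E A S : Type*) [Field E] [IsAlgClosed E] [CommRing A] [IsDomain A]
    [CommRing S] [IsDomain S] [Algebra E A] [Algebra E S] : IsDomain (A ⊗[E] S) := by
  have : NoZeroDivisors (A ⊗[E] S) := by
    refine ⟨fun {x y} hxy => ?_⟩
    by_contra! h
    obtain ⟨T, hT, x', rfl⟩ := exists_fg_subalgebra (L := E) x
    obtain ⟨T', hT', y', rfl⟩ := exists_fg_subalgebra (L := E) y
    let U := T ⊔ T'
    have : Algebra.FiniteType E U := U.fg_iff_finiteType.mp (hT.sup hT')
    let x1 : U ⊗[E] S := tmap S (Subalgebra.inclusion le_sup_left) x'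
    let y1 : U ⊗[E] S := tmap S (Subalgebra.inclusion le_sup_right) y'
    have hx1 : tmap S U.val x1 = tmap S T.val x' := tmap_comp_apply _ _ _
    have hy1 : tmap S U.val y1 = tmap S T'.val y' := tmap_comp_apply _ _ _
    have h0 : x1 * y1 = 0 := by
      apply tmap_injective (N := S) U.val Subtype.val_injective
      rw [map_mul, map_zero, hx1, hy1]
      exact hxy
    obtain ⟨φ, h1, h2⟩ := exists_specialization_tensor (E := E) (L := E) (Ω := E) x1 y1
      (fun h' => h.1 (by rw [h', map_zero] at hx1; exact hx1.symm))
      (fun h' => h.2 (by rw [h', map_zero] at hy1; exact hy1.symm))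
    let e := Algebra.TensorProduct.lid E S
    have h3 := congrArg e (congrArg (tmap S (φ.restrictScalars E)) h0)
    rw [map_mul, map_mul, map_zero, map_zero, mul_eq_zero] at h3
    rcases h3 with h3 | h3
    · exact h1 (e.injective (h3.trans (map_zero e).symm))
    · exact h2 (e.injective (h3.trans (map_zero e).symm))
  have : Nontrivial (A ⊗[E] S) := by
    have := (Algebra.TensorProduct.includeLeft_injective (S := E) (A := A) (B := S)
      (algebraMap E S).injective)
    exact this.nontrivial
  exact NoZeroDivisors.to_isDomain _

end PD

namespace PD
open scoped TensorProduct

open PowerSeries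

section Abs

/-- strong recursion -/
noncomputable def seqRec {L : Type*} [Zero L] (c : ℕ → (ℕ → L) → L) : ℕ → L
  | k => c k (fun j => if _h : j < k then seqRec c j else 0)

/-- Geometric data: places at infinity of a curve. -/
structure FD (E L T I : Type*) [Field E] [Field L] [CommRing T] [Algebra E L] [Algebra E T]
    [Fintype I] where
  ι : I → L →ₐ[E] T
  B : Subalgebra E L
  O : ℤ → Submodule E T
  mono : ∀ g h, g ≤ h → O g ≤ O h
  omul : ∀ g h a b, a ∈ O g → b ∈ O h → a * b ∈ O (g + h)
  one : 1 ∈ O 0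
  x : L
  xB : x ∈ B
  xO : ∀ i, ι i x ∈ O 1
  t : T
  tO : t ∈ O (-1)
  tx : ∀ i, t * ι i x = 1
  g1 : ℕ
  approx : ∀ v : I → T, ∃ b ∈ B, ∀ i, ι i b - v i ∈ O g1

variable {E L T I : Type*} [Field E] [Field L] [CommRing T] [Algebra E L] [Algebra E T]
    [Fintype I] (D : FD E L T I)

theorem smul_eq_C_mul_aux (a : E) (p : L⟦X⟧) : a • p = C (algebraMap E L a) * p := by
  ext k; rw [coeff_smul, coeff_C_mul, Algebra.smul_def]

namespace FD

def W (g : ℤ) : Submodule E L where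
  carrier := {b | b ∈ D.B ∧ ∀ i, D.ι i b ∈ D.O g}
  add_mem' := fun {a b} ha hb => ⟨add_mem ha.1 hb.1, fun i => by
    rw [map_add]; exact add_mem (ha.2 i) (hb.2 i)⟩
  zero_mem' := ⟨zero_mem _, fun i => by rw [map_zero]; exact zero_mem _⟩
  smul_mem' := fun c a ha => ⟨D.B.smul_mem ha.1 c, fun i => by
    rw [map_smul]; exact Submodule.smul_mem _ _ (ha.2 i)⟩

def M (u : I → T⟦X⟧) (g : ℤ) : Submodule E L⟦X⟧ where
  carrier := {h | (∀ k, coeff k h ∈ D.B) ∧ ∀ i k, coeff k (u i * map (D.ι i : L →+* T) h) ∈ D.O g}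
  add_mem' := fun {a b} ha hb => ⟨fun k => by rw [map_add]; exact add_mem (ha.1 k) (hb.1 k),
    fun i k => by rw [map_add, mul_add, map_add]; exact add_mem (ha.2 i k) (hb.2 i k)⟩
  zero_mem' := ⟨fun k => by simp, fun i k => by simp⟩
  smul_mem' := fun c a ha => ⟨fun k => by
      rw [coeff_smul]; exact D.B.smul_mem (ha.1 k) c, fun i k => by
    have : map (D.ι i : L →+* T) (c • a) = c • map (D.ι i : L →+* T) a := by
      ext j; simp
    rw [this, mul_smul_comm, coeff_smul]; exact Submodule.smul_mem _ _ (ha.2 i k)⟩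

theorem M_mono (u : I → T⟦X⟧) {g h : ℤ} (hg : g ≤ h) : D.M u g ≤ D.M u h :=
  fun _ ha => ⟨ha.1, fun i k => D.mono _ _ hg (ha.2 i k)⟩

theorem M_mul {u u' : I → T⟦X⟧} {g g' : ℤ} {h h' : L⟦X⟧} (hh : h ∈ D.M u g)
    (hh' : h' ∈ D.M u' g') : h * h' ∈ D.M (u * u') (g + g') := by
  refine ⟨fun k => ?_, fun i k => ?_⟩
  · rw [coeff_mul]
    exact sum_mem fun p _ => mul_mem (hh.1 _) (hh'.1 _)
  · have : (u * u') i * map (D.ι i : L →+* T) (h * h') =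
      (u i * map (D.ι i : L →+* T) h) * (u' i * map (D.ι i : L →+* T) h') := by
      rw [map_mul, Pi.mul_apply]; ring
    rw [this, coeff_mul]
    exact sum_mem fun p _ => D.omul _ _ _ _ (hh.2 i _) (hh'.2 i _)

theorem exists_M (u : I → T⟦X⟧) (hu : ∀ i, coeff 0 (u i) = 1) (g : ℤ) (hg : D.g1 ≤ g) (b : L)
    (hb : b ∈ D.W g) : ∃ h ∈ D.M u g, coeff 0 h = b := by
  choose app hB happ using D.approx
  let c : ℕ → (ℕ → L) → L := fun k prev => if k = 0 then b else
    app (fun i => - ∑ p ∈ (Finset.HasAntidiagonal.antidiagonal k).erase (0, k), coeff p.1 (u i) * D.ι i (prev p.2))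
  have hc : ∀ k, seqRec c k = if k = 0 then b else
    app (fun i => - ∑ p ∈ (Finset.HasAntidiagonal.antidiagonal k).erase (0, k),
      coeff p.1 (u i) * D.ι i (seqRec c p.2)) := by
    intro k
    rw [seqRec]
    simp only [c]
    split_ifs with h
    · rfl
    · congr 1
      ext i
      congr 1
      refine Finset.sum_congr rfl fun p hp => ?_
      have hp' := Finset.mem_erase.mp hp
      have h2 := Finset.HasAntidiagonal.mem_antidiagonal.mp hp'.2
      have : p.2 < k := by
        rcases Nat.eq_zero_or_pos p.1 with h0 | h0
        · exact absurd (Prod.ext h0 (by simpa [h0] using h2)) hp'.1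
        · omega
      rw [dif_pos this]
  refine ⟨PowerSeries.mk (seqRec c), ⟨fun k => ?_, fun i k => ?_⟩, ?_⟩
  · rw [coeff_mk, hc]
    split_ifs
    · exact hb.1
    · exact hB _
  · rw [coeff_mul, ← Finset.add_sum_erase _ _ (a := (0, k)) (by simp)]
    simp only [coeff_map, coeff_mk, hu, one_mul]
    nth_rewrite 1 [hc k]
    split_ifs with h
    · subst h
      simpa using hb.2 i
    · have := D.mono _ _ hg (happ (fun i => - ∑ p ∈ (Finset.HasAntidiagonal.antidiagonal k).erase (0, k),
        coeff p.1 (u i) * D.ι i (seqRec c p.2)) i)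
      rw [sub_neg_eq_add] at this
      exact this
  · rw [coeff_mk, hc]; simp

theorem x_pow_mem (g : ℕ) : D.x ^ g ∈ D.W g := by
  induction g with
  | zero => exact ⟨by simp, fun i => by simpa using D.one⟩
  | succ g ih => exact ⟨pow_mem D.xB _, fun i => by
      rw [pow_succ, map_mul]; push_cast; exact D.omul _ _ _ _ (ih.2 i) (D.xO i)⟩

theorem t_pow_mem (g : ℕ) : D.t ^ g ∈ D.O (-g) := by
  induction g with
  | zero => simpa using D.one
  | succ g ih => 
    rw [pow_succ]; push_cast; rw [neg_add]; exact D.omul _ _ _ _ ih D.tO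

theorem W_split (g : ℕ) (g' : ℤ) (hg : g + D.g1 ≤ g') (b : L) (hb : b ∈ D.W (g + g')) :
    ∃ c ∈ D.W g', ∃ e ∈ D.W g', b = D.x ^ g * c + e := by
  obtain ⟨c, hcB, hc⟩ := D.approx (fun i => D.t ^ g * D.ι i b)
  have h1 : c ∈ D.W g' := by
    refine ⟨hcB, fun i => ?_⟩
    have h := D.omul _ _ _ _ (D.t_pow_mem g) (hb.2 i)
    have := add_mem (D.mono _ g' (by omega) (hc i)) (D.mono _ g' (by omega) h)
    simpa using this
  refine ⟨c, h1, b - D.x ^ g * c, ⟨sub_mem hb.1 (mul_mem (pow_mem D.xB _) hcB), fun i => ?_⟩,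
    by ring⟩
  have h2 : D.ι i (b - D.x ^ g * c) = - (D.ι i (D.x ^ g) * (D.ι i c - D.t ^ g * D.ι i b)) := by
    have : D.ι i D.x ^ g * D.t ^ g = 1 := by rw [← mul_pow, mul_comm, D.tx, one_pow]
    rw [map_sub, map_mul, map_pow]
    linear_combination (-D.ι i b) * this
  rw [h2]
  exact neg_mem (D.mono _ _ hg (D.omul _ _ _ _ ((D.x_pow_mem g).2 i) (hc i)))

/-- span of all sections -/
def V (u : I → T⟦X⟧) : Submodule E L⟦X⟧ := ⨆ g : ℤ, D.M u g

theorem M_le_V (u : I → T⟦X⟧) (g : ℤ) : D.M u g ≤ D.V u := le_iSup _ g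

theorem mem_V {u : I → T⟦X⟧} {h : L⟦X⟧} (hh : h ∈ D.V u) : ∃ g, h ∈ D.M u g := by
  rwa [V, Submodule.mem_iSup_of_directed] at hh
  exact (monotone_int_of_le_succ (fun g => D.M_mono u (by omega))).directed_le

theorem mem_V_pow {u : I → T⟦X⟧} (n : ℕ) {h : L⟦X⟧} (hh : h ∈ D.V u ^ n) :
    ∃ g, h ∈ D.M (u ^ n) g := by
  induction n generalizing h with
  | zero =>
    rw [pow_zero] at hh
    obtain ⟨e, rfl⟩ := Submodule.mem_one.mp hh
    have : (1 : L⟦X⟧) ∈ D.M (u ^ 0) 0 := by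
      refine ⟨fun k => ?_, fun i k => ?_⟩
      · rw [coeff_one]; split_ifs <;> simp
      · rw [pow_zero, Pi.one_apply, one_mul, map_one, coeff_one]
        split_ifs
        · exact D.one
        · simp
    exact ⟨0, by rw [Algebra.algebraMap_eq_smul_one]; exact Submodule.smul_mem _ _ this⟩
  | succ n ih =>
    rw [pow_succ] at hh
    induction hh using Submodule.mul_induction_on' with
    | mem_mul_mem a ha b hb =>
      obtain ⟨g, hg⟩ := ih ha
      obtain ⟨g', hg'⟩ := D.mem_V hb
      exact ⟨g + g', by rw [pow_succ]; exact D.M_mul hg hg'⟩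
    | add a _ b _ ha hb =>
      obtain ⟨g, hg⟩ := ha
      obtain ⟨g', hg'⟩ := hb
      exact ⟨max g g', add_mem (D.M_mono _ (le_max_left _ _) hg) (D.M_mono _ (le_max_right _ _) hg')⟩

theorem exists_lead (u : I → T⟦X⟧) (hu : ∀ i, coeff 0 (u i) = 1) (m : ℕ) (g' : ℤ)
    (hg : 2 * D.g1 ≤ g') (b : L) (hb : b ∈ D.W (m * D.g1 + g')) :
    ∃ h ∈ D.M (u ^ (m + 1)) (m * D.g1 + g'), h ∈ D.V u ^ (m + 1) ∧ coeff 0 h = b := by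
  induction m generalizing b with
  | zero =>
    obtain ⟨h, h1, h2⟩ := D.exists_M u hu g' (by omega) b (by simpa using hb)
    exact ⟨h, by simpa using h1, by simpa using D.M_le_V u _ h1, h2⟩
  | succ m ih =>
    have e : ((m + 1 : ℕ) : ℤ) * D.g1 + g' = D.g1 + (m * D.g1 + g') := by push_cast; ring
    have hm : (0 : ℤ) ≤ m * D.g1 := by positivity
    rw [e] at hb ⊢
    obtain ⟨c, hc, d, hd, rfl⟩ := D.W_split D.g1 _ (by linarith) b hb
    obtain ⟨Hc, hc1, hc2, hc3⟩ := ih c hc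
    obtain ⟨Hd, hd1, hd2, hd3⟩ := ih d hd
    obtain ⟨h1, h11, h12⟩ := D.exists_M u hu D.g1 le_rfl _ (D.x_pow_mem D.g1)
    obtain ⟨h0, h01, h02⟩ := D.exists_M u hu D.g1 le_rfl 1
      (⟨one_mem _, fun i => D.mono 0 _ (by omega) (by simpa using D.one)⟩ :
        (1 : L) ∈ D.W D.g1)
    refine ⟨h1 * Hc + h0 * Hd, ?_, ?_, ?_⟩
    · rw [pow_succ']
      exact add_mem (D.M_mul h11 hc1) (D.M_mul h01 hd1)
    · rw [pow_succ']
      exact add_mem (Submodule.mul_mem_mul (D.M_le_V _ _ h11) hc2)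
        (Submodule.mul_mem_mul (D.M_le_V _ _ h01) hd2)
    · simp only [map_add]
      simp only [coeff_zero_eq_constantCoeff, map_mul] at *
      rw [h12, hc3, h02, hd3, one_mul]

theorem M_step {u : I → T⟦X⟧} {g : ℤ} {h : L⟦X⟧} (hh : X * h ∈ D.M u g) : h ∈ D.M u g := by
  refine ⟨fun k => ?_, fun i k => ?_⟩
  · have := hh.1 (k + 1)
    rwa [coeff_succ_X_mul] at this
  · have := hh.2 i (k + 1)
    have e : u i * map (D.ι i : L →+* T) (X * h) = X * (u i * map (D.ι i : L →+* T) h) := by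
      rw [map_mul, map_X, mul_left_comm]
    rwa [e, coeff_succ_X_mul] at this

theorem generation (u : I → T⟦X⟧) (hu : ∀ i, coeff 0 (u i) = 1) (m : ℕ) (g' : ℤ)
    (hg : 2 * D.g1 ≤ g') [Module.Finite E (D.W (m * D.g1 + g'))] (h : L⟦X⟧)
    (hh : h ∈ D.M (u ^ (m + 1)) (m * D.g1 + g')) :
    ∃ (r : ℕ) (c : Fin r → E⟦X⟧) (p : Fin r → L⟦X⟧), (∀ j, p j ∈ D.V u ^ (m + 1)) ∧
      h = ∑ j, map (algebraMap E L) (c j) * p j := by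
  set G := (m * D.g1 + g' : ℤ) with hG
  let w := Module.finBasis E (D.W G)
  choose p hp1 hp2 hp3 using fun j => D.exists_lead u hu m g' hg (w j : L) (w j).2
  let S := {h : L⟦X⟧ // h ∈ D.M (u ^ (m + 1)) G}
  have lead : ∀ s : S, coeff 0 s.1 ∈ D.W G := by
    intro s
    refine ⟨s.2.1 0, fun i => ?_⟩
    have := s.2.2 i 0
    have h0 : constantCoeff (u i) = 1 := by rw [← hu i]; simp
    rw [coeff_zero_eq_constantCoeff_apply, map_mul, ← coeff_zero_eq_constantCoeff_apply (map _ _),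
      coeff_map, Pi.pow_apply, map_pow, h0, one_pow, one_mul] at this
    exact this
  let a : Fin _ → S → E := fun j s => w.repr ⟨_, lead s⟩ j
  have ha : ∀ s : S, coeff 0 s.1 = ∑ j, a j s • (w j : L) := by
    intro s
    have := congrArg Subtype.val (w.sum_repr ⟨_, lead s⟩)
    refine this.symm.trans ?_
    rw [Submodule.coe_sum]
    rfl
  have step : ∀ s : S, ∃ s' : S, s.1 - ∑ j, a j s • p j = X * s'.1 := by
    intro s
    have h1 : constantCoeff (s.1 - ∑ j, a j s • p j) = 0 := by
      rw [← coeff_zero_eq_constantCoeff_apply, map_sub, ha, map_sum]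
      simp only [coeff_smul, hp3, sub_self]
    obtain ⟨h', hh'⟩ := X_dvd_iff.mpr h1
    refine ⟨⟨h', D.M_step ?_⟩, hh'⟩
    rw [← hh']
    exact sub_mem s.2 (sum_mem fun j _ => Submodule.smul_mem _ _ (hp1 j))
  choose nx hnx using step
  let c : Fin _ → S → E⟦X⟧ := fun j s => PowerSeries.mk fun k => a j (nx^[k] s)
  have hc : ∀ j s, c j s = C (a j s) + X * c j (nx s) := by
    intro j s
    ext k
    cases k with
    | zero => simp [c]
    | succ k => simp [c]
  let e : S → L⟦X⟧ := fun s => s.1 - ∑ j, map (algebraMap E L) (c j s) * p j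
  have he : ∀ s, e s = X * e (nx s) := by
    intro s
    have h1 : ∀ j, map (algebraMap E L) (c j s) * p j =
        a j s • p j + X * (map (algebraMap E L) (c j (nx s)) * p j) := by
      intro j
      rw [hc, map_add, map_mul, map_X, map_C, add_mul, smul_eq_C_mul_aux, mul_assoc]
    simp only [e, h1, Finset.sum_add_distrib, ← Finset.mul_sum, mul_sub, ← hnx]
    ring
  have he' : ∀ k s, e s = X ^ k * e (nx^[k] s) := by
    intro k
    induction k with
    | zero => intro s; simp
    | succ k ih => intro s; rw [ih, he, Function.iterate_succ_apply', pow_succ, mul_assoc]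
  have he0 : ∀ s, e s = 0 := by
    intro s
    ext k
    rw [he' (k + 1), coeff_X_pow_mul', if_neg (by omega), map_zero]
  exact ⟨_, fun j => c j ⟨h, hh⟩, p, hp2, sub_eq_zero.mp (he0 ⟨h, hh⟩)⟩

end FD
end Abs
end PD

namespace PD
open scoped TensorProduct

open PowerSeries

section Theta

variable {E L : Type*} [Field E] [Field L] [Algebra E L]

noncomputable def theta (E L : Type*) [Field E] [Field L] [Algebra E L] :
    E⟦X⟧ ⊗[E] L →ₐ[E] L⟦X⟧ :=
  Algebra.TensorProduct.lift (PowerSeries.mapAlgHom (Algebra.ofId E L))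
    (IsScalarTower.toAlgHom E L L⟦X⟧) (fun _ _ => Commute.all _ _)

theorem theta_tmul (p : E⟦X⟧) (l : L) :
    theta E L (p ⊗ₜ l) = map (algebraMap E L) p * C l := by
  simp only [theta, Algebra.TensorProduct.lift_tmul]
  rfl

theorem coeff_theta_tmul (p : E⟦X⟧) (l : L) (k : ℕ) :
    coeff k (theta E L (p ⊗ₜ l)) = coeff k p • l := by
  rw [theta_tmul, coeff_mul_C, coeff_map, Algebra.smul_def]

theorem theta_injective : Function.Injective (theta E L) := by
  rw [injective_iff_map_eq_zero]
  intro z hz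
  let b := Module.Basis.ofVectorSpace E L
  let bS := b.baseChange E⟦X⟧
  have key : ∀ (z : E⟦X⟧ ⊗[E] L) (k : ℕ) i, coeff k (bS.repr z i) = b.repr (coeff k (theta E L z)) i := by
    intro z k i
    induction z with
    | zero => simp
    | tmul a n => 
      rw [coeff_theta_tmul]
      simp only [bS, Module.Basis.baseChange_repr_tmul, map_smul, Finsupp.smul_apply]
      simp [mul_comm]
    | add x y hx hy => simp only [map_add, Finsupp.add_apply, hx, hy]
  apply bS.repr.injective
  ext i k
  rw [key, hz]
  simp

theorem exists_theta (W : Submodule E L) [Module.Finite E W] (h : L⟦X⟧) (hh : ∀ k, coeff k h ∈ W) :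
    ∃ γ, theta E L γ = h := by
  let w := Module.finBasis E W
  refine ⟨∑ j, (PowerSeries.mk fun k => w.repr ⟨_, hh k⟩ j) ⊗ₜ (w j : L), ?_⟩
  ext k
  rw [map_sum, map_sum]
  simp only [coeff_theta_tmul, coeff_mk]
  have := congrArg Subtype.val (w.sum_repr ⟨_, hh k⟩)
  rw [Submodule.coe_sum] at this
  exact this

end Theta

namespace FD

variable {E L T I : Type*} [Field E] [Field L] [CommRing T] [Algebra E L] [Algebra E T]
    [Fintype I] (D : FD E L T I)

theorem coeff_mem_W {u q : I → T⟦X⟧} (hq : ∀ i, q i * u i = 1) (hqO : ∀ i k, coeff k (q i) ∈ D.O 1)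
    {G : ℤ} {h : L⟦X⟧} (hh : h ∈ D.M u G) (k : ℕ) : coeff k h ∈ D.W (1 + G) := by
  refine ⟨hh.1 k, fun i => ?_⟩
  have : map (D.ι i : L →+* T) h = q i * (u i * map (D.ι i : L →+* T) h) := by
    rw [← mul_assoc, hq, one_mul]
  have h2 := congrArg (coeff k) this
  rw [coeff_map] at h2
  change D.ι i (coeff k h) = _ at h2
  rw [h2, coeff_mul]
  exact sum_mem fun p _ => D.omul _ _ _ _ (hqO i _) (hh.2 i _)

theorem main {K : Type*} [CommRing K] [Algebra E K] (κ : E⟦X⟧ →ₐ[E] K) (hκ : Function.Injective κ)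
    (u q : I → T⟦X⟧) (m : ℕ) (hu : ∀ i, coeff 0 (u i) = 1)
    (hq : ∀ i, q i * (u ^ (m + 1)) i = 1) (hqO : ∀ i k, coeff k (q i) ∈ D.O 1)
    (hfin : ∀ g, Module.Finite E (D.W g)) (Δ : Ideal (K ⊗[E] L))
    (H1 : ∀ γ G, theta E L γ ∈ D.M (u ^ (m + 1)) G → tmap L κ γ ∈ Δ)
    (H2 : Δ ≤ Ideal.span {z | ∃ γ G, theta E L γ ∈ D.M (u ^ (m + 1)) G ∧ tmap L κ γ = z}) :
    ∃ (f : K ⊗[E] L) (J : Ideal (K ⊗[E] L)), f ≠ 0 ∧ Ideal.span {f} * Δ = J ^ (m + 1) := by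
  have lift : ∀ G h, h ∈ D.M (u ^ (m + 1)) G → ∃ γ, theta E L γ = h := fun G h hh =>
    exists_theta (D.W (1 + G)) h (D.coeff_mem_W hq hqO hh)
  have liftV : ∀ h ∈ D.V u ^ (m + 1), ∃ γ, theta E L γ = h := fun h hh => by
    obtain ⟨g, hg⟩ := D.mem_V_pow _ hh
    exact lift g h hg
  obtain ⟨h0, h01, h02⟩ := D.exists_M u hu D.g1 le_rfl 1
      (⟨one_mem _, fun i => D.mono 0 _ (by omega) (by simpa using D.one)⟩ :
        (1 : L) ∈ D.W D.g1)
  have h0V := D.M_le_V u _ h01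
  obtain ⟨φ, hφ⟩ := liftV (h0 ^ (m + 1)) (Submodule.pow_mem_pow _ h0V _)
  let V' : Submodule E (E⟦X⟧ ⊗[E] L) :=
    (Submodule.span E {h0 ^ m} * D.V u).comap (theta E L).toLinearMap
  have hV' : V'.map (theta E L).toLinearMap = Submodule.span E {h0 ^ m} * D.V u := by
    apply Submodule.map_comap_eq_of_le
    intro h hh
    have : h ∈ D.V u ^ (m + 1) := by
      rw [pow_succ]
      refine (mul_le_mul' (a := Submodule.span E {h0 ^ m}) ?_ (le_refl (D.V u))) hh
      rw [Submodule.span_le, Set.singleton_subset_iff]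
      exact Submodule.pow_mem_pow _ h0V _
    obtain ⟨γ, hγ⟩ := liftV h this
    exact ⟨γ, hγ⟩
  have hV'n : (V' ^ (m + 1)).map (theta E L).toLinearMap =
      Submodule.span E {(h0 ^ (m + 1)) ^ m} * D.V u ^ (m + 1) := by
    rw [Submodule.map_pow, hV', mul_pow, Submodule.span_pow, Set.singleton_pow, ← pow_mul, ← pow_mul,
      mul_comm m]
  let J : Ideal (K ⊗[E] L) := Ideal.span ((tmap L κ) '' V')
  have hJ : ∀ k, ∀ γ ∈ V' ^ k, tmap L κ γ ∈ J ^ k := by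
    intro k
    induction k with
    | zero => intro γ _; rw [pow_zero, Ideal.one_eq_top]; trivial
    | succ k ih =>
      intro γ hγ
      rw [pow_succ] at hγ ⊢
      induction hγ using Submodule.mul_induction_on' with
      | mem_mul_mem a ha b hb =>
        rw [map_mul]
        exact Ideal.mul_mem_mul (ih a ha) (Ideal.subset_span ⟨b, hb, rfl⟩)
      | add a _ b _ ha hb => rw [map_add]; exact add_mem ha hb
  have hJ2 : ∀ k, J ^ k ≤ Ideal.span ((tmap L κ) '' (V' ^ k : Submodule E _)) := by
    intro k
    induction k with
    | zero =>
      rw [pow_zero, pow_zero, Ideal.one_eq_top, top_le_iff, Ideal.eq_top_iff_one]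
      exact Ideal.subset_span ⟨1, Submodule.one_le.mp le_rfl, map_one _⟩
    | succ k ih =>
      rw [pow_succ]
      refine (Ideal.mul_mono_left ih).trans ?_
      rw [Ideal.span_mul_span', Ideal.span_le]
      rintro _ ⟨_, ⟨a, ha, rfl⟩, _, ⟨b, hb, rfl⟩, rfl⟩
      refine Ideal.subset_span ⟨a * b, ?_, map_mul _ _ _⟩
      rw [pow_succ]
      exact Submodule.mul_mem_mul ha hb
  refine ⟨tmap L κ (φ ^ m), J, ?_, le_antisymm ?_ ?_⟩
  · intro h
    rw [← map_zero (tmap L κ)] at h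
    have h3 := congrArg (theta E L) (tmap_injective (N := L) κ hκ h)
    rw [map_pow, hφ, map_zero] at h3
    have h4 := congrArg (constantCoeff (R := L)) h3
    rw [coeff_zero_eq_constantCoeff] at h02
    rw [map_pow, map_pow, h02] at h4
    simp at h4
  · refine (Ideal.mul_mono_right H2).trans ?_
    rw [Ideal.span_mul_span', Ideal.span_le]
    rintro _ ⟨_, rfl, _, ⟨γ, G, hγ, rfl⟩, rfl⟩
    let g' : ℤ := max (2 * D.g1) G
    have := hfin (m * D.g1 + g')
    have hm : (0 : ℤ) ≤ m * D.g1 := by positivity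
    obtain ⟨r, c, p, hp, hs⟩ := D.generation u hu m g' (le_max_left _ _) (theta E L γ)
      (D.M_mono _ (by have := le_max_right (2 * (D.g1 : ℤ)) G; change G ≤ m * D.g1 + max _ _; linarith) hγ)
    have h5 : ∀ j, ∃ γ' ∈ V' ^ (m + 1), theta E L γ' = (h0 ^ (m + 1)) ^ m * p j := by
      intro j
      have : (h0 ^ (m + 1)) ^ m * p j ∈ (V' ^ (m + 1)).map (theta E L).toLinearMap := by
        rw [hV'n]
        exact Submodule.mul_mem_mul (Submodule.mem_span_singleton_self _) (hp j)
      exact this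
    choose γ' hγ' hγ'' using h5
    have h6 : φ ^ m * γ = ∑ j, (c j ⊗ₜ (1 : L)) * γ' j := by
      apply theta_injective
      rw [map_mul, map_pow, hφ, hs, Finset.mul_sum, map_sum]
      refine Finset.sum_congr rfl fun j _ => ?_
      rw [map_mul, hγ'', theta_tmul, map_one]
      ring
    change tmap L κ (φ ^ m) * tmap L κ γ ∈ J ^ (m + 1)
    rw [← map_mul, h6, map_sum]
    refine sum_mem fun j _ => ?_
    rw [map_mul]
    exact Ideal.mul_mem_left _ _ (hJ _ _ (hγ' j))
  · refine (hJ2 _).trans ?_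
    rw [Ideal.span_le]
    rintro _ ⟨γ, hγ, rfl⟩
    have h7 : theta E L γ ∈ (V' ^ (m + 1)).map (theta E L).toLinearMap := ⟨γ, hγ, rfl⟩
    rw [hV'n, Submodule.mem_span_singleton_mul] at h7
    obtain ⟨p, hp, hp2⟩ := h7
    obtain ⟨γ', hγ'⟩ := liftV p hp
    have h8 : γ = φ ^ m * γ' := by
      apply theta_injective
      rw [map_mul, map_pow, hφ, hγ', hp2]
    obtain ⟨g, hg⟩ := D.mem_V_pow _ hp
    rw [h8, map_mul]
    exact Ideal.mul_mem_mul (Ideal.mem_span_singleton_self _) (H1 γ' g (by rwa [hγ']))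

end FD
end PD

namespace PD
open scoped TensorProduct

open PowerSeries

section Laurent

/-- Laurent series (with the coefficientwise algebra structure). -/
def Lau (E : Type*) [Field E] : Type _ := HahnSeries ℤ E

variable {E : Type*} [Field E]

noncomputable instance : Field (Lau E) := inferInstanceAs (Field (HahnSeries ℤ E))
noncomputable instance : Algebra E (Lau E) := HahnSeries.instAlgebra (Γ := ℤ) (R := E) (A := E)

namespace Lau

def co (f : Lau E) (k : ℤ) : E := HahnSeries.coeff (f : HahnSeries ℤ E) k

noncomputable def tpow (k : ℤ) : Lau E := (HahnSeries.single k (1 : E) : HahnSeries ℤ E)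

noncomputable def ofPS : E⟦X⟧ →ₐ[E] Lau E := HahnSeries.ofPowerSeriesAlg ℤ E

theorem ext_co {f g : Lau E} (h : ∀ k, co f k = co g k) : f = g := HahnSeries.ext (funext h)

@[simp] theorem co_add (f g : Lau E) (k) : co (f + g) k = co f k + co g k := HahnSeries.coeff_add
@[simp] theorem co_neg (f : Lau E) (k) : co (- f) k = - co f k := HahnSeries.coeff_neg
@[simp] theorem co_sub (f g : Lau E) (k) : co (f - g) k = co f k - co g k := HahnSeries.coeff_sub
@[simp] theorem co_zero (k) : co (0 : Lau E) k = 0 := rfl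
@[simp] theorem co_smul (c : E) (f : Lau E) (k) : co (c • f) k = c * co f k := by
  exact HahnSeries.coeff_smul (Γ := ℤ)
@[simp] theorem co_tpow_mul (j : ℤ) (f : Lau E) (k) : co (tpow j * f) k = co f (k - j) := by
  refine HahnSeries.coeff_single_mul.trans ?_
  rw [one_mul]; rfl
theorem co_tpow (j k : ℤ) : co (tpow j : Lau E) k = if k = j then 1 else 0 := by
  refine HahnSeries.coeff_single.trans ?_
  congr
theorem tpow_mul (j k : ℤ) : (tpow j * tpow k : Lau E) = tpow (j + k) := by
  refine HahnSeries.single_mul_single.trans ?_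
  rw [one_mul]; rfl
theorem tpow_zero : (tpow 0 : Lau E) = 1 := rfl
theorem tpow_ne_zero (j : ℤ) : (tpow j : Lau E) ≠ 0 := by
  intro h
  have := tpow_mul (E := E) (-j) j
  rw [h, mul_zero, neg_add_cancel, tpow_zero] at this
  exact one_ne_zero this.symm
theorem co_ofPS (p : E⟦X⟧) (k : ℤ) :
    co (ofPS p) k = if k < 0 then 0 else PowerSeries.coeff k.natAbs p :=
  PowerSeries.coeff_coe p k
theorem ofPS_injective : Function.Injective (ofPS (E := E)) := 
  HahnSeries.ofPowerSeries_injective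
theorem ofPS_X : ofPS (X : E⟦X⟧) = tpow 1 := HahnSeries.ofPowerSeries_X
theorem tpow_pow (j : ℤ) (n : ℕ) : (tpow j : Lau E) ^ n = tpow (n * j) := by
  induction n with
  | zero => simp [tpow_zero]
  | succ n ih => rw [pow_succ, ih, tpow_mul]; congr 1; push_cast; ring

theorem exists_bound (f : Lau E) : ∃ N : ℕ, ∀ k < -(N : ℤ), co f k = 0 := by
  refine ⟨(HahnSeries.order (f : HahnSeries ℤ E)).natAbs, fun k hk => ?_⟩
  refine HahnSeries.coeff_eq_zero_of_lt_order (x := f) ?_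
  omega

end Lau
open Lau

/-- Laurent series with pole order at most `g`. -/
def pole (E : Type*) [Field E] (g : ℤ) : Submodule E (Lau E) where
  carrier := {f | ∀ k < -g, co f k = 0}
  add_mem' := fun {a b} ha hb k hk => by rw [co_add, ha k hk, hb k hk, add_zero]
  zero_mem' := fun k _ => co_zero k
  smul_mem' := fun c a ha k hk => by rw [co_smul, ha k hk, mul_zero]

theorem mem_pole {f : Lau E} {g : ℤ} : f ∈ pole E g ↔ ∀ k < -g, co f k = 0 := Iff.rfl

theorem pole_iff {f : Lau E} {g : ℤ} : f ∈ pole E g ↔ ∃ p : E⟦X⟧, f = tpow (-g) * ofPS p := by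
  constructor
  · intro h
    refine ⟨PowerSeries.mk fun k => co f (k - g), ext_co fun k => ?_⟩
    rw [co_tpow_mul, co_ofPS]
    split_ifs with hk
    · exact h k (by omega)
    · rw [coeff_mk]; congr 1; omega
  · rintro ⟨p, rfl⟩ k hk
    rw [co_tpow_mul, co_ofPS, if_pos (by omega)]

theorem pole_mul {f f' : Lau E} {g g' : ℤ} (h : f ∈ pole E g) (h' : f' ∈ pole E g') :
    f * f' ∈ pole E (g + g') := by
  obtain ⟨p, rfl⟩ := pole_iff.mp h
  obtain ⟨p', rfl⟩ := pole_iff.mp h'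
  refine pole_iff.mpr ⟨p * p', ?_⟩
  rw [neg_add, ← tpow_mul, map_mul]; ring

theorem pole_mono {g h : ℤ} (hg : g ≤ h) : pole E g ≤ pole E h :=
  fun _ hf k hk => hf k (by omega)

theorem tpow_mem (j : ℤ) : (tpow j : Lau E) ∈ pole E (-j) := 
  pole_iff.mpr ⟨1, by rw [map_one, mul_one, neg_neg]⟩

theorem one_mem_pole : (1 : Lau E) ∈ pole E 0 := by simpa [tpow_zero] using tpow_mem (E := E) 0

theorem tail (p : E⟦X⟧) (N : ℕ) :
    ofPS p - ∑ k ∈ Finset.range N, coeff k p • tpow (k : ℤ) ∈ pole E (-N) := by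
  intro k hk
  have hs : ∀ (s : Finset ℕ) (F : ℕ → Lau E), co (∑ i ∈ s, F i) k = ∑ i ∈ s, co (F i) k := by
    intro s F
    induction s using Finset.cons_induction with
    | empty => simp
    | cons a s ha ih => rw [Finset.sum_cons, Finset.sum_cons, co_add, ih]
  rw [co_sub, co_ofPS, hs]
  simp only [co_smul, co_tpow]
  split_ifs with h
  · rw [Finset.sum_eq_zero, sub_zero]
    intro i _
    rw [if_neg (by omega), mul_zero]
  · rw [Finset.sum_eq_single k.natAbs]
    · rw [if_pos (by omega), mul_one, sub_self]
    · intro i _ hi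
      rw [if_neg (by omega), mul_zero]
    · intro hi
      exact absurd (Finset.mem_range.mpr (by omega)) hi

theorem co_sum {α : Type*} (s : Finset α) (F : α → Lau E) (k : ℤ) :
    co (∑ i ∈ s, F i) k = ∑ i ∈ s, co (F i) k := by
  induction s using Finset.cons_induction with
  | empty => simp
  | cons a s ha ih => rw [Finset.sum_cons, Finset.sum_cons, co_add, ih]

theorem co_ofPS_mul (p : E⟦X⟧) (f : Lau E) (m : ℤ) :
    ∃ N0 : ℕ, ∀ N ≥ N0, co (ofPS p * f) m = ∑ k ∈ Finset.range N, coeff k p * co f (m - k) := by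
  obtain ⟨g, hg⟩ := exists_bound f
  refine ⟨(m + g + 1).natAbs, fun N hN => ?_⟩
  have h1 := pole_mul (tail p N) (mem_pole.mpr hg) m (by omega)
  rw [sub_mul, co_sub, Finset.sum_mul, co_sum, sub_eq_zero] at h1
  rw [h1]
  refine Finset.sum_congr rfl fun k _ => ?_
  rw [smul_mul_assoc, co_smul, co_tpow_mul]

end Laurent
end PD

namespace PD
open scoped TensorProduct

open PowerSeries Lau

section Concrete

theorem exists_root {R : Type*} [CommRing R] [Algebra ℚ R] (a : R) (m : ℕ) :
    ∃ w : R⟦X⟧, coeff 0 w = 1 ∧ (1 - C a * X) * w ^ (m + 1) = 1 := by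
  have key : ∀ j : ℕ, binomialSeries R (-1 / ((m : ℚ) + 1)) ^ j =
      binomialSeries R ((j : ℚ) * (-1 / ((m : ℚ) + 1))) := by
    intro j
    induction j with
    | zero => simp
    | succ j ih => rw [pow_succ, ih, ← binomialSeries_add]; congr 1; push_cast; ring
  refine ⟨rescale (-a) (binomialSeries R (-1 / ((m : ℚ) + 1))), ?_, ?_⟩
  · rw [coeff_rescale, pow_zero, one_mul]
    simpa using binomialSeries_constantCoeff (A := R) (-1 / ((m : ℚ) + 1))
  · have h1 : (1 + X : R⟦X⟧) * binomialSeries R (-1 / ((m : ℚ) + 1)) ^ (m + 1) = 1 := by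
      have h2 : (1 + X : R⟦X⟧) = binomialSeries R ((1 : ℕ) : ℚ) := by
        rw [binomialSeries_nat, pow_one]
      rw [key, h2, ← binomialSeries_add]
      have : (((1 : ℕ) : ℚ) + ((m + 1 : ℕ) : ℚ) * (-1 / ((m : ℚ) + 1))) = 0 := by
        have : (m : ℚ) + 1 ≠ 0 := by positivity
        push_cast; field_simp; ring
      rw [this, binomialSeries_zero]
    have h3 := congrArg (rescale (-a)) h1
    rw [map_mul, map_pow, map_one, map_add, map_one, rescale_X] at h3
    rw [sub_eq_add_neg, ← neg_mul, ← map_neg]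
    exact h3

variable {E L I : Type*} [Field E] [Field L] [Algebra E L] [Fintype I]

theorem exists_pole_bound (f : I → Lau E) : ∃ N : ℕ, ∀ i, f i ∈ pole E N := by
  choose N hN using fun i => exists_bound (f i)
  refine ⟨Finset.univ.sup N, fun i => ?_⟩
  refine pole_mono (g := N i) ?_ (mem_pole.mpr (hN i))
  exact_mod_cast Finset.le_sup (f := N) (Finset.mem_univ i)

/-- The telescoping identity. -/
theorem telescope {T : Type*} [CommRing T] (t x : T) (htx : t * x = 1) (Y H : T⟦X⟧)
    (h : (1 - C x * X) * Y = H) (N : ℕ) :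
    ∑ k ∈ Finset.range (N + 1), t ^ k * coeff k H = t ^ N * coeff N Y := by
  have h0 : ∀ k, coeff (k + 1) H = coeff (k + 1) Y - x * coeff k Y := by
    intro k
    rw [← h, sub_mul, one_mul, map_sub, mul_assoc, coeff_C_mul, mul_comm X, coeff_succ_mul_X]
  induction N with
  | zero =>
    rw [← h, sub_mul]; simp [mul_assoc]
  | succ N ih =>
    rw [Finset.sum_range_succ, ih, h0]
    linear_combination (t ^ N * coeff N Y) * (- htx)

noncomputable def mu (ι : L →ₐ[E] Lau E) : Lau E ⊗[E] L →ₐ[E] Lau E :=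
  Algebra.TensorProduct.lift (AlgHom.id E _) ι (fun _ _ => Commute.all _ _)

theorem mu_tmul (ι : L →ₐ[E] Lau E) (a : Lau E) (l : L) : mu ι (a ⊗ₜ l) = a * ι l := by
  simp [mu]

theorem co_mu (ι : L →ₐ[E] Lau E) (γ : E⟦X⟧ ⊗[E] L) (m : ℤ) :
    ∃ N0 : ℕ, ∀ N ≥ N0, co (mu ι (tmap L ofPS γ)) m =
      ∑ k ∈ Finset.range N, co (ι (coeff k (theta E L γ))) (m - k) := by
  induction γ using TensorProduct.induction_on with
  | zero => exact ⟨0, fun N _ => by simp⟩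
  | tmul p l =>
    obtain ⟨N0, h⟩ := co_ofPS_mul p (ι l) m
    refine ⟨N0, fun N hN => ?_⟩
    have : tmap L ofPS (p ⊗ₜ[E] l) = ofPS p ⊗ₜ l := by simp
    rw [this, mu_tmul, h N hN]
    refine Finset.sum_congr rfl fun k _ => ?_
    rw [coeff_theta_tmul, map_smul, co_smul]
  | add a b ha hb =>
    obtain ⟨N1, h1⟩ := ha
    obtain ⟨N2, h2⟩ := hb
    refine ⟨max N1 N2, fun N hN => ?_⟩
    rw [map_add, map_add, co_add, h1 N (le_trans (le_max_left _ _) hN),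
      h2 N (le_trans (le_max_right _ _) hN), ← Finset.sum_add_distrib]
    refine Finset.sum_congr rfl fun k _ => ?_
    rw [map_add, map_add, map_add, co_add]

theorem d1 [CharZero E] (D : FD E L (Lau E) I) (hO : D.O = pole E) (ht : D.t = tpow 1) (i0 : I)
    (hfrac : ∀ l : L, ∃ b ∈ D.B, ∃ c ∈ D.B, c ≠ 0 ∧ l * c = b)
    (hfin : ∀ g, Module.Finite E (D.W g)) (m : ℕ) :
    ∃ (f : Lau E ⊗[E] L) (J : Ideal (Lau E ⊗[E] L)), f ≠ 0 ∧
      Ideal.span {f} * RingHom.ker (mu (D.ι i0)) = J ^ (m + 1) := by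
  classical
  let _ : Algebra ℚ (Lau E) := ((algebraMap E (Lau E)).comp (algebraMap ℚ E)).toAlgebra
  obtain ⟨w, hw0, hw⟩ := exists_root (D.ι i0 D.x) m
  have htx : tpow 1 * D.ι i0 D.x = 1 := ht ▸ D.tx i0
  let u : I → (Lau E)⟦X⟧ := fun i => if i = i0 then w else 1
  let q : I → (Lau E)⟦X⟧ := fun i => if i = i0 then (1 - C (D.ι i0 D.x) * X) else 1
  have hq : ∀ i, q i * (u ^ (m + 1)) i = 1 := by
    intro i
    simp only [q, u, Pi.pow_apply]
    split_ifs
    · exact hw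
    · simp
  have h1P : ∀ g : ℤ, 0 ≤ g → (1 : Lau E) ∈ pole E g := fun g hg => pole_mono hg one_mem_pole
  have tpow_nat : ∀ k : ℕ, (tpow 1 : Lau E) ^ k = tpow k := fun k => by
    rw [tpow_pow, mul_one]
  refine D.main ofPS ofPS_injective u q m ?_ hq ?_ hfin _ ?_ ?_
  · intro i
    simp only [u]; split_ifs
    · exact hw0
    · simp
  · intro i k
    rw [hO]
    have h1 : coeff k (1 : (Lau E)⟦X⟧) ∈ pole E 1 := by
      rw [coeff_one]; split_ifs
      · exact h1P 1 (by norm_num)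
      · exact zero_mem _
    simp only [q]; split_ifs
    · rw [map_sub, coeff_C_mul]
      refine sub_mem h1 ?_
      rw [coeff_X]; split_ifs
      · rw [mul_one, ← hO]; exact D.xO i0
      · rw [mul_zero]; exact zero_mem _
    · exact h1
  · intro γ G hγ
    rw [RingHom.mem_ker]
    refine ext_co fun j => ?_
    obtain ⟨N0, hN⟩ := co_mu (D.ι i0) γ j
    have h2 := hN (N0 + (j + G).natAbs + 1 + 1) (by omega)
    change co (mu (D.ι i0) (tmap L ofPS γ)) j = _
    rw [h2, co_zero]
    have h3 := telescope (tpow 1) _ htx ((u ^ (m + 1)) i0 * map (D.ι i0 : L →+* Lau E) (theta E L γ))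
      (map (D.ι i0 : L →+* Lau E) (theta E L γ)) (by
        rw [← mul_assoc]
        have := hq i0
        simp only [q, if_true] at this
        rw [this, one_mul]) (N0 + (j + G).natAbs + 1)
    have h4 := congrArg (fun z => co z j) h3
    simp only [co_sum, coeff_map, tpow_nat, co_tpow_mul] at h4
    refine Eq.trans h4 ?_
    have h5 := hγ.2 i0 (N0 + (j + G).natAbs + 1)
    rw [hO] at h5
    exact h5 _ (by omega)
  · set J := Ideal.span {z | ∃ γ G, theta E L γ ∈ D.M (u ^ (m + 1)) G ∧ tmap L ofPS γ = z} with hJ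
    let δ : L → Lau E ⊗[E] L := fun l => D.ι i0 l ⊗ₜ 1 - 1 ⊗ₜ l
    have hB : ∀ b ∈ D.B, δ b ∈ J := by
      intro b hb
      obtain ⟨N, hN⟩ := exists_pole_bound fun i => D.ι i b
      obtain ⟨r, hr⟩ := pole_iff.mp (hN i0)
      have hr' : ofPS r = tpow N * D.ι i0 b := by
        rw [hr, ← mul_assoc, tpow_mul, add_neg_cancel, tpow_zero, one_mul]
      have hco : ∀ k, coeff k (theta E L (r ⊗ₜ 1 - (X ^ N) ⊗ₜ b)) =
          algebraMap E L (coeff k r) - if k = N then b else 0 := by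
        intro k
        rw [map_sub, map_sub, coeff_theta_tmul, coeff_theta_tmul, coeff_X_pow,
          Algebra.algebraMap_eq_smul_one]
        split_ifs <;> simp
      have hι : ∀ i k, D.ι i (coeff k (theta E L (r ⊗ₜ 1 - (X ^ N) ⊗ₜ b))) =
          coeff k r • (1 : Lau E) - if k = N then D.ι i b else 0 := by
        intro i k
        rw [hco, map_sub, AlgHom.commutes, Algebra.algebraMap_eq_smul_one]
        split_ifs <;> simp
      have hmem : theta E L (r ⊗ₜ 1 - (X ^ N) ⊗ₜ b) ∈ D.M (u ^ (m + 1)) N := by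
        refine ⟨fun k => ?_, fun i k => ?_⟩
        · rw [hco]
          refine sub_mem (D.B.algebraMap_mem _) ?_
          split_ifs
          · exact hb
          · exact zero_mem _
        · rw [hO]
          by_cases hi : i = i0
          · subst hi
            have h3 := telescope (tpow 1) _ htx
              ((u ^ (m + 1)) i * map (D.ι i : L →+* Lau E) (theta E L (r ⊗ₜ 1 - (X ^ N) ⊗ₜ b)))
              (map (D.ι i : L →+* Lau E) (theta E L (r ⊗ₜ 1 - (X ^ N) ⊗ₜ b))) (by
              rw [← mul_assoc]
              have := hq i
              simp only [q, if_true] at this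
              rw [this, one_mul]) k
            have h4 : ∀ j, coeff j (map (D.ι i : L →+* Lau E)
              (theta E L (r ⊗ₜ 1 - (X ^ N) ⊗ₜ b))) = coeff j r • (1 : Lau E) - if j = N then D.ι i b else 0 := by
              intro j; rw [coeff_map]; exact hι i j
            simp only [h4, mul_sub, Finset.sum_sub_distrib] at h3
            set Y := coeff k ((u ^ (m + 1)) i * map (D.ι i : L →+* Lau E)
              (theta E L (r ⊗ₜ 1 - (X ^ N) ⊗ₜ b))) with hY
            have h5 : Y = tpow (-k) * (tpow 1 ^ k * Y) := by
              rw [tpow_nat, ← mul_assoc, tpow_mul, neg_add_cancel, tpow_zero, one_mul]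
            rw [h5, ← h3]
            have h6 : ∀ j : ℕ, (tpow 1 : Lau E) ^ j * coeff j r • (1 : Lau E) = coeff j r • tpow (j : ℤ) := by
              intro j; rw [tpow_nat, mul_smul_comm, mul_one]
            simp only [h6]
            have hk : (tpow (-k) : Lau E) ∈ pole E k := by simpa using tpow_mem (E := E) (-k)
            by_cases hkN : N ≤ k
            · rw [Finset.sum_eq_single_of_mem (s := Finset.range (k + 1))
                (f := fun j => tpow 1 ^ j * if j = N then D.ι i b else 0) N (Finset.mem_range.mpr (by omega))
                (by intro j _ hj; simp [hj])]
              rw [if_pos rfl, tpow_nat, ← hr']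
              have h7 := neg_mem (tail r (k + 1))
              rw [neg_sub] at h7
              exact pole_mono (by push_cast; omega) (pole_mul hk h7)
            · rw [Finset.sum_eq_zero (s := Finset.range (k + 1))
                (f := fun j => tpow 1 ^ j * if j = N then D.ι i b else 0)
                (by intro j hj; rw [if_neg (by have := Finset.mem_range.mp hj; omega), mul_zero]), sub_zero]
              refine pole_mono (g := k + 0) (by omega) (pole_mul hk ?_)
              exact sum_mem fun j _ => Submodule.smul_mem _ _ (pole_mono (by omega) (tpow_mem _))
          · simp only [Pi.pow_apply, u, if_neg hi, one_pow, one_mul, coeff_map]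
            refine (hι i k) ▸ sub_mem (Submodule.smul_mem _ _ (h1P _ (by omega))) ?_
            split_ifs
            · exact hN i
            · exact zero_mem _
      have h8 : tmap L ofPS (r ⊗ₜ 1 - (X ^ N) ⊗ₜ b) = (tpow N ⊗ₜ 1) * δ b := by
        simp only [δ, mul_sub, map_sub, Algebra.TensorProduct.map_tmul, map_pow, ofPS_X, tpow_nat, hr',
          Algebra.TensorProduct.tmul_mul_tmul, mul_one, one_mul]
        simp
      have h9 : δ b = (tpow (-N) ⊗ₜ 1) * ((tpow N ⊗ₜ 1) * δ b) := by
        rw [← mul_assoc, Algebra.TensorProduct.tmul_mul_tmul, tpow_mul, neg_add_cancel, tpow_zero,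
          mul_one, ← Algebra.TensorProduct.one_def, one_mul]
      rw [h9]
      refine Ideal.mul_mem_left _ _ (Ideal.subset_span ⟨_, N, hmem, h8⟩)
    have hL : ∀ l, δ l ∈ J := by
      intro l
      obtain ⟨b, hb, c, hc, hc0, rfl⟩ := hfrac l
      have e1 : ((D.ι i0 c) ⊗ₜ 1) * δ l = δ (l * c) - (1 ⊗ₜ l) * δ c := by
        simp only [δ, mul_sub, map_mul, Algebra.TensorProduct.tmul_mul_tmul, mul_one, one_mul]
        rw [mul_comm (D.ι i0 c)]; abel
      have e2 : δ l = ((D.ι i0 c)⁻¹ ⊗ₜ 1) * (((D.ι i0 c) ⊗ₜ 1) * δ l) := by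
        rw [← mul_assoc, Algebra.TensorProduct.tmul_mul_tmul, inv_mul_cancel₀ (by simpa using hc0),
          mul_one, ← Algebra.TensorProduct.one_def, one_mul]
      rw [e2, e1]
      exact Ideal.mul_mem_left _ _ (sub_mem (hB _ hb) (Ideal.mul_mem_left _ _ (hB _ hc)))
    intro z hz
    have h10 : ∀ z : Lau E ⊗[E] L, z - (mu (D.ι i0) z) ⊗ₜ 1 ∈ J := by
      intro z
      induction z using TensorProduct.induction_on with
      | zero => simp
      | tmul a l =>
        have : a ⊗ₜ[E] l - (mu (D.ι i0) (a ⊗ₜ[E] l)) ⊗ₜ 1 = - ((a ⊗ₜ 1) * δ l) := by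
          simp [δ, mul_sub, mu_tmul]
        rw [this]
        exact neg_mem (Ideal.mul_mem_left _ _ (hL l))
      | add a b ha hb =>
        have : a + b - (mu (D.ι i0) (a + b)) ⊗ₜ 1 = (a - (mu (D.ι i0) a) ⊗ₜ[E] (1 : L)) +
          (b - (mu (D.ι i0) b) ⊗ₜ[E] (1 : L)) := by
          rw [map_add, TensorProduct.add_tmul]; abel
        rw [this]; exact add_mem ha hb
    have h11 := h10 z
    rw [RingHom.mem_ker] at hz
    have hz' : mu (D.ι i0) z = 0 := hz
    rwa [hz', TensorProduct.zero_tmul, sub_zero] at h11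

end Concrete
end PD

namespace PD
open scoped TensorProduct

open PowerSeries Lau

section CurveData

variable {E L : Type*} [Field E] [Field L] [Algebra E L]

theorem aeval_tpow (c : Polynomial E) : Polynomial.aeval (tpow (-1) : Lau E) c =
    ∑ k ∈ Finset.range (c.natDegree + 1), c.coeff k • tpow (-(k : ℤ)) := by
  rw [Polynomial.aeval_eq_sum_range]
  refine Finset.sum_congr rfl fun k _ => ?_
  rw [tpow_pow]; congr 2; ring

theorem co_aeval_tpow (c : Polynomial E) (k : ℕ) :
    co (Polynomial.aeval (tpow (-1) : Lau E) c) (-(k : ℤ)) = c.coeff k := by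
  rw [aeval_tpow, co_sum]
  simp only [co_smul, co_tpow]
  by_cases hk : k ≤ c.natDegree
  · rw [Finset.sum_eq_single_of_mem k (Finset.mem_range.mpr (by omega))]
    · simp
    · intro j _ hj; rw [if_neg (by omega), mul_zero]
  · rw [Polynomial.coeff_eq_zero_of_natDegree_lt (by omega)]
    refine Finset.sum_eq_zero fun j hj => ?_
    have := Finset.mem_range.mp hj
    rw [if_neg (by omega), mul_zero]

theorem exists_polar (f : Lau E) :
    ∃ c : Polynomial E, Polynomial.aeval (tpow (-1) : Lau E) c - f ∈ pole E 0 := by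
  obtain ⟨N, hN⟩ := exists_bound f
  let c : Polynomial E := ∑ k ∈ Finset.range (N + 1), Polynomial.monomial k (co f (-(k : ℤ)))
  refine ⟨c, fun k hk => ?_⟩
  obtain ⟨j, rfl⟩ : ∃ j : ℕ, k = -(j : ℤ) := ⟨k.natAbs, by omega⟩
  rw [co_sub, co_aeval_tpow]
  simp only [c, Polynomial.finsetSum_coeff, Polynomial.coeff_monomial]
  by_cases hj : j ≤ N
  · rw [Finset.sum_eq_single_of_mem j (Finset.mem_range.mpr (by omega))]
    · simp
    · intro i _ hi; rw [if_neg (by omega)]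
  · rw [hN _ (by omega), sub_zero]
    refine Finset.sum_eq_zero fun i hi => ?_
    have := Finset.mem_range.mp hi
    rw [if_neg (by omega)]

theorem aeval_reflect {t : L} (ht : t ≠ 0) (g : Polynomial E) (M : ℕ) (hM : g.natDegree ≤ M) :
    Polynomial.aeval t⁻¹ (Polynomial.reflect M g) = Polynomial.aeval t g * t⁻¹ ^ M := by
  let _ : Invertible t := invertibleOfNonzero ht
  have h := Polynomial.eval₂_reflect_mul_pow (algebraMap E L) t M g hM
  rw [invOf_eq_inv] at h
  rw [Polynomial.aeval_def, Polynomial.aeval_def, ← h, mul_assoc, ← mul_pow,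
    mul_inv_cancel₀ ht, one_pow, mul_one]

theorem rep_B {d : ℕ} (x w : L) (h : Fin d → Polynomial E)
    (hw : w ^ d + ∑ j, Polynomial.aeval x (h j) * w ^ (j : ℕ) = 0) (b : L)
    (hb : b ∈ Algebra.adjoin E {x, w}) :
    ∃ c : Fin d → Polynomial E, b = ∑ j, Polynomial.aeval x (c j) * w ^ (j : ℕ) := by
  let Φ : Polynomial (Polynomial E) →+* L :=
    Polynomial.eval₂RingHom (Polynomial.aeval x : Polynomial E →ₐ[E] L).toRingHom w
  have hΦ : ∃ p, Φ p = b := by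
    induction hb using Algebra.adjoin_induction with
    | mem z hz =>
      rcases hz with rfl | hz
      · exact ⟨Polynomial.C Polynomial.X, by simp [Φ]⟩
      · rw [Set.mem_singleton_iff] at hz; subst hz
        exact ⟨Polynomial.X, by simp [Φ]⟩
    | algebraMap r => exact ⟨Polynomial.C (Polynomial.C r), by simp [Φ]⟩
    | add a b _ _ ha hb =>
      obtain ⟨p, rfl⟩ := ha; obtain ⟨q, rfl⟩ := hb; exact ⟨p + q, map_add _ _ _⟩
    | mul a b _ _ ha hb =>
      obtain ⟨p, rfl⟩ := ha; obtain ⟨q, rfl⟩ := hb; exact ⟨p * q, map_mul _ _ _⟩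
  obtain ⟨p, hp⟩ := hΦ
  let G : Polynomial (Polynomial E) :=
    Polynomial.X ^ d + ∑ j : Fin d, Polynomial.C (h j) * Polynomial.X ^ (j : ℕ)
  have hG : G.Monic := Polynomial.monic_X_pow_add (Polynomial.degree_sum_fin_lt _)
  have hGd : G.natDegree = d := by
    have h2 : G.degree = d := by
      refine (Polynomial.degree_add_eq_left_of_degree_lt ?_).trans (Polynomial.degree_X_pow d)
      rw [Polynomial.degree_X_pow]; exact Polynomial.degree_sum_fin_lt h
    exact Polynomial.natDegree_eq_of_degree_eq_some h2
  have hG0 : Φ G = 0 := by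
    rw [← hw]
    simp only [G, map_add, map_sum, map_mul, map_pow]
    simp [Φ]
  refine ⟨fun j => (p %ₘ G).coeff j, ?_⟩
  have h1 : b = Φ (p %ₘ G) := by
    rw [← hp, ← Polynomial.modByMonic_add_div p G, map_add, map_mul, hG0, zero_mul, add_zero,
      Polynomial.modByMonic_add_div]
  rcases Nat.eq_zero_or_pos d with hd | hd
  · have : (1 : L) = 0 := by subst hd; simpa using hw
    exact absurd this one_ne_zero
  have h2 : (p %ₘ G).natDegree < d := by
    have := Polynomial.natDegree_modByMonic_lt p hG (by
      intro h1; rw [h1, Polynomial.natDegree_one] at hGd; omega)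
    omega
  rw [h1]
  change Polynomial.eval₂ _ _ _ = _
  rw [Polynomial.eval₂_eq_sum_range' _ h2, Finset.sum_range]
  rfl

theorem exists_FD {d : ℕ} (ι : Fin d → L →ₐ[E] Lau E) (t y : L) (ht : ∀ i, ι i t = tpow 1)
    (η : Fin d → E⟦X⟧) (hy : ∀ i, ι i y = ofPS (η i))
    (hη : Function.Injective fun i => constantCoeff (η i)) (hd : 0 < d)
    (g : Fin d → Polynomial E)
    (hG : y ^ d + ∑ j, Polynomial.aeval t (g j) * y ^ (j : ℕ) = 0)
    (hgen : IntermediateField.adjoin E {t, y} = ⊤) :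
    ∃ D : FD E L (Lau E) (Fin d), D.ι = ι ∧ D.O = pole E ∧ D.t = tpow 1 ∧
      (∀ l : L, ∃ b ∈ D.B, ∃ c ∈ D.B, c ≠ 0 ∧ l * c = b) ∧ (∀ n, Module.Finite E (D.W n)) := by
  classical
  have ht0 : t ≠ 0 := by
    rintro rfl
    have := ht ⟨0, hd⟩
    rw [map_zero] at this
    exact tpow_ne_zero 1 this.symm
  obtain ⟨N, hN⟩ : ∃ N : ℕ, ∀ j, (g j).natDegree ≤ N :=
    ⟨Finset.univ.sup fun j => (g j).natDegree, fun j =>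
      Finset.le_sup (f := fun j => (g j).natDegree) (Finset.mem_univ j)⟩
  set x := t⁻¹ with hx
  set w := y * x ^ N with hw
  have htx : t * x = 1 := mul_inv_cancel₀ ht0
  have hιx : ∀ i, ι i x = tpow (-1) := fun i => by
    have h1 : (tpow 1 : Lau E) * ι i x = 1 := by rw [← ht i, ← map_mul, htx, map_one]
    have h2 : (tpow (-1) : Lau E) * tpow 1 = 1 := by rw [tpow_mul]; exact tpow_zero
    calc ι i x = (tpow (-1) * tpow 1) * ι i x := by rw [h2, one_mul]
      _ = tpow (-1) := by rw [mul_assoc, h1, mul_one]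
  have hιw : ∀ i, ι i w = tpow (-(N : ℤ)) * ofPS (η i) := fun i => by
    rw [hw, map_mul, map_pow, hιx, hy, tpow_pow, mul_comm]; congr 2; ring
  have hrel : w ^ d + ∑ j : Fin d, Polynomial.aeval x (Polynomial.reflect (N * (d - j)) (g j)) *
      w ^ (j : ℕ) = 0 := by
    have h1 : ∀ j : Fin d, Polynomial.aeval x (Polynomial.reflect (N * (d - j)) (g j)) * w ^ (j : ℕ) =
        (Polynomial.aeval t (g j) * y ^ (j : ℕ)) * x ^ (N * d) := by
      intro j
      rw [hx, aeval_reflect ht0, ← hx, hw]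
      · have : N * d = N * (d - j) + N * j := by
          rw [← mul_add]; congr 1; omega
        rw [this, pow_add, mul_pow, ← pow_mul]; ring
      · refine (hN j).trans (Nat.le_mul_of_pos_right _ (by omega))
    rw [Finset.sum_congr rfl fun j _ => h1 j, ← Finset.sum_mul, hw, mul_pow, ← pow_mul, ← add_mul, hG,
      zero_mul]
  -- Vandermonde
  let V : Matrix (Fin d) (Fin d) E⟦X⟧ := Matrix.vandermonde η
  have hV : IsUnit V.det := by
    rw [Matrix.det_vandermonde, isUnit_iff_constantCoeff, isUnit_iff_ne_zero]
    rw [map_prod]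
    refine Finset.prod_ne_zero_iff.mpr fun i _ => ?_
    rw [map_prod]
    refine Finset.prod_ne_zero_iff.mpr fun j hj => ?_
    rw [map_sub, sub_ne_zero]
    intro h
    have := hη h
    subst this
    simp at hj
  have hVV : V * V⁻¹ = 1 := Matrix.mul_nonsing_inv _ hV
  have hVV' : V⁻¹ * V = 1 := Matrix.nonsing_inv_mul _ hV
  let V1 : Matrix (Fin d) (Fin d) (Lau E) := V.map ofPS
  let V2 : Matrix (Fin d) (Fin d) (Lau E) := V⁻¹.map ofPS
  have h12 : V1 * V2 = 1 := by
    have : V1 * V2 = (V * V⁻¹).map (ofPS : E⟦X⟧ →ₐ[E] Lau E) := by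
      rw [Matrix.map_mul]
    rw [this, hVV, Matrix.map_one _ (map_zero _) (map_one _)]
  have h21 : V2 * V1 = 1 := by
    have : V2 * V1 = (V⁻¹ * V).map (ofPS : E⟦X⟧ →ₐ[E] Lau E) := by
      rw [Matrix.map_mul]
    rw [this, hVV', Matrix.map_one _ (map_zero _) (map_one _)]
  have hps : ∀ p : E⟦X⟧, ofPS p ∈ pole E 0 := fun p => pole_iff.mpr ⟨p, by
    rw [neg_zero, tpow_zero, one_mul]⟩
  have hιb : ∀ (c : Fin d → Polynomial E) (i : Fin d),
      ι i (∑ j, Polynomial.aeval x (c j) * w ^ (j : ℕ)) =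
      ∑ j : Fin d, V1 i j * (Polynomial.aeval (tpow (-1) : Lau E) (c j) * tpow (-((N * j : ℕ) : ℤ))) := by
    intro c i
    rw [map_sum]
    refine Finset.sum_congr rfl fun j _ => ?_
    rw [map_mul, map_pow, hιw, ← Polynomial.aeval_algHom_apply, hιx, mul_pow, tpow_pow]
    have : V1 i j = ofPS (η i) ^ (j : ℕ) := by
      simp [V1, V, Matrix.vandermonde_apply]
    rw [this]
    have : ((j : ℕ) : ℤ) * -(N : ℤ) = -((N * j : ℕ) : ℤ) := by push_cast; ring
    rw [this]; ring
  let D : FD E L (Lau E) (Fin d) :=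
    { ι := ι
      B := Algebra.adjoin E {x, w}
      O := pole E
      mono := fun g h hg => pole_mono (E := E) hg
      omul := fun g h a b ha hb => pole_mul ha hb
      one := one_mem_pole
      x := x
      xB := Algebra.subset_adjoin (by simp)
      xO := fun i => by rw [hιx]; simpa using tpow_mem (E := E) (-1)
      t := tpow 1
      tO := tpow_mem (E := E) 1
      tx := fun i => by rw [hιx, tpow_mul]; exact tpow_zero
      g1 := N * d
      approx := fun v => by
        let e := V2.mulVec v
        have he : V1.mulVec e = v := by rw [Matrix.mulVec_mulVec, h12, Matrix.one_mulVec]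
        choose c hc using fun j : Fin d => exists_polar (e j * tpow ((N * j : ℕ) : ℤ))
        refine ⟨∑ j, Polynomial.aeval x (c j) * w ^ (j : ℕ), ?_, fun i => ?_⟩
        · refine sum_mem fun j _ => mul_mem ?_ (pow_mem (Algebra.subset_adjoin (by simp)) _)
          exact Algebra.adjoin_mono (by simp) (Polynomial.aeval_mem_adjoin_singleton E x)
        · have h3 : v i = ∑ j, V1 i j * e j := by rw [← congrFun he i]; rfl
          rw [hιb, h3, ← Finset.sum_sub_distrib]
          refine sum_mem fun j _ => ?_
          have h4 : V1 i j * (Polynomial.aeval (tpow (-1) : Lau E) (c j) * tpow (-((N * j : ℕ) : ℤ))) -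
            V1 i j * e j = V1 i j * ((Polynomial.aeval (tpow (-1) : Lau E) (c j) -
              e j * tpow ((N * j : ℕ) : ℤ)) * tpow (-((N * j : ℕ) : ℤ))) := by
            rw [sub_mul, mul_assoc (e j), tpow_mul, add_neg_cancel, tpow_zero, mul_one, mul_sub]
          rw [h4]
          refine pole_mono ?_ (pole_mul (hps _) (pole_mul (hc j) (tpow_mem _)))
          have : N * (j : ℕ) ≤ N * d := Nat.mul_le_mul_left _ (by omega)
          push_cast at this ⊢
          zify at this
          linarith }
  refine ⟨D, rfl, rfl, rfl, fun l => ?_, fun n => ?_⟩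
  · have hl : l ∈ IntermediateField.adjoin E ({x, w} : Set L) := by
      have h5 : IntermediateField.adjoin E ({t, y} : Set L) ≤ IntermediateField.adjoin E ({x, w} : Set L) := by
        rw [IntermediateField.adjoin_le_iff]
        have hxm : x ∈ IntermediateField.adjoin E ({x, w} : Set L) :=
          IntermediateField.subset_adjoin _ _ (by simp)
        have hwm : w ∈ IntermediateField.adjoin E ({x, w} : Set L) :=
          IntermediateField.subset_adjoin _ _ (by simp)
        have htm : t ∈ IntermediateField.adjoin E ({x, w} : Set L) := by
          have := inv_mem hxm
          rwa [hx, inv_inv] at this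
        have hym : y ∈ IntermediateField.adjoin E ({x, w} : Set L) := by
          have : y = w * t ^ N := by
            rw [hw, mul_assoc, ← mul_pow, mul_comm x, htx, one_pow, mul_one]
          rw [this]; exact mul_mem hwm (pow_mem htm _)
        rintro z (rfl | hz)
        · exact htm
        · rw [Set.mem_singleton_iff] at hz; subst hz; exact hym
      apply h5; rw [hgen]; trivial
    obtain ⟨r, hr, s, hs, rfl⟩ := IntermediateField.mem_adjoin_iff_div.mp hl
    by_cases hs0 : s = 0
    · exact ⟨0, zero_mem _, 1, one_mem _, one_ne_zero, by simp [hs0]⟩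
    · exact ⟨r, hr, s, hs, hs0, div_mul_cancel₀ _ hs0⟩
  · let S : Finset L := (Finset.range (n.toNat + 1) ×ˢ (Finset.univ : Finset (Fin d))).image
      fun p => x ^ p.1 * w ^ (p.2 : ℕ)
    have hle : D.W n ≤ Submodule.span E (S : Set L) := by
      rintro b ⟨hb, hbi⟩
      obtain ⟨c, rfl⟩ := rep_B x w _ hrel b hb
      have hbi' : ∀ i, ∑ j : Fin d, V1 i j * (Polynomial.aeval (tpow (-1) : Lau E) (c j) *
          tpow (-((N * j : ℕ) : ℤ))) ∈ pole E n := fun i => by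
        rw [← hιb]; exact hbi i
      let e : Fin d → Lau E := fun j => Polynomial.aeval (tpow (-1) : Lau E) (c j) *
          tpow (-((N * j : ℕ) : ℤ))
      have he : ∀ j, e j ∈ pole E n := fun j => by
        have h6 : e = V2.mulVec (V1.mulVec e) := by
          rw [Matrix.mulVec_mulVec, h21, Matrix.one_mulVec]
        rw [h6]
        change ∑ i, V2 j i * V1.mulVec e i ∈ _
        refine sum_mem fun i _ => ?_
        refine pole_mono (g := 0 + n) (by simp) (pole_mul (hps _) ?_)
        exact hbi' i
      have hc : ∀ j k, n.toNat < k → (c j).coeff k = 0 := fun j k hk => by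
        rw [← co_aeval_tpow]
        have h7 : Polynomial.aeval (tpow (-1) : Lau E) (c j) = e j * tpow ((N * j : ℕ) : ℤ) := by
          simp only [e]; rw [mul_assoc, tpow_mul, neg_add_cancel, tpow_zero, mul_one]
        rw [h7]
        refine pole_mono (h := n) ?_ (pole_mul (he j) (tpow_mem _)) _ (by omega)
        omega
      refine sum_mem fun j _ => ?_
      rw [Polynomial.aeval_eq_sum_range' (n := n.toNat + 1), Finset.sum_mul]
      · refine sum_mem fun k hk => ?_
        rw [smul_mul_assoc]
        refine Submodule.smul_mem _ _ (Submodule.subset_span ?_)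
        exact Finset.mem_coe.mpr (Finset.mem_image.mpr ⟨(k, j), by simpa using hk, rfl⟩)
      · rw [Nat.lt_succ_iff, Polynomial.natDegree_le_iff_coeff_eq_zero]
        exact fun k hk => hc j k hk
    have : FiniteDimensional E (Submodule.span E (S : Set L)) := FiniteDimensional.span_finset E S
    exact Submodule.finiteDimensional_of_le hle

end CurveData
end PD

namespace PD
open scoped TensorProduct

open PowerSeries Lau

section CurveData2

theorem hensel_ps {E : Type*} [Field E] (f : Polynomial E⟦X⟧) (hf : f.Monic) (ρ : E)
    (h0 : (f.map (constantCoeff (R := E))).IsRoot ρ)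
    (h1 : (f.map (constantCoeff (R := E))).derivative.eval ρ ≠ 0) :
    ∃ η : E⟦X⟧, f.IsRoot η ∧ constantCoeff η = ρ := by
  have hev : ∀ p : Polynomial E⟦X⟧, constantCoeff (p.eval (C ρ)) =
      (p.map (constantCoeff (R := E))).eval ρ := by
    intro p
    rw [Polynomial.eval_map]
    have := Polynomial.hom_eval₂ p (RingHom.id _) (constantCoeff (R := E)) (C ρ)
    rw [RingHom.comp_id] at this
    simpa using this
  obtain ⟨η, hη, hη'⟩ := HenselianRing.is_henselian (I := Ideal.span {(X : E⟦X⟧)}) f hf (C ρ) (by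
    rw [Ideal.mem_span_singleton, X_dvd_iff, hev]; exact h0) (by
    refine IsUnit.map _ ?_
    rw [isUnit_iff_constantCoeff, hev, ← Polynomial.derivative_map]
    exact isUnit_iff_ne_zero.mpr h1)
  refine ⟨η, hη, ?_⟩
  rw [Ideal.mem_span_singleton, X_dvd_iff, map_sub, sub_eq_zero] at hη'
  rw [hη']; simp

variable {E L : Type*} [Field E] [Field L] [Algebra E L]

theorem d1_exists [IsAlgClosed E] [CharZero E] (F0 : Type*) [Field F0] [Algebra (Polynomial E) F0]
    [IsFractionRing (Polynomial E) F0] [Algebra E F0] [IsScalarTower E (Polynomial E) F0]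
    [Algebra (Polynomial E) L] [IsScalarTower E (Polynomial E) L] [Algebra F0 L]
    [IsScalarTower (Polynomial E) F0 L] [FiniteDimensional F0 L] :
    ∃ ι : L →ₐ[E] Lau E, ∀ m, ∃ (f : Lau E ⊗[E] L) (J : Ideal (Lau E ⊗[E] L)), f ≠ 0 ∧
      Ideal.span {f} * RingHom.ker (mu ι) = J ^ (m + 1) := by
  classical
  have : CharZero F0 := charZero_of_injective_algebraMap (FaithfulSMul.algebraMap_injective E F0)
  have : IsScalarTower E F0 L := IsScalarTower.of_algebraMap_eq fun r => by
    rw [IsScalarTower.algebraMap_apply E (Polynomial E) L, IsScalarTower.algebraMap_apply (Polynomial E) F0 L,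
      IsScalarTower.algebraMap_apply E (Polynomial E) F0]
  obtain ⟨α, hα⟩ := Field.exists_primitive_element F0 L
  have hαalg : IsAlgebraic (Polynomial E) α :=
    (IsFractionRing.isAlgebraic_iff (Polynomial E) F0 L).mpr (Algebra.IsAlgebraic.isAlgebraic α)
  obtain ⟨c, hc0, hyint⟩ := hαalg.exists_integral_multiple
  set y := c • α with hy
  have hyF : IsIntegral F0 y := Algebra.IsIntegral.isIntegral y
  have hadj : IntermediateField.adjoin F0 {y} = ⊤ := by
    rw [eq_top_iff, ← hα, IntermediateField.adjoin_simple_le_iff]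
    have hc0' : algebraMap (Polynomial E) F0 c ≠ 0 := by
      simpa using hc0
    have : α = (algebraMap (Polynomial E) F0 c)⁻¹ • y := by
      rw [hy, ← IsScalarTower.algebraMap_smul F0 c α, smul_smul, inv_mul_cancel₀ hc0', one_smul]
    rw [this]
    exact IntermediateField.smul_mem _ (IntermediateField.mem_adjoin_simple_self _ _)
  have hadj' : Algebra.adjoin F0 {y} = ⊤ := by
    rw [← IntermediateField.adjoin_simple_toSubalgebra_of_isAlgebraic hyF.isAlgebraic, hadj]; rfl
  set G := minpoly (Polynomial E) y with hGdef
  have hGm : G.Monic := minpoly.monic hyint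
  have hGF : minpoly F0 y = G.map (algebraMap (Polynomial E) F0) :=
    minpoly.isIntegrallyClosed_eq_field_fractions' F0 hyint
  have hsep : (G.map (algebraMap (Polynomial E) F0)).Separable := by
    rw [← hGF]; exact (minpoly.irreducible hyF).separable
  -- a nonzero element of the resultant ideal
  obtain ⟨U, V, r, hr0, hUV⟩ : ∃ (U V : Polynomial (Polynomial E)) (r : Polynomial E), r ≠ 0 ∧
      U * G + V * G.derivative = Polynomial.C r := by
    obtain ⟨a, b, hab⟩ := hsep
    obtain ⟨ba, hba', hba⟩ := IsLocalization.integerNormalization_spec (nonZeroDivisors (Polynomial E)) a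
    obtain ⟨bb, hbb', hbb⟩ := IsLocalization.integerNormalization_spec (nonZeroDivisors (Polynomial E)) b
    set A := IsLocalization.integerNormalization (nonZeroDivisors (Polynomial E)) a
    set B := IsLocalization.integerNormalization (nonZeroDivisors (Polynomial E)) b
    refine ⟨Polynomial.C (bb : Polynomial E) * A, Polynomial.C (ba : Polynomial E) * B,
      (ba : Polynomial E) * bb, mul_ne_zero (nonZeroDivisors.ne_zero hba') (nonZeroDivisors.ne_zero hbb'), ?_⟩
    refine Polynomial.map_injective (algebraMap (Polynomial E) F0) (IsFractionRing.injective _ _) ?_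
    rw [Polynomial.derivative_map] at hab
    simp only [Polynomial.map_add, Polynomial.map_mul, Polynomial.map_C, hba, hbb, map_mul]
    have e1 : ∀ (s : Polynomial E) (p : Polynomial F0), s • p = Polynomial.C (algebraMap (Polynomial E) F0 s) * p := by
      intro s p; rw [← Polynomial.smul_eq_C_mul, IsScalarTower.algebraMap_smul]
    rw [e1, e1]
    linear_combination (Polynomial.C (algebraMap (Polynomial E) F0 ba) * Polynomial.C (algebraMap (Polynomial E) F0 bb)) * hab
  obtain ⟨a, ha⟩ : ∃ a, r.eval a ≠ 0 := by
    by_contra! h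
    exact hr0 (Polynomial.funext (by simpa using h))
  let Ga := G.map (Polynomial.evalRingHom a)
  have hGam : Ga.Monic := hGm.map _
  have hGasep : Ga.Separable := by
    have h1 := congrArg (Polynomial.map (Polynomial.evalRingHom a)) hUV
    simp only [Polynomial.map_add, Polynomial.map_mul, Polynomial.map_C, ← Polynomial.derivative_map] at h1
    change _ * Ga + _ * Polynomial.derivative Ga = Polynomial.C (r.eval a) at h1
    refine ⟨Polynomial.C (r.eval a)⁻¹ * U.map (Polynomial.evalRingHom a),
      Polynomial.C (r.eval a)⁻¹ * V.map (Polynomial.evalRingHom a), ?_⟩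
    have h2 : Polynomial.C (r.eval a)⁻¹ * Polynomial.C (r.eval a) = (1 : Polynomial E) := by
      rw [← Polynomial.C_mul, inv_mul_cancel₀ ha, Polynomial.C_1]
    rw [← h2, ← h1]; ring
  let d := G.natDegree
  have hcard : Ga.roots.toFinset.card = d := by
    rw [Multiset.toFinset_card_of_nodup (Polynomial.nodup_roots hGasep), IsAlgClosed.card_roots_eq_natDegree,
      hGm.natDegree_map]
  let σ : Polynomial E →ₐ[E] E⟦X⟧ := Polynomial.aeval (X + C a)
  have hσX : σ (Polynomial.X - Polynomial.C a) = X := by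
    have : algebraMap E E⟦X⟧ a = C a := rfl
    simp [σ, this]
  have hσc : (constantCoeff (R := E)).comp (σ : Polynomial E →+* E⟦X⟧) = Polynomial.evalRingHom a := by
    refine Polynomial.ringHom_ext (fun e => ?_) ?_
    · have : algebraMap E E⟦X⟧ e = C e := rfl
      simp [σ, this]
    · simp [σ]
  have hmapc : (G.map (σ : Polynomial E →+* E⟦X⟧)).map (constantCoeff (R := E)) = Ga := by
    rw [Polynomial.map_map, hσc]
  have hroots : ∀ ρ : Ga.roots.toFinset, ∃ η : E⟦X⟧, (G.map (σ : Polynomial E →+* E⟦X⟧)).IsRoot η ∧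
      constantCoeff η = ρ := by
    rintro ⟨ρ, hρ⟩
    have hρ' : Ga.IsRoot ρ := by
      rw [Multiset.mem_toFinset] at hρ; exact Polynomial.isRoot_of_mem_roots hρ
    refine hensel_ps _ (hGm.map _) ρ (by rw [hmapc]; exact hρ') (by
      rw [hmapc]
      obtain ⟨p, q, hpq⟩ := hGasep
      intro h
      have := congrArg (Polynomial.eval ρ) hpq
      rw [Polynomial.eval_add, Polynomial.eval_mul, Polynomial.eval_mul, hρ', h] at this
      simp at this)
  choose η' hη1 hη2 using hroots
  let e : Fin d ≃ Ga.roots.toFinset := (Finset.equivFinOfCardEq hcard).symm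
  let η : Fin d → E⟦X⟧ := fun i => η' (e i)
  -- the embeddings
  let φ : Polynomial E →ₐ[E] Lau E := ofPS.comp σ
  have hφ : Function.Injective φ := by
    refine ofPS_injective.comp ?_
    rw [injective_iff_map_eq_zero]
    intro p hp
    have h3 : σ p = ((p.comp (Polynomial.X + Polynomial.C a) : Polynomial E) : E⟦X⟧) := by
      have : σ = (Polynomial.coeToPowerSeries.algHom E).comp (Polynomial.aeval (Polynomial.X + Polynomial.C a)) := by
        refine Polynomial.algHom_ext ?_
        simp [σ]
      rw [this]
      simp [Polynomial.comp, Polynomial.aeval_def]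
    have hp : σ p = 0 := hp
    rw [h3, Polynomial.coe_eq_zero_iff] at hp
    have h4 := congrArg (fun q => Polynomial.comp q (Polynomial.X - Polynomial.C a)) hp
    simpa [Polynomial.comp_assoc] using h4
  let ψ : F0 →ₐ[E] Lau E := IsFractionRing.liftAlgHom hφ
  have hψ : ∀ p, ψ (algebraMap (Polynomial E) F0 p) = φ p := fun p => IsFractionRing.lift_algebraMap hφ p
  let _ : Algebra F0 (Lau E) := ψ.toRingHom.toAlgebra
  have hst : IsScalarTower E F0 (Lau E) := IsScalarTower.of_algebraMap_eq fun r => (ψ.commutes r).symm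
  let pb := PowerBasis.ofAdjoinEqTop hyF hadj'
  have hpbg : pb.gen = y := PowerBasis.ofAdjoinEqTop_gen hyF hadj'
  have hlift : ∀ i, Polynomial.aeval (ofPS (η i)) (minpoly F0 pb.gen) = 0 := by
    intro i
    rw [hpbg, hGF, Polynomial.aeval_def, Polynomial.eval₂_map]
    have h5 : (algebraMap F0 (Lau E)).comp (algebraMap (Polynomial E) F0) =
      (ofPS : E⟦X⟧ →ₐ[E] Lau E).toRingHom.comp (σ : Polynomial E →+* E⟦X⟧) := RingHom.ext fun p => hψ p
    rw [h5]
    have h6 := hη1 (e i)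
    rw [Polynomial.IsRoot.def, Polynomial.eval_map] at h6
    have h7 := congrArg (ofPS : E⟦X⟧ →ₐ[E] Lau E).toRingHom h6
    rw [Polynomial.hom_eval₂, map_zero] at h7
    exact h7
  let ι : Fin d → L →ₐ[E] Lau E := fun i => (pb.lift (ofPS (η i)) (hlift i)).restrictScalars E
  have hιy : ∀ i, ι i y = ofPS (η i) := fun i => by
    have := pb.lift_gen (ofPS (η i)) (hlift i)
    rw [hpbg] at this
    exact this
  have hιp : ∀ i p, ι i (algebraMap (Polynomial E) L p) = φ p := fun i p => by
    rw [IsScalarTower.algebraMap_apply (Polynomial E) F0 L]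
    exact ((pb.lift (ofPS (η i)) (hlift i)).commutes _).trans (hψ p)
  have hd : 0 < d := minpoly.natDegree_pos hyint
  set t := algebraMap (Polynomial E) L (Polynomial.X - Polynomial.C a) with ht
  have haev : ∀ p : Polynomial E, Polynomial.aeval t (p.comp (Polynomial.X + Polynomial.C a)) =
      algebraMap (Polynomial E) L p := by
    intro p
    have h8 : algebraMap (Polynomial E) L = ((IsScalarTower.toAlgHom E (Polynomial E) L : Polynomial E →ₐ[E] L) : Polynomial E →+* L) := rfl
    rw [ht, h8]
    rw [Polynomial.aeval_comp]
    have h9 : Polynomial.aeval t (Polynomial.X + Polynomial.C a) =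
       (IsScalarTower.toAlgHom E (Polynomial E) L) Polynomial.X := by
      rw [map_add, Polynomial.aeval_X, Polynomial.aeval_C, ht, map_sub]
      have : algebraMap (Polynomial E) L (Polynomial.C a) = algebraMap E L a :=
        (IsScalarTower.algebraMap_apply E (Polynomial E) L a).symm
      rw [this]; simp
    change Polynomial.aeval (Polynomial.aeval t (Polynomial.X + Polynomial.C a)) p = _
    rw [h9, Polynomial.aeval_algHom_apply]; simp
  obtain ⟨D, hD1, hD2, hD3, hD4, hD5⟩ := exists_FD ι t y (fun i => by
      rw [ht, hιp]; change ofPS (σ _) = _; rw [hσX, ofPS_X]) η hιy (by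
      intro i j hij
      have : ((e i : Ga.roots.toFinset) : E) = e j := by
        rw [← hη2, ← hη2]; exact hij
      exact e.injective (Subtype.ext this)) hd
      (fun j => (G.coeff j).comp (Polynomial.X + Polynomial.C a)) (by
      have h10 := minpoly.aeval (Polynomial E) y
      rw [← hGdef, Polynomial.aeval_eq_sum_range, Finset.sum_range_succ, hGm.coeff_natDegree, one_smul,
        Finset.sum_range, add_comm] at h10
      rw [← h10]
      congr 1
      refine Finset.sum_congr rfl fun j _ => ?_
      rw [haev, Algebra.smul_def]) (by
      rw [eq_top_iff]
      intro l _
      obtain ⟨p, hp⟩ := pb.exists_eq_aeval' l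
      rw [hp, hpbg, Polynomial.aeval_eq_sum_range]
      refine sum_mem fun k _ => ?_
      rw [Algebra.smul_def]
      refine mul_mem ?_ (pow_mem (IntermediateField.subset_adjoin _ _ (by simp)) _)
      have hpoly : ∀ q : Polynomial E, algebraMap (Polynomial E) L q ∈ IntermediateField.adjoin E {t, y} := by
        intro q
        rw [← haev]
        exact IntermediateField.algebra_adjoin_le_adjoin _ _
          (Algebra.adjoin_mono (by simp) (Polynomial.aeval_mem_adjoin_singleton E t))
      obtain ⟨n1, n2, hn, hn'⟩ := IsFractionRing.div_surjective (A := Polynomial E) (p.coeff k)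
      rw [← hn', map_div₀, ← IsScalarTower.algebraMap_apply, ← IsScalarTower.algebraMap_apply]
      exact div_mem (hpoly _) (hpoly _))
  refine ⟨D.ι ⟨0, hd⟩, fun m => d1 D hD2 hD3 ⟨0, hd⟩ hD4 hD5 m⟩

end CurveData2
end PD

namespace PD
open scoped TensorProduct

open PowerSeries Lau

section Spread

theorem exists_fg_family {E L K N ι : Type*} [CommRing E] [CommRing L] [CommRing K]
    [CommRing N] [Algebra E L] [Algebra L K] [Algebra E K] [IsScalarTower E L K] [Algebra E N]
    [Fintype ι] (x : ι → K ⊗[E] N) : ∃ S : Subalgebra L K, S.FG ∧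
      ∃ y : ι → S ⊗[E] N, ∀ i, tmap N (S.val.restrictScalars E) (y i) = x i := by
  classical
  choose S hS y hy using fun i => exists_fg_subalgebra (L := L) (x i)
  refine ⟨Finset.univ.sup S, ?_, fun i => tmap N ((Subalgebra.inclusion
    (Finset.le_sup (f := S) (Finset.mem_univ i))).restrictScalars E) (y i), fun i => ?_⟩
  · have : ∀ s : Finset ι, (s.sup S).FG := by
      intro s
      induction s using Finset.induction_on with
      | empty => rw [Finset.sup_empty]; exact Subalgebra.fg_bot
      | insert a s _ ih => rw [Finset.sup_insert]; exact (hS a).sup ih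
    exact this _
  · rw [tmap_comp_apply]; exact hy i

theorem span_range_pow {R : Type*} [CommRing R] {r : ℕ} (g : Fin r → R) (n : ℕ) :
    Ideal.span (Set.range g) ^ n =
      Ideal.span (Set.range fun μ : Fin n → Fin r => ∏ k, g (μ k)) := by
  have h := Submodule.span_pow (R := R) (Set.range g) n
  refine h.trans ?_
  congr 1
  ext a
  rw [Set.mem_pow]
  constructor
  · rintro ⟨f, rfl⟩
    choose μ hμ using fun i => (f i).2
    exact ⟨μ, by simp only [hμ, List.prod_ofFn]⟩
  · rintro ⟨μ, rfl⟩
    exact ⟨fun i => ⟨g (μ i), μ i, rfl⟩, by simp only [List.prod_ofFn]⟩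

theorem span_mul_span_range {R : Type*} [CommRing R] {p : ℕ} (f : R) (a : Fin p → R) :
    Ideal.span {f} * Ideal.span (Set.range a) = Ideal.span (Set.range fun i => f * a i) := by
  rw [Ideal.span_mul_span']
  congr 1
  ext z; simp [Set.mem_mul]

theorem ideal_eq_iff {R : Type*} [CommRing R] {p r : ℕ} (f : R) (a : Fin p → R) (g : Fin r → R)
    (n : ℕ) : Ideal.span {f} * Ideal.span (Set.range a) = Ideal.span (Set.range g) ^ n ↔
      ∃ (c : Fin p → (Fin n → Fin r) → R) (e : (Fin n → Fin r) → Fin p → R),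
        (∀ i, ∑ μ, c i μ * ∏ k, g (μ k) = f * a i) ∧
        (∀ μ, ∑ i, e μ i * (f * a i) = ∏ k, g (μ k)) := by
  rw [span_range_pow, span_mul_span_range]
  constructor
  · intro h
    have h1 : ∀ i, f * a i ∈ Ideal.span (Set.range fun μ : Fin n → Fin r => ∏ k, g (μ k)) :=
      fun i => h ▸ Ideal.subset_span ⟨i, rfl⟩
    have h2 : ∀ μ : Fin n → Fin r, ∏ k, g (μ k) ∈ Ideal.span (Set.range fun i => f * a i) :=
      fun μ => h ▸ Ideal.subset_span ⟨μ, rfl⟩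
    choose c hc using fun i => Ideal.mem_span_range_iff_exists_fun.mp (h1 i)
    choose e he using fun μ => Ideal.mem_span_range_iff_exists_fun.mp (h2 μ)
    exact ⟨c, e, hc, he⟩
  · rintro ⟨c, e, hc, he⟩
    refine le_antisymm (Ideal.span_le.mpr ?_) (Ideal.span_le.mpr ?_)
    · rintro _ ⟨i, rfl⟩
      exact Ideal.mem_span_range_iff_exists_fun.mpr ⟨c i, hc i⟩
    · rintro _ ⟨μ, rfl⟩
      exact Ideal.mem_span_range_iff_exists_fun.mpr ⟨e μ, he μ⟩

theorem fg_iff_range {R : Type*} [CommRing R] (I : Ideal R) (hI : I.FG) :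
    ∃ (p : ℕ) (a : Fin p → R), I = Ideal.span (Set.range a) := by
  obtain ⟨s, rfl⟩ := hI
  refine ⟨s.card, fun i => s.equivFin.symm i, ?_⟩
  congr 1
  ext z
  constructor
  · intro hz
    exact ⟨s.equivFin ⟨z, hz⟩, by simp⟩
  · rintro ⟨i, rfl⟩
    exact (s.equivFin.symm i).2

theorem spread {E L K Ω : Type*} [Field E] [Field L] [Field K] [Field Ω] [IsAlgClosed Ω]
    [Algebra E L] [Algebra L K] [Algebra E K] [IsScalarTower E L K]
    [Algebra L Ω] [Algebra E Ω] [IsScalarTower E L Ω] (N : Type*) [CommRing N] [Algebra E N]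
    (𝔞 : Ideal (L ⊗[E] N)) (h𝔞 : 𝔞.FG) (n : ℕ)
    (f : K ⊗[E] N) (hf : f ≠ 0) (J : Ideal (K ⊗[E] N)) (hJ : J.FG)
    (h : Ideal.span {f} * 𝔞.map (tmap N (IsScalarTower.toAlgHom E L K)) = J ^ n) :
    ∃ (f : Ω ⊗[E] N) (J : Ideal (Ω ⊗[E] N)), f ≠ 0 ∧
      Ideal.span {f} * 𝔞.map (tmap N (IsScalarTower.toAlgHom E L Ω)) = J ^ n := by
  obtain ⟨p, a, rfl⟩ := fg_iff_range _ h𝔞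
  obtain ⟨r, g, rfl⟩ := fg_iff_range _ hJ
  have hmapK : (Ideal.span (Set.range a)).map (tmap N (IsScalarTower.toAlgHom E L K)) =
    Ideal.span (Set.range fun i => tmap N (IsScalarTower.toAlgHom E L K) (a i)) := by
    rw [Ideal.map_span, ← Set.range_comp]; rfl
  rw [hmapK, ideal_eq_iff] at h
  obtain ⟨c, e, hc, he⟩ := h
  obtain ⟨S, hS, y, hy⟩ := exists_fg_family (L := L)
    (ι := Unit ⊕ Fin r ⊕ (Fin p × (Fin n → Fin r)) ⊕ ((Fin n → Fin r) × Fin p))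
    (Sum.elim (fun _ => f) (Sum.elim g (Sum.elim (fun q => c q.1 q.2) (fun q => e q.1 q.2))))
  have : Algebra.FiniteType L S := S.fg_iff_finiteType.mp hS
  let f' := y (Sum.inl ())
  let g' := fun j => y (Sum.inr (Sum.inl j))
  let c' := fun i μ => y (Sum.inr (Sum.inr (Sum.inl (i, μ))))
  let e' := fun μ i => y (Sum.inr (Sum.inr (Sum.inr (μ, i))))
  have hf' : tmap N (S.val.restrictScalars E) f' = f := hy _
  have hg' : ∀ j, tmap N (S.val.restrictScalars E) (g' j) = g j := fun j => hy _
  have hc' : ∀ i μ, tmap N (S.val.restrictScalars E) (c' i μ) = c i μ := fun i μ => hy _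
  have he' : ∀ μ i, tmap N (S.val.restrictScalars E) (e' μ i) = e μ i := fun μ i => hy _
  have hinj : Function.Injective (tmap N (S.val.restrictScalars E)) :=
    tmap_injective _ Subtype.val_injective
  let aS := fun i => tmap N (IsScalarTower.toAlgHom E L S) (a i)
  have haS : ∀ i, tmap N (S.val.restrictScalars E) (aS i) = tmap N (IsScalarTower.toAlgHom E L K) (a i) := by
    intro i
    rw [tmap_comp_apply]; rfl
  have h1 : ∀ i, ∑ μ, c' i μ * ∏ k, g' (μ k) = f' * aS i := fun i => hinj (by
    simp only [map_sum, map_mul, map_prod, hf', hg', hc', haS, hc])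
  have h2 : ∀ μ, ∑ i, e' μ i * (f' * aS i) = ∏ k, g' (μ k) := fun i => hinj (by
    simp only [map_sum, map_mul, map_prod, hf', hg', he', haS, he])
  have hf0 : f' ≠ 0 := by
    intro h0; rw [h0, map_zero] at hf'; exact hf hf'.symm
  obtain ⟨φ, hφ, -⟩ := exists_specialization_tensor (E := E) (L := L) (Ω := Ω) f' f' hf0 hf0
  refine ⟨_, Ideal.span (Set.range fun j => tmap N (φ.restrictScalars E) (g' j)), hφ, ?_⟩
  have hmapO : (Ideal.span (Set.range a)).map (tmap N (IsScalarTower.toAlgHom E L Ω)) =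
    Ideal.span (Set.range fun i => tmap N (φ.restrictScalars E) (aS i)) := by
    rw [Ideal.map_span, ← Set.range_comp]
    congr 2
    ext i
    simp only [aS]
    rw [tmap_comp_apply]
    have : (AlgHom.restrictScalars E φ).comp (IsScalarTower.toAlgHom E L S) = IsScalarTower.toAlgHom E L Ω := by
      ext l; simp
    rw [this]; rfl
  rw [hmapO, ideal_eq_iff]
  refine ⟨fun i μ => tmap N (φ.restrictScalars E) (c' i μ), fun μ i => tmap N (φ.restrictScalars E) (e' μ i),
    fun i => ?_, fun μ => ?_⟩
  · rw [← map_mul, ← h1]; simp only [map_sum, map_mul, map_prod]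
  · rw [← map_prod, ← h2]; simp only [map_sum, map_mul]

/-- The curve lemma. -/
theorem d2 {E L Ω : Type*} [Field E] [Field L] [Field Ω] [IsAlgClosed Ω] [Algebra E L]
    [IsAlgClosed E] [CharZero E] [Algebra.EssFiniteType E L]
    [Algebra L Ω] [Algebra E Ω] [IsScalarTower E L Ω]
    (F0 : Type*) [Field F0] [Algebra (Polynomial E) F0]
    [IsFractionRing (Polynomial E) F0] [Algebra E F0] [IsScalarTower E (Polynomial E) F0]
    [Algebra (Polynomial E) L] [IsScalarTower E (Polynomial E) L] [Algebra F0 L]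
    [IsScalarTower (Polynomial E) F0 L] [FiniteDimensional F0 L] (m : ℕ) :
    ∃ (f : Ω ⊗[E] L) (J : Ideal (Ω ⊗[E] L)), f ≠ 0 ∧
      Ideal.span {f} * (KaehlerDifferential.ideal E L).map (tmap L (IsScalarTower.toAlgHom E L Ω)) =
        J ^ (m + 1) := by
  obtain ⟨ι, hι⟩ := d1_exists (E := E) (L := L) F0
  obtain ⟨f, J, hf, hJ⟩ := hι m
  let _ : Algebra L (Lau E) := ι.toRingHom.toAlgebra
  have : IsScalarTower E L (Lau E) := IsScalarTower.of_algebraMap_eq fun r => (ι.commutes r).symm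
  have hιe : IsScalarTower.toAlgHom E L (Lau E) = ι := by ext l; rfl
  have hnoeth : IsNoetherianRing (Lau E ⊗[E] L) := Algebra.EssFiniteType.isNoetherianRing (Lau E) _
  have hnoeth' : IsNoetherianRing (L ⊗[E] L) := Algebra.EssFiniteType.isNoetherianRing L _
  refine spread (K := Lau E) L (KaehlerDifferential.ideal E L) (IsNoetherian.noetherian _) (m + 1) f hf J
    (IsNoetherian.noetherian _) ?_
  rw [← hJ]
  congr 1
  rw [hιe, ← KaehlerDifferential.span_range_eq_ideal, Ideal.map_span, ← Set.range_comp]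
  refine le_antisymm (Ideal.span_le.mpr ?_) ?_
  · rintro _ ⟨l, rfl⟩
    simp [mu_tmul, RingHom.mem_ker]
  · intro z hz
    have h10 : ∀ z : Lau E ⊗[E] L, z - (mu ι z) ⊗ₜ 1 ∈ Ideal.span (Set.range
        (⇑(tmap L ι) ∘ fun s : L => (1 : L) ⊗ₜ[E] s - s ⊗ₜ[E] (1 : L))) := by
      intro z
      induction z using TensorProduct.induction_on with
      | zero => simp
      | tmul a l =>
        have : a ⊗ₜ[E] l - (mu ι (a ⊗ₜ[E] l)) ⊗ₜ 1 = (a ⊗ₜ 1) * (1 ⊗ₜ l - ι l ⊗ₜ 1) := by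
          simp [mul_sub, mu_tmul]
        rw [this]
        exact Ideal.mul_mem_left _ _ (Ideal.subset_span ⟨l, by simp⟩)
      | add a b ha hb =>
        have : a + b - (mu ι (a + b)) ⊗ₜ 1 = (a - (mu ι a) ⊗ₜ[E] (1 : L)) +
          (b - (mu ι b) ⊗ₜ[E] (1 : L)) := by
          rw [map_add, TensorProduct.add_tmul]; abel
        rw [this]; exact add_mem ha hb
    have h11 := h10 z
    rw [RingHom.mem_ker] at hz
    have hz' : mu ι z = 0 := hz
    rwa [hz', TensorProduct.zero_tmul, sub_zero] at h11

end Spread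
end PD

namespace PD
open scoped TensorProduct

open CategoryTheory

/-- Projective dimension at most `n`, for unbundled modules. -/
def Pdle (R : Type u) [CommRing R] (M : Type u) [AddCommGroup M] [Module R M] (n : ℕ) : Prop :=
  HasProjectiveDimensionLE (ModuleCat.of R M) n

section
variable {R : Type u} [CommRing R] {M N P : Type u} [AddCommGroup M] [Module R M]
  [AddCommGroup N] [Module R N] [AddCommGroup P] [Module R P]

theorem pdle_zero_iff : Pdle R M 0 ↔ Module.Projective R M := by
  unfold Pdle
  rw [← projective_iff_hasProjectiveDimensionLE_zero, ← IsProjective.iff_projective]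

theorem Pdle.mono {m n : ℕ} (h : Pdle R M m) (hmn : m ≤ n) : Pdle R M n :=
  @hasProjectiveDimensionLT_of_ge _ _ _ _ (m + 1) (n + 1) (by omega) h

theorem Pdle.of_projective [Module.Projective R M] (n : ℕ) : Pdle R M n :=
  (pdle_zero_iff.mpr inferInstance).mono (Nat.zero_le _)

theorem Pdle.of_retract {n : ℕ} (i : M →ₗ[R] N) (p : N →ₗ[R] M) (h : p ∘ₗ i = LinearMap.id)
    (hN : Pdle R N n) : Pdle R M n := by
  refine @Retract.hasProjectiveDimensionLT _ _ _ (ModuleCat.of R M) (ModuleCat.of R N)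
    ⟨ModuleCat.ofHom i, ModuleCat.ofHom p, ?_⟩ (n + 1) hN
  rw [← ModuleCat.ofHom_comp, h]; rfl

theorem Pdle.of_equiv {n : ℕ} (e : M ≃ₗ[R] N) (hN : Pdle R N n) : Pdle R M n :=
  Pdle.of_retract (e : M →ₗ[R] N) (e.symm : N →ₗ[R] M) (by ext; simp) hN

theorem shortExact (f : M →ₗ[R] N) (g : N →ₗ[R] P) (hf : Function.Injective f)
    (hg : Function.Surjective g) (hfg : Function.Exact f g) :
    (ShortComplex.mk (ModuleCat.ofHom f) (ModuleCat.ofHom g)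
      (by rw [← ModuleCat.ofHom_comp, hfg.linearMap_comp_eq_zero]; rfl)).ShortExact :=
  ModuleCat.shortComplex_shortExact _ hfg hf hg

theorem Pdle.third {n : ℕ} (f : M →ₗ[R] N) (g : N →ₗ[R] P) (hf : Function.Injective f)
    (hg : Function.Surjective g) (hfg : Function.Exact f g) (h1 : Pdle R M n) (h2 : Pdle R N (n + 1)) :
    Pdle R P (n + 1) :=
  (shortExact f g hf hg hfg).hasProjectiveDimensionLT_X₃ (n + 1) h1 h2

theorem Pdle.first {n : ℕ} (f : M →ₗ[R] N) (g : N →ₗ[R] P) (hf : Function.Injective f)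
    (hg : Function.Surjective g) (hfg : Function.Exact f g) (h1 : Pdle R N n) (h2 : Pdle R P (n + 1)) :
    Pdle R M n :=
  (shortExact f g hf hg hfg).hasProjectiveDimensionLT_X₁ (n + 1) h1 h2

end

/-- canonical free cover -/
theorem exists_cover (R : Type u) [CommRing R] (M : Type u) [AddCommGroup M] [Module R M] :
    ∃ g : (M →₀ R) →ₗ[R] M, Function.Surjective g :=
  ⟨Finsupp.linearCombination R id, Finsupp.linearCombination_id_surjective R M⟩

theorem Pdle.baseChange {R R' : Type u} [CommRing R] [CommRing R'] [Algebra R R'] [Module.Flat R R']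
    (n : ℕ) : ∀ (M : Type u) [AddCommGroup M] [Module R M], Pdle R M n → Pdle R' (R' ⊗[R] M) n := by
  induction n with
  | zero =>
    intro M _ _ h
    rw [pdle_zero_iff] at h ⊢
    infer_instance
  | succ n ih =>
    intro M _ _ h
    obtain ⟨g, hg⟩ := exists_cover R M
    have hN := Pdle.first (n := n) (M := g.ker) g.ker.subtype g g.ker.injective_subtype hg
      (LinearMap.exact_subtype_ker_map g) (Pdle.of_projective _) h
    have key : ∀ (N : Type u) [AddCommGroup N] [Module R N] (f : N →ₗ[R] (M →₀ R)),
        Function.Injective f → Function.Exact f g → Pdle R N n → Pdle R' (R' ⊗[R] M) (n + 1) := by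
      intro N _ _ f hf hfg hN
      refine Pdle.third (f.baseChange R') (g.baseChange R') ?_ ?_ ?_ (ih _ hN)
        (Pdle.of_projective _)
      · exact Module.Flat.lTensor_preserves_injective_linearMap (M := R') _ hf
      · exact LinearMap.lTensor_surjective R' hg
      · exact lTensor_exact R' hfg hg
    exact key g.ker g.ker.subtype g.ker.injective_subtype (LinearMap.exact_subtype_ker_map g) hN

/-- Descent of projective dimension along a separable extension. -/
theorem Pdle.of_restrict {R R' : Type u} [CommRing R] [CommRing R'] [Algebra R R']
    [Module.Projective R R'] [Algebra.FormallyUnramified R R'] [Algebra.EssFiniteType R R']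
    (n : ℕ) : ∀ (M : Type u) [AddCommGroup M] [Module R M] [Module R' M] [IsScalarTower R R' M],
      Pdle R M n → Pdle R' M n := by
  induction n with
  | zero =>
    intro M _ _ _ _ h
    rw [pdle_zero_iff] at h ⊢
    exact Algebra.FormallyUnramified.projective_of_restrictScalars R R' M
  | succ n ih =>
    intro M _ _ _ _ h
    obtain ⟨g, hg⟩ := exists_cover R' M
    let g0 := g.restrictScalars R
    have : Module.Projective R (M →₀ R') := by
      classical
      exact Module.Projective.of_equiv (finsuppLequivDFinsupp R (ι := M) (M := R')).symm
    have hN := Pdle.first (R := R) (n := n) (M := g.ker) (g.ker.subtype.restrictScalars R) g0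
      g.ker.injective_subtype hg
      (LinearMap.exact_subtype_ker_map g) (Pdle.of_projective _) h
    exact Pdle.third g.ker.subtype g g.ker.injective_subtype hg
      (LinearMap.exact_subtype_ker_map g) (ih _ hN) (Pdle.of_projective _) 

/-- finite global dimension -/
def GD (R : Type u) [CommRing R] : Prop :=
  ∃ n, ∀ (M : Type u) [AddCommGroup M] [Module R M], Pdle R M n

theorem GD.of_unramified {R R' : Type u} [CommRing R] [CommRing R'] [Algebra R R']
    [Module.Projective R R'] [Algebra.FormallyUnramified R R'] [Algebra.EssFiniteType R R']
    (h : GD R) : GD R' := by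
  obtain ⟨n, hn⟩ := h
  refine ⟨n, fun M _ _ => ?_⟩
  let _ : Module R M := Module.compHom M (algebraMap R R')
  have : IsScalarTower R R' M := ⟨fun a b m => by
    rw [Algebra.smul_def, mul_smul]; rfl⟩
  exact Pdle.of_restrict n M (hn M)

end PD

namespace PD
open scoped TensorProduct

section inj
variable {K K' M : Type*} [Field K] [Field K'] [Algebra K K'] [AddCommGroup M] [Module K M]

theorem clear_denom (x : K') (hx : IntermediateField.adjoin K {x} = ⊤) (z : K' ⊗[K] M) :
    ∃ q : Polynomial K, Polynomial.aeval x q ≠ 0 ∧ ∃ w : Polynomial K ⊗[K] M,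
      Polynomial.aeval x q • z = (Polynomial.aeval x (R := K)).toLinearMap.rTensor M w := by
  induction z with
  | zero => exact ⟨1, by simp, 0, by simp⟩
  | tmul k m =>
    have hk : k ∈ IntermediateField.adjoin K {x} := by rw [hx]; trivial
    obtain ⟨p, q, rfl⟩ := (IntermediateField.mem_adjoin_simple_iff K k).mp hk
    by_cases hq : Polynomial.aeval x q = 0
    · exact ⟨1, by simp, 0, by simp [hq]⟩
    · refine ⟨q, hq, p ⊗ₜ m, ?_⟩
      rw [TensorProduct.smul_tmul', smul_eq_mul, mul_div_cancel₀ _ hq]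
      rfl
  | add a b ha hb =>
    obtain ⟨q, hq, w, hw⟩ := ha
    obtain ⟨q', hq', w', hw'⟩ := hb
    refine ⟨q * q', by simp [hq, hq'],
      (LinearMap.mulLeft K q').rTensor M w + (LinearMap.mulLeft K q).rTensor M w', ?_⟩
    have key : ∀ (p : Polynomial K) (v : Polynomial K ⊗[K] M),
        (Polynomial.aeval x (R := K)).toLinearMap.rTensor M ((LinearMap.mulLeft K p).rTensor M v) =
        Polynomial.aeval x p • (Polynomial.aeval x (R := K)).toLinearMap.rTensor M v := by
      intro p v
      induction v with
      | zero => simp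
      | tmul a b => simp [TensorProduct.smul_tmul']
      | add a b ha hb => simp only [map_add, smul_add, ha, hb]
    rw [map_add, key, key, ← hw, ← hw', map_mul, smul_add, smul_smul, smul_smul,
      mul_comm (Polynomial.aeval x q)]

theorem delta_injective (x : K') (hx : IntermediateField.adjoin K {x} = ⊤) (hxt : Transcendental K x)
    (τ : M →ₗ[K] M) (z : K' ⊗[K] M) (hz : x • z = τ.lTensor K' z) : z = 0 := by
  obtain ⟨q, hq, w, hw⟩ := clear_denom x hx z
  have hinj : Function.Injective ((Polynomial.aeval x (R := K)).toLinearMap.rTensor M) :=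
    Module.Flat.rTensor_preserves_injective_linearMap _ (transcendental_iff_injective.mp hxt)
  have h1 : (LinearMap.mulLeft K (Polynomial.X : Polynomial K)).rTensor M w =
      τ.lTensor (Polynomial K) w := by
    apply hinj
    have e1 : ∀ w, (Polynomial.aeval x (R := K)).toLinearMap.rTensor M
        ((LinearMap.mulLeft K (Polynomial.X : Polynomial K)).rTensor M w) =
        x • (Polynomial.aeval x (R := K)).toLinearMap.rTensor M w := by
      intro w
      induction w with
      | zero => simp
      | tmul a b => simp [TensorProduct.smul_tmul']
      | add a b ha hb => simp only [map_add, smul_add, ha, hb]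
    have e2 : ∀ w, (Polynomial.aeval x (R := K)).toLinearMap.rTensor M
        (τ.lTensor (Polynomial K) w) =
        τ.lTensor K' ((Polynomial.aeval x (R := K)).toLinearMap.rTensor M w) := by
      intro w
      induction w with
      | zero => simp
      | tmul a b => simp
      | add a b ha hb => simp only [map_add, ha, hb]
    have e3 : ∀ (c : K') (z : K' ⊗[K] M), τ.lTensor K' (c • z) = c • τ.lTensor K' z := by
      intro c z
      induction z with
      | zero => simp
      | tmul a b => simp [TensorProduct.smul_tmul']
      | add a b ha hb => simp only [map_add, smul_add, ha, hb]
    rw [e1, e2, ← hw, e3, ← hz, smul_smul, smul_smul, mul_comm]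
  let c := TensorProduct.equivFinsuppOfBasisLeft (Polynomial.basisMonomials K) (N := M)
  have c1 : ∀ (w : Polynomial K ⊗[K] M) n,
      c ((LinearMap.mulLeft K (Polynomial.X : Polynomial K)).rTensor M w) (n + 1) = c w n := by
    intro w n
    induction w with
    | zero => simp
    | tmul a b => 
      have hb : ∀ (p : Polynomial K) (i : ℕ), (Polynomial.basisMonomials K).repr p i = p.coeff i :=
        fun _ _ => rfl
      simp only [c, LinearMap.rTensor_tmul, TensorProduct.equivFinsuppOfBasisLeft_apply_tmul_apply,
        LinearMap.mulLeft_apply, hb, Polynomial.coeff_X_mul]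
    | add a b ha hb => simp only [map_add, Finsupp.add_apply, ha, hb]
  have c2 : ∀ (w : Polynomial K ⊗[K] M) n, c (τ.lTensor _ w) n = τ (c w n) := by
    intro w n
    induction w with
    | zero => simp
    | tmul a b => simp [c, TensorProduct.equivFinsuppOfBasisLeft_apply_tmul_apply]
    | add a b ha hb => simp only [map_add, Finsupp.add_apply, ha, hb]
  have c3 : ∀ n, c w n = τ (c w (n + 1)) := fun n => by rw [← c1, h1, c2]
  have hw0 : w = 0 := by
    apply c.injective
    rw [map_zero]
    by_contra hne
    have hs : (c w).support.Nonempty := Finsupp.support_nonempty_iff.mpr hne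
    have hM := Finset.max'_mem _ hs
    rw [Finsupp.mem_support_iff] at hM
    apply hM
    rw [c3]
    have : c w ((c w).support.max' hs + 1) = 0 := by
      by_contra h
      have := Finset.le_max' _ _ (Finsupp.mem_support_iff.mpr h)
      omega
    rw [this, map_zero]
  rw [hw0, map_zero] at hw
  exact (smul_eq_zero.mp hw).resolve_left hq

end inj

attribute [local instance] Algebra.TensorProduct.rightAlgebra

theorem GD.of_transcendental {K K' R : Type u} [Field K] [Field K'] [Algebra K K'] [CommRing R]
    [Algebra K R] (x : K') (hx : IntermediateField.adjoin K {x} = ⊤) (hxt : Transcendental K x)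
    (h : GD R) : GD (K' ⊗[K] R) := by
  obtain ⟨n, hn⟩ := h
  refine ⟨n + 1, fun M _ _ => ?_⟩
  let _ : Module R M := Module.compHom M (algebraMap R (K' ⊗[K] R))
  have : IsScalarTower R (K' ⊗[K] R) M := ⟨fun a b m => by
    rw [Algebra.smul_def, mul_smul]; rfl⟩
  let _ : Module K M := Module.compHom M (algebraMap K (K' ⊗[K] R))
  have : IsScalarTower K (K' ⊗[K] R) M := ⟨fun a b m => by
    rw [Algebra.smul_def, mul_smul]; rfl⟩
  have : IsScalarTower K R (K' ⊗[K] R) := IsScalarTower.of_algebraMap_eq fun a => by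
    change (algebraMap K K' a) ⊗ₜ[K] (1 : R) = (1 : K') ⊗ₜ[K] algebraMap K R a
    rw [Algebra.algebraMap_eq_smul_one, Algebra.algebraMap_eq_smul_one, TensorProduct.smul_tmul]
  have : IsScalarTower K R M := ⟨fun a b m => by
    change (algebraMap R (K' ⊗[K] R) (a • b)) • m =
      (algebraMap K (K' ⊗[K] R) a) • (algebraMap R (K' ⊗[K] R) b) • m
    rw [smul_smul, Algebra.smul_def a b, map_mul, ← IsScalarTower.algebraMap_apply]⟩
  have : Module.Flat R (K' ⊗[K] R) :=
    Module.Flat.of_linearEquiv (Algebra.TensorProduct.commRight K R K').toLinearEquiv.symm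
  have hM := Pdle.baseChange (R' := K' ⊗[K] R) n M (hn M)
  let R' := K' ⊗[K] R
  let xx : R' := x ⊗ₜ 1
  let τ : M →ₗ[R] M := (LinearMap.lsmul R' M xx).restrictScalars R
  let D : R' ⊗[R] M →ₗ[R'] R' ⊗[R] M := xx • LinearMap.id - τ.baseChange R'
  let μ : R' ⊗[R] M →ₗ[R'] M := (LinearMap.id : M →ₗ[R] M).liftBaseChange R'
  have hμ : ∀ r m, μ (r ⊗ₜ m) = r • m := fun r m => by simp [μ]
  have hD : ∀ r m, D (r ⊗ₜ m) = (xx * r) ⊗ₜ m - r ⊗ₜ (xx • m) := fun r m => by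
    simp [D, τ, TensorProduct.smul_tmul']
  refine Pdle.third D μ ?_ ?_ ?_ hM (hM.mono (Nat.le_succ n))
  · rw [injective_iff_map_eq_zero]
    intro z hz
    let φ1 : R' ⊗[R] M ≃ₗ[R] M ⊗[K] K' :=
      (TensorProduct.congr (Algebra.TensorProduct.commRight K R K').toLinearEquiv.symm
        (LinearEquiv.refl R M)) ≪≫ₗ TensorProduct.comm R _ M ≪≫ₗ
      TensorProduct.AlgebraTensorModule.cancelBaseChange K R R M K'
    let φ : R' ⊗[R] M → K' ⊗[K] M := fun z => TensorProduct.comm K M K' (φ1 z)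
    have hφ : ∀ k r m, φ (((k ⊗ₜ r : K' ⊗[K] R) : R') ⊗ₜ m) = k ⊗ₜ (r • m) := by
      intro k r m
      rfl
    have hφa : ∀ a b, φ (a + b) = φ a + φ b := fun a b => by simp [φ]
    have hφinj : φ z = 0 → z = 0 := by
      intro h
      simpa [φ] using h
    have key : ∀ z, φ (D z) = x • φ z - (τ.restrictScalars K).lTensor K' (φ z) := by
      intro z
      induction z with
      | zero => simp [φ]
      | add a b ha hb => rw [map_add, hφa, hφa, ha, hb, smul_add, map_add]; abel
      | tmul r m =>
        rw [hD]
        have hsub : ∀ a b, φ (a - b) = φ a - φ b := fun a b => by simp [φ]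
        rw [hsub]
        induction r using TensorProduct.induction_on with
        | zero => simp [φ]
        | add a b ha hb =>
          rw [mul_add, TensorProduct.add_tmul, TensorProduct.add_tmul, TensorProduct.add_tmul,
            hφa, hφa, hφa, smul_add, map_add, ← sub_add_sub_comm, ha, hb]
          abel
        | tmul k r =>
          have e1 : xx * (k ⊗ₜ r : K' ⊗[K] R) = ((x * k) ⊗ₜ r : K' ⊗[K] R) := by
            change (x ⊗ₜ 1 : K' ⊗[K] R) * (k ⊗ₜ r) = _
            rw [Algebra.TensorProduct.tmul_mul_tmul, one_mul]
          rw [e1, hφ, hφ, hφ, LinearMap.lTensor_tmul, TensorProduct.smul_tmul', smul_eq_mul]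
          congr 2
          exact ((LinearMap.lsmul R' M xx).restrictScalars R).map_smul r m |>.symm
    apply hφinj
    apply delta_injective x hx hxt (τ.restrictScalars K)
    have := key z
    rw [hz] at this
    rw [← sub_eq_zero, ← this]; simp [φ]
  · intro m; exact ⟨1 ⊗ₜ m, by simp [hμ]⟩
  · have hcomp : ∀ z, μ (D z) = 0 := by
      intro z
      induction z with
      | zero => simp
      | add a b ha hb => simp [ha, hb]
      | tmul r m => rw [hD, map_sub, hμ, hμ, smul_smul, mul_comm, sub_self]
    have hDr : ∀ (k : R') z, k • z ∈ LinearMap.range D → IsUnit k → z ∈ LinearMap.range D := by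
      intro k z h hk
      obtain ⟨k, rfl⟩ := hk
      have := (LinearMap.range D).smul_mem (↑k⁻¹ : R') h
      rwa [smul_smul, Units.inv_mul, one_smul] at this
    have hright : ∀ (r : R') z, z ∈ LinearMap.range D →
        ((LinearMap.lsmul R' M r).restrictScalars R).baseChange R' z ∈ LinearMap.range D := by
      rintro r _ ⟨w, rfl⟩
      refine ⟨((LinearMap.lsmul R' M r).restrictScalars R).baseChange R' w, ?_⟩
      induction w with
      | zero => simp
      | add a b ha hb => simp only [map_add, ha, hb]
      | tmul s m => 
        rw [hD, map_sub]
        simp only [LinearMap.baseChange_tmul]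
        rw [hD]
        simp [smul_smul, mul_comm]
    have hgenK : ∀ (k : K') (m : M), ((k ⊗ₜ 1 : K' ⊗[K] R) : R') ⊗ₜ[R] m -
        (1 : R') ⊗ₜ[R] (((k ⊗ₜ 1 : K' ⊗[K] R) : R') • m) ∈ LinearMap.range D := by
      intro k
      have hk : k ∈ IntermediateField.adjoin K {x} := by rw [hx]; trivial
      induction hk using IntermediateField.adjoin_induction with
      | mem y hy =>
        intro m
        rw [Set.mem_singleton_iff.mp hy]
        exact ⟨1 ⊗ₜ m, by rw [hD, mul_one]⟩
      | algebraMap y =>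
        intro m
        have e : ((algebraMap K K' y ⊗ₜ 1 : K' ⊗[K] R)) = algebraMap R R' (algebraMap K R y) := by
          rw [← IsScalarTower.algebraMap_apply]; rfl
        rw [e, Algebra.algebraMap_eq_smul_one (A := R') (algebraMap K R y), TensorProduct.smul_tmul]
        simp
      | add a b _ _ ha hb =>
        intro m
        have := add_mem (ha m) (hb m)
        rw [TensorProduct.add_tmul, TensorProduct.add_tmul, add_smul, TensorProduct.tmul_add]
        convert this using 1
        abel
      | mul a b _ _ ha hb =>
        intro m
        have e : ((a * b) ⊗ₜ 1 : K' ⊗[K] R) = (a ⊗ₜ 1) * (b ⊗ₜ 1) := by simp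
        have h1 := (LinearMap.range D).smul_mem ((a ⊗ₜ 1 : K' ⊗[K] R) : R') (hb m)
        have h2 := ha (((b ⊗ₜ 1 : K' ⊗[K] R) : R') • m)
        have := add_mem h1 h2
        rw [e]
        rw [smul_sub, TensorProduct.smul_tmul', TensorProduct.smul_tmul', smul_eq_mul, smul_eq_mul,
          mul_one, sub_add_sub_cancel, smul_smul] at this
        exact this
      | inv a _ ha =>
        intro m
        by_cases h0 : a = 0
        · simp [h0]
        have e : ((a ⊗ₜ 1 : K' ⊗[K] R) : R') * ((a⁻¹ ⊗ₜ 1 : K' ⊗[K] R) : R') = 1 := by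
          change ((a ⊗ₜ 1 : K' ⊗[K] R)) * (a⁻¹ ⊗ₜ 1) = 1
          simp [h0, Algebra.TensorProduct.one_def]
        apply hDr ((a ⊗ₜ 1 : K' ⊗[K] R) : R') _ _ (IsUnit.of_mul_eq_one _ e)
        have := neg_mem (ha (((a⁻¹ ⊗ₜ 1 : K' ⊗[K] R) : R') • m))
        rw [smul_smul, e, one_smul] at this
        rw [smul_sub, TensorProduct.smul_tmul', TensorProduct.smul_tmul', smul_eq_mul, smul_eq_mul,
          mul_one, e]
        convert this using 1
        abel
    have hgen : ∀ (r : R') (m : M), r ⊗ₜ[R] m - (1 : R') ⊗ₜ[R] (r • m) ∈ LinearMap.range D := by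
      intro r m
      induction r using TensorProduct.induction_on with
      | zero => simp
      | add a b ha hb =>
        have := add_mem ha hb
        rw [TensorProduct.add_tmul, add_smul, TensorProduct.tmul_add]
        convert this using 1
        abel
      | tmul k r =>
        have e : ((k ⊗ₜ r : K' ⊗[K] R) : R') = r • ((k ⊗ₜ 1 : K' ⊗[K] R) : R') := by
          rw [Algebra.smul_def]
          change _ = (1 ⊗ₜ r : K' ⊗[K] R) * (k ⊗ₜ 1)
          simp
        have := hgenK k (r • m)
        have hc : ((k ⊗ₜ 1 : K' ⊗[K] R) : R') • r • m = r • ((k ⊗ₜ 1 : K' ⊗[K] R) : R') • m :=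
          (LinearMap.lsmul R' M ((k ⊗ₜ 1 : K' ⊗[K] R) : R')).restrictScalars R |>.map_smul r m
        rw [hc] at this
        rw [e, TensorProduct.smul_tmul, smul_assoc]
        exact this
    intro z
    constructor
    · intro hz
      have : ∀ z, z - (1 : R') ⊗ₜ[R] μ z ∈ LinearMap.range D := by
        intro z
        induction z with
        | zero => simp
        | add a b ha hb =>
          have := add_mem ha hb
          rw [map_add, TensorProduct.tmul_add]
          convert this using 1
          abel
        | tmul r m => rw [hμ]; exact hgen r m
      have := this z
      rw [hz, TensorProduct.tmul_zero, sub_zero] at this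
      exact this
    · rintro ⟨w, rfl⟩; exact hcomp w

end PD

namespace PD
open scoped TensorProduct

theorem GD.of_ringEquiv {R R' : Type u} [CommRing R] [CommRing R'] (e : R ≃+* R') (h : GD R) : GD R' := by
  let _ : Algebra R R' := e.toRingHom.toAlgebra
  have hs : Function.Surjective (algebraMap R R') := e.surjective
  let l : R ≃ₗ[R] R' := LinearEquiv.ofBijective (Algebra.linearMap R R') e.bijective
  have : Module.Projective R R' := Module.Projective.of_equiv l
  have : Algebra.FormallyUnramified R R' := Algebra.FormallyUnramified.of_surjective (Algebra.ofId R R') hs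
  have : Module.Finite R R' := Module.Finite.equiv l
  exact GD.of_unramified h

theorem GD.of_field {R : Type u} [Field R] : GD R :=
  ⟨0, fun _ _ _ => pdle_zero_iff.mpr inferInstance⟩

theorem normal_etale {R S : Type u} [CommRing R] [CommRing S] [IsDomain R] [IsDomain S] [Algebra R S]
    [IsIntegrallyClosed R] [Module.Finite R S] [Algebra.Smooth R S]
    (hinj : Function.Injective (algebraMap R S)) : IsIntegrallyClosed S := by
  let B := FractionRing R
  have hM : Algebra.algebraMapSubmonoid S (nonZeroDivisors R) ≤ nonZeroDivisors S := by
    rintro _ ⟨r, hr, rfl⟩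
    exact mem_nonZeroDivisors_of_ne_zero (by
      rw [Ne, map_eq_zero_iff _ hinj]; exact nonZeroDivisors.ne_zero hr)
  have hl : IsLocalization (Algebra.algebraMapSubmonoid S (nonZeroDivisors R)) (S ⊗[R] B) :=
    IsLocalization.tensor (S := S) B (nonZeroDivisors R)
  have hd : IsDomain (S ⊗[R] B) := IsLocalization.isDomain_of_le_nonZeroDivisors _ hM
  have hf : IsField (S ⊗[R] B) := by
    have : IsField (B ⊗[R] S) := by
      have : IsDomain (B ⊗[R] S) := (Algebra.TensorProduct.comm R B S).toMulEquiv.isDomain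
      exact isField_of_isIntegral_of_isField' (R := B) (Field.toIsField B)
    exact MulEquiv.isField this (Algebra.TensorProduct.comm R S B).toMulEquiv
  let _ : Field (S ⊗[R] B) := hf.toField
  have hle : nonZeroDivisors S ≤ (IsUnit.submonoid (S ⊗[R] B)).comap (algebraMap S (S ⊗[R] B)) := by
    intro s hs
    have : algebraMap S (S ⊗[R] B) s ≠ 0 := by
      rw [Ne, map_eq_zero_iff _ (IsLocalization.injective _ hM)]; exact nonZeroDivisors.ne_zero hs
    exact IsUnit.mk0 _ this
  have : IsFractionRing S (S ⊗[R] B) := 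
    IsLocalization.of_le (Algebra.algebraMapSubmonoid S (nonZeroDivisors R)) _ hM (fun r hr => hle hr)
  rw [isIntegrallyClosed_iff (S ⊗[R] B)]
  intro x hx
  obtain ⟨y, hy⟩ := (TensorProduct.toIntegralClosure_bijective_of_smooth (R := R) (S := S) (B := B)).2 ⟨x, hx⟩
  have hy' : (TensorProduct.toIntegralClosure R S B y : S ⊗[R] B) = x := by rw [hy]
  rw [← hy']
  clear hy hy' hx
  induction y using TensorProduct.induction_on with
  | zero => exact ⟨0, by simp⟩
  | tmul s b =>
    obtain ⟨r, hr⟩ := (isIntegrallyClosed_iff B).mp inferInstance b.2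
    refine ⟨r • s, ?_⟩
    change _ = s ⊗ₜ[R] (b : B)
    rw [← hr, Algebra.TensorProduct.algebraMap_apply, Algebra.algebraMap_eq_smul_one (A := B),
      TensorProduct.tmul_smul, TensorProduct.smul_tmul']
    rfl
  | add a b ha hb =>
    obtain ⟨u, hu⟩ := ha
    obtain ⟨v, hv⟩ := hb
    exact ⟨u + v, by rw [map_add, hu, hv, map_add]; rfl⟩

theorem isFractionRing_aeval {K K' : Type u} [Field K] [Field K'] [Algebra K K'] (x : K')
    (hx : IntermediateField.adjoin K {x} = ⊤) (hxt : Transcendental K x) :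
    @IsFractionRing (Polynomial K) _ K' _ (Polynomial.aeval x (R := K)).toRingHom.toAlgebra := by
  let _ : Algebra (Polynomial K) K' := (Polynomial.aeval x (R := K)).toRingHom.toAlgebra
  have hinj : Function.Injective (algebraMap (Polynomial K) K') :=
    transcendental_iff_injective.mp hxt
  have : FaithfulSMul (Polynomial K) K' := (faithfulSMul_iff_algebraMap_injective _ _).mpr hinj
  refine IsFractionRing.of_field (Polynomial K) K' (fun z => ?_)
  have hk : z ∈ IntermediateField.adjoin K {x} := by rw [hx]; trivial
  obtain ⟨p, q, rfl⟩ := (IntermediateField.mem_adjoin_simple_iff K z).mp hk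
  exact ⟨p, q, rfl⟩

theorem normal_transcendental {K K' R : Type u} [Field K] [Field K'] [CommRing R] [Algebra K K'] [Algebra K R]
    [IsDomain R] [IsIntegrallyClosed R] (x : K')
    (hx : IntermediateField.adjoin K {x} = ⊤) (hxt : Transcendental K x) :
    IsIntegrallyClosed (K' ⊗[K] R) := by
  let _ : Algebra (Polynomial K) K' := (Polynomial.aeval x (R := K)).toRingHom.toAlgebra
  have : IsScalarTower K (Polynomial K) K' := .of_algebraMap_eq fun r => by
    change _ = Polynomial.aeval x _; simp
  have : IsFractionRing (Polynomial K) K' := isFractionRing_aeval x hx hxt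
  let e : Polynomial R ≃+* (Polynomial K ⊗[K] R) :=
    (polyEquivTensor K R).toRingEquiv.trans (Algebra.TensorProduct.comm K R (Polynomial K)).toRingEquiv
  have hd : IsDomain (Polynomial K ⊗[K] R) := e.symm.toMulEquiv.isDomain
  have hn : IsIntegrallyClosed (Polynomial K ⊗[K] R) := IsIntegrallyClosed.of_equiv e
  let _ : Algebra (Polynomial K ⊗[K] R) (K' ⊗[K] R) :=
    (Algebra.TensorProduct.map (IsScalarTower.toAlgHom K (Polynomial K) K') (AlgHom.id K R)).toRingHom.toAlgebra
  have hal : ∀ (p : Polynomial K) (r : R), algebraMap (Polynomial K ⊗[K] R) (K' ⊗[K] R) (p ⊗ₜ r) = 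
    algebraMap (Polynomial K) K' p ⊗ₜ r := fun p r => rfl
  have : IsScalarTower (Polynomial K) (Polynomial K ⊗[K] R) (K' ⊗[K] R) :=
    IsScalarTower.of_algebraMap_eq (R := Polynomial K) (S := Polynomial K ⊗[K] R) (A := K' ⊗[K] R) fun p => by
    change algebraMap (Polynomial K) K' p ⊗ₜ (1 : R) =
      algebraMap (Polynomial K ⊗[K] R) (K' ⊗[K] R) (p ⊗ₜ (1 : R))
    rw [hal]
  have hloc := IsLocalization.tensorProduct_tensorProduct K R (nonZeroDivisors (Polynomial K)) K' (by
    ext r; change algebraMap (Polynomial K ⊗[K] R) (K' ⊗[K] R) (1 ⊗ₜ r) = _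
    rw [hal, map_one]; rfl)
  refine isIntegrallyClosed_of_isLocalization (K' ⊗[K] R) (Algebra.algebraMapSubmonoid (Polynomial K ⊗[K] R)
    (nonZeroDivisors (Polynomial K))) ?_ (R := Polynomial K ⊗[K] R) 
  rintro _ ⟨p, hp, rfl⟩
  refine mem_nonZeroDivisors_of_ne_zero ?_
  rw [Ne, map_eq_zero_iff]
  · exact nonZeroDivisors.ne_zero hp
  · exact Algebra.TensorProduct.includeLeft_injective (S := Polynomial K) (algebraMap K R).injective

structure Good (R : Type u) [CommRing R] : Prop where
  dom : IsDomain R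
  noeth : IsNoetherianRing R
  normal : IsIntegrallyClosed R
  gd : GD R

theorem Good.of_ringEquiv {R R' : Type u} [CommRing R] [CommRing R'] (e : R ≃+* R') (h : Good R) : Good R' := by
  have := h.dom
  have := h.noeth
  have := h.normal
  have := e.symm.toMulEquiv.isDomain
  exact ⟨this, isNoetherianRing_of_ringEquiv R e, IsIntegrallyClosed.of_equiv e, h.gd.of_ringEquiv e⟩

theorem Good.of_field {R : Type u} [Field R] : Good R :=
  ⟨inferInstance, inferInstance, inferInstance, GD.of_field⟩

theorem Good.step {K K' R : Type u} [Field K] [Field K'] [CommRing R] [Algebra K K'] [Algebra K R]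
    [CharZero K] (h : Good R) (x : K') (hx : IntermediateField.adjoin K {x} = ⊤)
    (hd : IsDomain (R ⊗[K] K')) : Good (R ⊗[K] K') := by
  have := h.dom
  have := h.noeth
  have := h.normal
  let e := (Algebra.TensorProduct.comm K K' R).toRingEquiv
  have hfg : Algebra.EssFiniteType K K' :=
    IntermediateField.fg_top_iff.mp ⟨{x}, by simpa using hx⟩
  have hinj : Function.Injective (algebraMap R (R ⊗[K] K')) :=
    Algebra.TensorProduct.includeLeft_injective (S := R) (algebraMap K K').injective
  have hfin : ¬ Transcendental K x → Algebra.IsAlgebraic K K' := by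
    intro hxt
    rw [Transcendental, not_not] at hxt
    have h1 : Algebra.IsAlgebraic K (IntermediateField.adjoin K {x}) :=
      IntermediateField.isAlgebraic_adjoin (by simpa using hxt.isIntegral)
    rw [hx] at h1
    exact (IntermediateField.topEquiv (F := K) (E := K')).isAlgebraic
  refine ⟨hd, Algebra.EssFiniteType.isNoetherianRing R _, ?_, ?_⟩
  · by_cases hxt : Transcendental K x
    · have := normal_transcendental (R := R) x hx hxt
      exact IsIntegrallyClosed.of_equiv e
    · have := hfin hxt
      have : FiniteDimensional K K' := Algebra.finite_of_essFiniteType_of_isAlgebraic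
      have : Algebra.FormallyEtale K K' := (Algebra.FormallyEtale.iff_isSeparable K K').mpr inferInstance
      have : Algebra.FinitePresentation K K' := Algebra.FinitePresentation.of_finiteType.mp inferInstance
      have : Algebra.Etale K K' := {}
      exact normal_etale hinj
  · by_cases hxt : Transcendental K x
    · exact (GD.of_transcendental x hx hxt h.gd).of_ringEquiv e
    · have := hfin hxt
      have : FiniteDimensional K K' := Algebra.finite_of_essFiniteType_of_isAlgebraic
      have : Algebra.FormallyEtale K K' := (Algebra.FormallyEtale.iff_isSeparable K K').mpr inferInstance
      exact GD.of_unramified h.gd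

theorem Good.step' {E A K K' : Type u} [Field E] [IsAlgClosed E] [CharZero E] [Field A] [Field K] [Field K']
    [Algebra E A] [Algebra E K] [Algebra E K'] [Algebra K K'] [IsScalarTower E K K']
    (x : K') (hx : IntermediateField.adjoin K {x} = ⊤) (h : Good (K ⊗[E] A)) : Good (K' ⊗[E] A) := by
  have : CharZero K := charZero_of_injective_algebraMap (algebraMap E K).injective
  let e : K' ⊗[K] (K ⊗[E] A) ≃ₐ[K] K' ⊗[E] A := Algebra.TensorProduct.cancelBaseChange E K K K' A
  let e' : (K ⊗[E] A) ⊗[K] K' ≃ₐ[K] K' ⊗[E] A := (Algebra.TensorProduct.comm K _ _).trans e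
  have := isDomain_tensor E K' A
  have hd : IsDomain ((K ⊗[E] A) ⊗[K] K') := e'.toMulEquiv.isDomain
  exact (Good.step h x hx hd).of_ringEquiv e'.toRingEquiv

theorem Good.tensor {E A K : Type u} [Field E] [IsAlgClosed E] [CharZero E] [Field A] [Field K]
    [Algebra E A] [Algebra E K] [Algebra.EssFiniteType E K] : Good (A ⊗[E] K) := by
  have key : ∀ L : IntermediateField E K, L.FG → Good (L ⊗[E] A) := by
    intro L hL
    refine IntermediateField.induction_on_adjoin_fg (fun L => Good (L ⊗[E] A)) ?_ ?_ L hL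
    · exact (Good.of_field (R := A)).of_ringEquiv ((Algebra.TensorProduct.lid E A).symm.trans
        (Algebra.TensorProduct.congr (IntermediateField.botEquiv E K).symm AlgEquiv.refl)).toRingEquiv
    · intro L x hL
      let L' := IntermediateField.adjoin L {x}
      let y : L' := ⟨x, IntermediateField.mem_adjoin_simple_self L x⟩
      have hy : IntermediateField.adjoin L {y} = ⊤ := by
        apply IntermediateField.lift_injective L'
        rw [IntermediateField.lift_adjoin_simple, IntermediateField.lift_top]
      exact Good.step' (K := L) (K' := L') y hy hL
  have := key ⊤ (IntermediateField.fg_top E K)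
  exact this.of_ringEquiv ((Algebra.TensorProduct.congr IntermediateField.topEquiv AlgEquiv.refl).trans
    (Algebra.TensorProduct.comm E K A)).toRingEquiv
end PD

namespace PD
open scoped TensorProduct

theorem length_coker {D M : Type u} [CommRing D] [IsDomain D] [IsPrincipalIdealRing D] [AddCommGroup M]
    [Module D M] [Module.Free D M] [Module.Finite D M] (φ : M →ₗ[D] M) (hφ : Function.Injective φ) :
    Module.length D (M ⧸ LinearMap.range φ) = Ring.ord D (LinearMap.det φ) := by
  classical
  let b := Module.Free.chooseBasis D M
  let N := LinearMap.range φ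
  let e : M ≃ₗ[D] N := LinearEquiv.ofInjective φ hφ
  have h : Module.finrank D N = Module.finrank D M := e.finrank_eq.symm
  let a := Submodule.smithNormalFormCoeffs b h
  let b' := Submodule.smithNormalFormTopBasis b h
  let ab := Submodule.smithNormalFormBotBasis b h
  have hab : ∀ i, (ab i : M) = a i • b' i := Submodule.smithNormalFormBotBasis_def b h
  rw [(Submodule.quotientEquivPiSpan N b h).length_eq, Module.length_pi_of_fintype]
  let E : M ≃ₗ[D] N := b'.equiv ab (Equiv.refl _)
  have hdet : LinearMap.det (N.subtype ∘ₗ (E : M →ₗ[D] N)) = ∏ i, a i := by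
    rw [← LinearMap.det_toMatrix b', ← Matrix.det_diagonal]
    congr 1
    ext i j
    rw [LinearMap.toMatrix_apply]
    simp only [LinearMap.comp_apply, LinearEquiv.coe_coe, E, Module.Basis.equiv_apply, Equiv.refl_apply,
      Submodule.subtype_apply, hab, map_smul, Module.Basis.repr_self, Matrix.diagonal_apply]
    simp [Finsupp.single_apply]
    grind
  have hass : Associated (LinearMap.det φ) (∏ i, a i) := by
    rw [← hdet]
    have := LinearMap.associated_det_comp_equiv N.subtype e E
    exact this
  have hne : ∀ i, a i ≠ 0 := fun i hi => by
    have := hab i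
    rw [hi, zero_smul] at this
    exact ab.ne_zero i (Subtype.ext this)
  rw [Ring.ord_eq_of_associated hass]
  change ∑ i, Ring.ord D (a i) = _
  have key : ∀ s : Finset (Module.Free.ChooseBasisIndex D M), ∑ i ∈ s, Ring.ord D (a i) = Ring.ord D (∏ i ∈ s, a i) := by
    intro s
    induction s using Finset.induction_on with
    | empty => simp
    | insert i s hi ih =>
      rw [Finset.sum_insert hi, Finset.prod_insert hi, Ring.ord_mul', ih]
      exact mem_nonZeroDivisors_of_ne_zero (hne i)
  exact key _

/-- length after base change to `D` -/
noncomputable def len (R D T : Type u) [CommRing R] [CommRing D] [Algebra R D] [AddCommGroup T] [Module R T] : ℕ∞ :=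
  Module.length D (D ⊗[R] T)

section
variable {R D : Type u} [CommRing R] [CommRing D] [Algebra R D] [Module.Flat R D]
  {M N P : Type u} [AddCommGroup M] [Module R M] [AddCommGroup N] [Module R N] [AddCommGroup P] [Module R P]

theorem len_add (f : M →ₗ[R] N) (g : N →ₗ[R] P) (hf : Function.Injective f)
    (hg : Function.Surjective g) (hfg : Function.Exact f g) : len R D N = len R D M + len R D P := by
  refine Module.length_eq_add_of_exact (f.baseChange D) (g.baseChange D) ?_ ?_ ?_
  · exact Module.Flat.lTensor_preserves_injective_linearMap f hf
  · exact LinearMap.lTensor_surjective D hg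
  · exact Module.Flat.lTensor_exact D hfg

theorem len_coker [IsDomain D] [IsPrincipalIdealRing D] [Module.Free R M] [Module.Finite R M] 
    (φ : M →ₗ[R] M) (hφ : Function.Injective φ) (g : M →ₗ[R] P)
    (hg : Function.Surjective g) (hfg : Function.Exact φ g) :
    len R D P = Ring.ord D (algebraMap R D (LinearMap.det φ)) := by
  rw [← LinearMap.det_baseChange, ← length_coker]
  · refine LinearEquiv.length_eq (R := D) ?_
    have h1 : Function.Exact (φ.baseChange D) (g.baseChange D) := Module.Flat.lTensor_exact D hfg
    exact ((Submodule.quotEquivOfEq _ _ (LinearMap.exact_iff.mp h1).symm).trans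
      ((g.baseChange D).quotKerEquivOfSurjective (LinearMap.lTensor_surjective D hg))).symm
  · exact Module.Flat.lTensor_preserves_injective_linearMap φ hφ
end

theorem exists_pair_one {R : Type u} [CommRing R] [IsDomain R] [IsNoetherianRing R] [IsLocalRing R]
    (T : Type u) [AddCommGroup T] [Module R T] [Module.Finite R T] (c : R) (hc : c ≠ 0)
    (hcT : ∀ t : T, c • t = 0) (h : Pdle R T 1) :
    ∃ a : R, a ≠ 0 ∧ ∀ (D : Type u) [CommRing D] [IsDomain D] [IsPrincipalIdealRing D]
      [Algebra R D] [Module.Flat R D], len R D T = Ring.ord D (algebraMap R D a) := by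
  obtain ⟨k, g, hg⟩ := Module.Finite.exists_fin' R T
  let F := ULift.{u} (Fin k) → R
  let eF : F ≃ₗ[R] (Fin k → R) := LinearEquiv.funCongrLeft R R Equiv.ulift.symm
  let g' : F →ₗ[R] T := g ∘ₗ (eF : F →ₗ[R] (Fin k → R))
  have hg' : Function.Surjective g' := hg.comp eF.surjective
  obtain ⟨N, hN⟩ : ∃ N : Submodule R F, N = LinearMap.ker g' := ⟨_, rfl⟩
  have hex : Function.Exact N.subtype g' := by
    rw [hN]; exact LinearMap.exact_subtype_ker_map g'
  have h0 : Pdle R N 0 := Pdle.first N.subtype g' N.subtype_injective hg' hex (Pdle.of_projective 0) h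
  have : Module.Projective R N := pdle_zero_iff.mp h0
  have : Module.Free R N := Module.free_of_flat_of_isLocalRing
  have hcF : ∀ x : F, c • x ∈ N := fun x => by
    rw [hN, LinearMap.mem_ker, map_smul, hcT]
  let m : F →ₗ[R] N := (LinearMap.lsmul R F c).codRestrict N hcF
  have hm : Function.Injective m := fun x y hxy => by
    have : c • x = c • y := congrArg Subtype.val hxy
    exact smul_right_injective F hc this
  have hrk : Module.finrank R F = Module.finrank R N :=
    le_antisymm (LinearMap.finrank_le_finrank_of_injective hm)
      (LinearMap.finrank_le_finrank_of_injective N.subtype_injective)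
  let e : F ≃ₗ[R] N := LinearEquiv.ofFinrankEq F N hrk
  let φ : F →ₗ[R] F := N.subtype ∘ₗ (e : F →ₗ[R] N)
  have hφ : Function.Injective φ := N.subtype_injective.comp e.injective
  have hex' : Function.Exact φ g' := by
    intro x
    rw [hex x]
    constructor
    · rintro ⟨y, rfl⟩; exact ⟨e.symm y, by simp [φ]⟩
    · rintro ⟨y, rfl⟩; exact ⟨e y, rfl⟩
  refine ⟨LinearMap.det φ, ?_, fun D _ _ _ _ _ => len_coker φ hφ g' hg' hex'⟩
  intro h0
  exact (LinearMap.bot_lt_ker_of_det_eq_zero h0).ne' (LinearMap.ker_eq_bot.mpr hφ)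

theorem exists_pair {R : Type u} [CommRing R] [IsDomain R] [IsNoetherianRing R] [IsLocalRing R]
    (n : ℕ) : ∀ (T : Type u) [AddCommGroup T] [Module R T] [Module.Finite R T] (c : R) (_ : c ≠ 0)
    (_ : ∀ t : T, c • t = 0) (_ : Pdle R T (n + 1)),
    ∃ a b : R, a ≠ 0 ∧ b ≠ 0 ∧ ∀ (D : Type u) [CommRing D] [IsDomain D] [IsPrincipalIdealRing D]
      [Algebra R D] [Module.Flat R D] [FaithfulSMul R D],
      len R D T + Ring.ord D (algebraMap R D b) = Ring.ord D (algebraMap R D a) := by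
  induction n with
  | zero =>
    intro T _ _ _ c hc hcT h
    obtain ⟨a, ha, H⟩ := exists_pair_one T c hc hcT h
    exact ⟨a, 1, ha, one_ne_zero, fun D _ _ _ _ _ _ => by simp [H D]⟩
  | succ n ih =>
    intro T _ _ _ c hc hcT h
    obtain ⟨k, g, hg⟩ := Module.Finite.exists_fin' R T
    let F := ULift.{u} (Fin k) → R
    let eF : F ≃ₗ[R] (Fin k → R) := LinearEquiv.funCongrLeft R R Equiv.ulift.symm
    let g' : F →ₗ[R] T := g ∘ₗ (eF : F →ₗ[R] (Fin k → R))
    have hg' : Function.Surjective g' := hg.comp eF.surjective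
    let m : F →ₗ[R] F := c • LinearMap.id
    have hm : Function.Injective m := fun x y hxy => smul_right_injective F hc hxy
    let Q := F ⧸ LinearMap.range m
    let π : F →ₗ[R] Q := (LinearMap.range m).mkQ
    have hπ : Function.Surjective π := Submodule.mkQ_surjective _
    have hmπ : Function.Exact m π := LinearMap.exact_map_mkQ_range m
    let p : Q →ₗ[R] T := (LinearMap.range m).liftQ g' (by
      rintro _ ⟨x, rfl⟩
      change g' (c • x) = 0
      rw [map_smul, hcT])
    have hp : Function.Surjective p := by
      intro t
      obtain ⟨x, rfl⟩ := hg' t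
      exact ⟨π x, rfl⟩
    obtain ⟨N, hN⟩ : ∃ N : Submodule R Q, N = LinearMap.ker p := ⟨_, rfl⟩
    have hex : Function.Exact N.subtype p := by
      rw [hN]; exact LinearMap.exact_subtype_ker_map p
    have hQ : Pdle R Q 1 := Pdle.third m π hm hπ hmπ (Pdle.of_projective 0) (Pdle.of_projective 1)
    have hNpd : Pdle R N (n + 1) :=
      Pdle.first N.subtype p N.subtype_injective hp hex (hQ.mono (by omega)) h
    have hcN : ∀ x : N, c • x = 0 := by
      rintro ⟨x, hx⟩
      obtain ⟨y, rfl⟩ := hπ x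
      apply Subtype.ext
      change c • π y = 0
      rw [← map_smul]
      exact (hmπ _).mpr ⟨y, rfl⟩
    obtain ⟨a, b, ha, hb, H⟩ := ih N c hc hcN hNpd
    refine ⟨c ^ k * b, a, mul_ne_zero (pow_ne_zero _ hc) hb, ha, fun D _ _ _ _ _ _ => ?_⟩
    have h1 : len R D Q = len R D N + len R D T := len_add N.subtype p N.subtype_injective hp hex
    have h2 : len R D Q = Ring.ord D (algebraMap R D (c ^ k)) := by
      rw [len_coker m hm π hπ hmπ]
      congr 2
      simp [m, F]
    have hinj := FaithfulSMul.algebraMap_injective R D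
    rw [map_mul, Ring.ord_mul', ← h2, h1, ← H D]
    · ring
    · apply mem_nonZeroDivisors_of_ne_zero
      rw [Ne, map_eq_zero_iff _ hinj]
      exact pow_ne_zero _ hc

end PD

namespace PD
open scoped TensorProduct

/-- height one primes -/
structure H1 {R : Type u} [CommRing R] (P : Ideal R) : Prop where
  prime : P.IsPrime
  ne_bot : P ≠ ⊥
  min : ∀ Q : Ideal R, Q.IsPrime → Q ≤ P → Q ≠ ⊥ → Q = P

theorem H1.of_minimal {R : Type u} [CommRing R] [IsDomain R] [IsNoetherianRing R] {y : R} (hy : y ≠ 0)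
    {P : Ideal R} (hP : P ∈ (Ideal.span {y}).minimalPrimes) : H1 P := by
  have hp : P.IsPrime := hP.1.1
  have hyP : y ∈ P := hP.1.2 (Ideal.mem_span_singleton_self y)
  refine ⟨hp, fun h => hy (by rwa [h] at hyP), fun Q hQ hQP hQ0 => ?_⟩
  by_contra hne
  have hlt : Q < P := lt_of_le_of_ne hQP hne
  have h1 : P.height ≤ 1 := Ideal.height_le_one_of_isPrincipal_of_mem_minimalPrimes _ P hP
  have h2 : (⊥ : Ideal R).height + 1 ≤ Q.height := by
    exact Ideal.height_add_one_le_of_lt_of_isPrime (bot_lt_iff_ne_bot.mpr hQ0)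
  have h3 : Q.height + 1 ≤ P.height := by
    exact Ideal.height_add_one_le_of_lt_of_isPrime hlt
  have h4 : (1 : ℕ∞) + 1 ≤ 1 := le_trans (add_le_add_left (le_trans (by simp) h2) 1) (h3.trans h1)
  exact absurd h4 (by decide)

theorem dvd_of_local {R : Type u} [CommRing R] [IsDomain R] [IsNoetherianRing R] [IsIntegrallyClosed R]
    {a b : R} (hb : b ≠ 0) (h : ∀ P : Ideal R, H1 P → ∃ s ∉ P, b ∣ s * a) : b ∣ a := by
  by_contra hab
  let M := R ⧸ Ideal.span {b}
  let x : M := Ideal.Quotient.mk _ a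
  have hx : x ≠ 0 := fun h => hab (Ideal.mem_span_singleton.mp (Ideal.Quotient.eq_zero_iff_mem.mp h))
  obtain ⟨p, hpa, hxp⟩ := exists_le_isAssociatedPrime_of_isNoetherianRing R x hx
  obtain ⟨hp, z, hz⟩ := isAssociatedPrime_iff.mp hpa
  obtain ⟨a', rfl⟩ := Ideal.Quotient.mk_surjective z
  have hcol : ∀ r c : R, r ∈ (⊥ : Submodule R M).colon {Ideal.Quotient.mk (Ideal.span {b}) c} ↔ b ∣ r * c := by
    intro r c
    rw [Submodule.mem_colon_singleton, Submodule.mem_bot, ← Ideal.mem_span_singleton,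
      ← Ideal.Quotient.eq_zero_iff_mem]
    rfl
  have hmem : ∀ r : R, r ∈ p ↔ b ∣ r * a' := by
    intro r
    rw [hz]
    exact hcol r a'
  have hmem' : ∀ r : R, b ∣ r * a → r ∈ p := by
    intro r hr
    apply hxp
    exact (hcol r a).mpr hr
  have ha' : ¬ b ∣ a' := fun h => hp.ne_top ((Ideal.eq_top_iff_one _).mpr ((hmem 1).mpr (by simpa using h)))
  have hbp : b ∈ p := (hmem b).mpr (dvd_mul_right _ _)
  by_cases hcase : ∃ y ∈ p, ∃ z ∉ p, y * a' = b * z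
  · obtain ⟨y, hy, z, hz, hyz⟩ := hcase
    have hy0 : y ≠ 0 := by
      rintro rfl
      rw [zero_mul, eq_comm, mul_eq_zero] at hyz
      exact hz ((hyz.resolve_left hb) ▸ p.zero_mem)
    have hH : H1 p := by
      refine H1.of_minimal hy0 ⟨⟨hp, (Ideal.span_singleton_le_iff_mem _).mpr hy⟩, fun Q ⟨hQ, hyQ⟩ hQp w hw => ?_⟩
      obtain ⟨v, hv⟩ := (hmem w).mp hw
      have h1 : z * w = v * y := by
        apply mul_left_cancel₀ hb
        linear_combination (-w) * hyz + y * hv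
      have h2 : z * w ∈ Q := h1 ▸ Q.mul_mem_left v (hyQ (Ideal.mem_span_singleton_self y))
      exact (hQ.mem_or_mem h2).resolve_left (fun h => hz (hQp h))
    obtain ⟨s, hs, hsa⟩ := h p hH
    exact hs (hmem' s hsa)
  · push Not at hcase
    let K := FractionRing R
    have hbK : algebraMap R K b ≠ 0 := by simpa using hb
    let ξ : K := algebraMap R K a' / algebraMap R K b
    let N : Submodule R K := Submodule.map (Algebra.linearMap R K) p
    have hint : IsIntegral R ξ := by
      refine isIntegral_of_smul_mem_submodule N ?_ (Submodule.FG.map _ (IsNoetherian.noetherian p)) ξ ?_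
      · intro h
        have : algebraMap R K b ∈ N := ⟨b, hbp, rfl⟩
        rw [h] at this
        exact hbK this
      · rintro _ ⟨y, hy, rfl⟩
        obtain ⟨z, hz⟩ := (hmem y).mp hy
        refine ⟨z, ?_, ?_⟩
        · by_contra hzp
          exact hcase y hy z hzp hz
        · have := congrArg (algebraMap R K) hz
          simp only [map_mul] at this
          simp only [Algebra.linearMap_apply, smul_eq_mul, ξ]
          rw [div_mul_eq_mul_div, eq_div_iff hbK]
          linear_combination -this
    obtain ⟨r, hr⟩ := IsIntegrallyClosed.isIntegral_iff.mp hint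
    apply ha'
    refine ⟨r, ?_⟩
    apply IsFractionRing.injective R K
    rw [map_mul, hr]
    simp only [ξ]
    rw [mul_div_cancel₀ _ hbK]

theorem dvr_of_H1 {R : Type u} [CommRing R] [IsDomain R] [IsNoetherianRing R] [IsIntegrallyClosed R]
    (q : Ideal R) [q.IsPrime] (hq : H1 q) : IsDiscreteValuationRing (Localization.AtPrime q) := by
  let D := Localization.AtPrime q
  have hle : q.primeCompl ≤ nonZeroDivisors R := q.primeCompl_le_nonZeroDivisors
  have : IsDomain D := IsLocalization.isDomain_localization hle
  have : IsNoetherianRing D := IsLocalization.isNoetherianRing q.primeCompl D inferInstance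
  have : IsIntegrallyClosed D := isIntegrallyClosed_of_isLocalization D q.primeCompl hle
  have hinj : Function.Injective (algebraMap R D) := IsLocalization.injective D hle
  have hpid : IsPrincipalIdealRing D := by
    have h03 : IsPrincipalIdealRing D ↔ IsIntegrallyClosed D ∧ ∀ P : Ideal D, P ≠ ⊥ → P.IsPrime →
        P = IsLocalRing.maximalIdeal D := (tfae_of_isNoetherianRing_of_isLocalRing_of_isDomain D).out 0 3
    refine h03.mpr ⟨inferInstance, ?_⟩
    intro P hP hPp
    have h1 : (P.comap (algebraMap R D)) ≤ q := by
      refine le_trans (Ideal.comap_mono (IsLocalRing.le_maximalIdeal hPp.ne_top)) (le_of_eq ?_)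
      exact Localization.AtPrime.under_maximalIdeal (I := q)
    have h2 : P.comap (algebraMap R D) = q := by
      refine hq.min _ (hPp.comap _) h1 ?_
      intro h
      apply hP
      rw [← IsLocalization.map_under q.primeCompl D P]
      have : P.under R = ⊥ := h
      rw [this, Ideal.map_bot]
    rw [← IsLocalization.map_under q.primeCompl D P, ← Localization.AtPrime.map_eq_maximalIdeal]
    exact congrArg _ h2
  refine { hpid with not_a_field' := ?_ }
  intro h
  apply hq.ne_bot
  rw [← Localization.AtPrime.under_maximalIdeal (I := q), h]
  exact Ideal.comap_bot_of_injective _ hinj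

theorem loc_dvd {R : Type u} [CommRing R] [IsDomain R] (q : Ideal R) [q.IsPrime] {a b : R}
    (h : algebraMap R (Localization.AtPrime q) b ∣ algebraMap R (Localization.AtPrime q) a) :
    ∃ s ∉ q, b ∣ s * a := by
  obtain ⟨z, hz⟩ := h
  obtain ⟨r, s, rfl⟩ := IsLocalization.exists_mk'_eq q.primeCompl z
  have hinj : Function.Injective (algebraMap R (Localization.AtPrime q)) :=
    IsLocalization.injective _ q.primeCompl_le_nonZeroDivisors
  refine ⟨s, s.2, r, ?_⟩
  apply hinj
  rw [map_mul, map_mul, hz, ← IsLocalization.mk'_spec (Localization.AtPrime q) r s]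
  ring

theorem len_quot_ne {R : Type u} [CommRing R] (P q : Ideal R) [q.IsPrime] (h : ¬ P ≤ q) :
    len R (Localization.AtPrime q) (R ⧸ P) = 0 := by
  obtain ⟨s, hs, hsq⟩ := Set.not_subset.mp h
  have hu : IsUnit (algebraMap R (Localization.AtPrime q) s) := IsLocalization.map_units _ (⟨s, hsq⟩ : q.primeCompl)
  unfold len
  rw [Module.length_eq_zero_iff]
  refine ⟨fun x y => ?_⟩
  have key : ∀ x : Localization.AtPrime q ⊗[R] (R ⧸ P), x = 0 := by
    intro x
    induction x using TensorProduct.induction_on with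
    | zero => rfl
    | tmul a b =>
      obtain ⟨u, hu⟩ := hu
      obtain ⟨b, rfl⟩ := Ideal.Quotient.mk_surjective b
      have h1 : a = s • (a * (u⁻¹ : (Localization.AtPrime q)ˣ)) := by
        rw [Algebra.smul_def, ← hu, mul_comm a, ← mul_assoc, Units.mul_inv, one_mul]
      rw [h1, TensorProduct.smul_tmul]
      have h2 : s • (Ideal.Quotient.mk P b) = 0 := by
        change Ideal.Quotient.mk P (s * b) = 0
        exact Ideal.Quotient.eq_zero_iff_mem.mpr (P.mul_mem_right _ hs)
      rw [h2, TensorProduct.tmul_zero]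
    | add a b ha hb => rw [ha, hb, add_zero]
  rw [key x, key y]

theorem len_quot_self {R : Type u} [CommRing R] (P : Ideal R) [P.IsPrime] :
    len R (Localization.AtPrime P) (R ⧸ P) = 1 := by
  unfold len
  let e := Algebra.TensorProduct.quotIdealMapEquivTensorQuot (Localization.AtPrime P) P
  rw [← e.toLinearEquiv.length_eq, Module.length_eq_one_iff, isSimpleModule_iff_isCoatom,
    Localization.AtPrime.map_eq_maximalIdeal]
  exact (IsLocalRing.maximalIdeal.isMaximal _).out

theorem principal_of_local {R : Type u} [CommRing R] [IsDomain R] [IsNoetherianRing R] [IsIntegrallyClosed R]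
    [IsLocalRing R] (P : Ideal R) (hP : H1 P) (n : ℕ) (h : Pdle R (R ⧸ P) n) : 
    ∃ c ∈ P, ∀ x ∈ P, c ∣ x := by
  obtain ⟨d, hd, hd0⟩ := Submodule.exists_mem_ne_zero_of_ne_bot hP.ne_bot
  obtain ⟨a, b, ha, hb, H⟩ := exists_pair n (R ⧸ P) d hd0 (fun t => by
    obtain ⟨t, rfl⟩ := Ideal.Quotient.mk_surjective t
    change Ideal.Quotient.mk P (d * t) = 0
    exact Ideal.Quotient.eq_zero_iff_mem.mpr (P.mul_mem_right _ hd)) (h.mono (Nat.le_succ n))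
  have H' : ∀ (q : Ideal R) [q.IsPrime], H1 q → len R (Localization.AtPrime q) (R ⧸ P) +
      Ring.ord (Localization.AtPrime q) (algebraMap R _ b) = Ring.ord (Localization.AtPrime q) (algebraMap R _ a) := by
    intro q _ hq
    have := dvr_of_H1 q hq
    have hfl : Module.Flat R (Localization.AtPrime q) := IsLocalization.flat _ q.primeCompl
    have : FaithfulSMul R (Localization.AtPrime q) := (faithfulSMul_iff_algebraMap_injective _ _).mpr
      (IsLocalization.injective _ q.primeCompl_le_nonZeroDivisors)
    exact H _
  have hinj : ∀ (q : Ideal R) [q.IsPrime], Function.Injective (algebraMap R (Localization.AtPrime q)) := fun q _ =>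
    IsLocalization.injective _ q.primeCompl_le_nonZeroDivisors
  have key : ∀ {a b : R}, b ≠ 0 → (∀ (q : Ideal R) [q.IsPrime], H1 q →
      Ring.ord (Localization.AtPrime q) (algebraMap R _ b) ≤ Ring.ord (Localization.AtPrime q) (algebraMap R _ a)) →
      b ∣ a := by
    intro a b hb hle
    refine dvd_of_local hb (fun q hq => ?_)
    have := hq.prime
    have := dvr_of_H1 q hq
    apply loc_dvd
    have := hle q hq
    rwa [Ring.ord_eq_addVal, Ring.ord_eq_addVal, IsDiscreteValuationRing.addVal_le_iff_dvd] at this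
  obtain ⟨c, rfl⟩ : b ∣ a := key hb (fun q _ hq => by rw [← H' q hq]; exact le_add_self)
  have hc0 : c ≠ 0 := right_ne_zero_of_mul ha
  have Hc : ∀ (q : Ideal R) [q.IsPrime], H1 q → Ring.ord (Localization.AtPrime q) (algebraMap R _ c) =
      len R (Localization.AtPrime q) (R ⧸ P) := by
    intro q _ hq
    have := dvr_of_H1 q hq
    have h1 := H' q hq
    have hb' : algebraMap R (Localization.AtPrime q) b ∈ nonZeroDivisors _ := by
      apply mem_nonZeroDivisors_of_ne_zero
      rwa [Ne, map_eq_zero_iff _ (hinj q)]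
    rw [map_mul, Ring.ord_mul' _ hb', add_comm] at h1
    exact (WithTop.add_left_cancel (Ring.ord_ne_top hb') h1).symm
  have hpos : ∀ (q : Ideal R) [q.IsPrime], H1 q → ∀ x ∈ q, 1 ≤ Ring.ord (Localization.AtPrime q) (algebraMap R _ x) := by
    intro q _ hq x hx
    rw [ENat.one_le_iff_ne_zero, Ring.ord, Ne, Module.length_eq_zero_iff, Submodule.Quotient.subsingleton_iff]
    intro h
    have := Ideal.span_singleton_eq_top.mp h
    rw [IsLocalization.AtPrime.isUnit_to_map_iff (Localization.AtPrime q) q] at this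
    exact this hx
  have := hP.prime
  refine ⟨c, ?_, fun x hx => key hc0 fun q _ hq => ?_⟩
  · by_contra hcP
    have h1 := Hc P hP
    rw [len_quot_self] at h1
    have := (IsLocalization.AtPrime.isUnit_to_map_iff (Localization.AtPrime P) P c).mpr hcP
    rw [Ring.ord_of_isUnit this] at h1
    exact zero_ne_one h1
  · rw [Hc q hq]
    by_cases hqP : P ≤ q
    · obtain rfl := hq.min P hP.prime hqP hP.ne_bot
      rw [len_quot_self]
      exact hpos P hP x hx
    · rw [len_quot_ne P q hqP]; exact bot_le
end PD

namespace PD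
open scoped TensorProduct

theorem H1.localize {R : Type u} [CommRing R] [IsDomain R] {M : Submonoid R} (hM : M ≤ nonZeroDivisors R)
    (S : Type u) [CommRing S] [Algebra R S] [IsLocalization M S] {P : Ideal R} (hP : H1 P)
    (hd : Disjoint (M : Set R) P) : H1 (P.map (algebraMap R S)) := by
  have hpp := hP.prime
  have hcm : (P.map (algebraMap R S)).under R = P := IsLocalization.under_map_of_isPrime_disjoint M S hpp hd
  refine ⟨IsLocalization.isPrime_of_isPrime_disjoint M S P hP.prime hd, ?_, ?_⟩
  · intro h
    apply hP.ne_bot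
    rw [← hcm, h]
    exact Ideal.comap_bot_of_injective _ (IsLocalization.injective S hM)
  · intro Q hQ hQP hQ0
    rw [← IsLocalization.map_under M S Q]
    congr 1
    refine hP.min _ (hQ.comap _) (le_trans (Ideal.comap_mono hQP) hcm.le) ?_
    intro h
    apply hQ0
    rw [← IsLocalization.map_under M S Q, h, Ideal.map_bot]

theorem H1.comap {R : Type u} [CommRing R] [IsDomain R] {M : Submonoid R} (hM : M ≤ nonZeroDivisors R)
    (S : Type u) [CommRing S] [Algebra R S] [IsLocalization M S] {P : Ideal S} (hP : H1 P) :
    H1 (P.under R) := by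
  refine ⟨hP.prime.comap _, ?_, ?_⟩
  · intro h
    apply hP.ne_bot
    rw [← IsLocalization.map_under M S P, h, Ideal.map_bot]
  · intro Q hQ hQP hQ0
    have hd : Disjoint (M : Set R) Q := by
      rw [Set.disjoint_left]
      intro x hx hxQ
      exact hP.prime.ne_top (Ideal.eq_top_of_isUnit_mem _ (hQP hxQ) (IsLocalization.map_units S ⟨x, hx⟩))
    have h1 := IsLocalization.isPrime_of_isPrime_disjoint M S Q hQ hd
    have h2 : Q.map (algebraMap R S) = P := by
      refine hP.min _ h1 (Ideal.map_le_iff_le_comap.mpr hQP) ?_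
      intro h
      apply hQ0
      rw [← IsLocalization.under_map_of_isPrime_disjoint M S hQ hd, h]
      exact Ideal.comap_bot_of_injective _ (IsLocalization.injective S hM)
    rw [← h2]
    exact (IsLocalization.under_map_of_isPrime_disjoint M S hQ hd).symm

theorem loc_gen {R : Type u} [CommRing R] (hR : Good R) {P : Ideal R} (hP : H1 P) (m : Ideal R) (hm : m.IsPrime) :
    ∃ c ∈ P, ∃ s ∉ m, ∀ x ∈ P, c ∣ s * x := by
  have := hR.dom
  have := hR.noeth
  have := hR.normal
  by_cases hPm : P ≤ m
  swap
  · obtain ⟨s, hs, hsm⟩ := Set.not_subset.mp hPm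
    exact ⟨s, hs, s, hsm, fun x _ => dvd_mul_right _ _⟩
  let D := Localization.AtPrime m
  have hle : m.primeCompl ≤ nonZeroDivisors R := m.primeCompl_le_nonZeroDivisors
  have : IsDomain D := IsLocalization.isDomain_localization hle
  have : IsNoetherianRing D := IsLocalization.isNoetherianRing m.primeCompl D inferInstance
  have : IsIntegrallyClosed D := isIntegrallyClosed_of_isLocalization D m.primeCompl hle
  have hinj : Function.Injective (algebraMap R D) := IsLocalization.injective D hle
  have hfl : Module.Flat R D := IsLocalization.flat _ m.primeCompl
  have hd : Disjoint (m.primeCompl : Set R) P := by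
    rw [Set.disjoint_left]
    intro x hx hxP
    exact hx (hPm hxP)
  have hH : H1 (P.map (algebraMap R D)) := hP.localize hle D hd
  obtain ⟨n, hn⟩ := hR.gd
  have hpd : Pdle D (D ⧸ P.map (algebraMap R D)) n :=
    (Pdle.baseChange n (R ⧸ P) (hn (R ⧸ P))).of_equiv
      (Algebra.TensorProduct.quotIdealMapEquivTensorQuot D P).toLinearEquiv
  obtain ⟨c', hc', hc⟩ := principal_of_local _ hH n hpd
  obtain ⟨⟨c, s⟩, hcs⟩ := (IsLocalization.mem_map_algebraMap_iff m.primeCompl D).mp hc'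
  have hdv : ∀ x ∈ P, ∃ s ∉ m, (c : R) ∣ s * x := by
    intro x hx
    apply loc_dvd m
    have h1 := hc _ (Ideal.mem_map_of_mem _ hx)
    change c' * algebraMap R D s = algebraMap R D c at hcs
    rw [← hcs]
    exact (IsUnit.mul_right_dvd (IsLocalization.map_units D s)).mpr h1
  obtain ⟨T, hT⟩ := (IsNoetherian.noetherian P : P.FG)
  have key : ∀ T : Finset R, (∀ x ∈ T, x ∈ P) → ∃ s ∉ m, ∀ x ∈ T, (c : R) ∣ s * x := by
    classical
    intro T
    induction T using Finset.induction_on with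
    | empty => exact fun _ => ⟨1, fun h => hm.ne_top ((Ideal.eq_top_iff_one _).mpr h), by simp⟩
    | insert a T _ ih =>
      intro h
      obtain ⟨s, hs, hs'⟩ := ih (fun x hx => h x (Finset.mem_insert_of_mem hx))
      obtain ⟨t, ht, ht'⟩ := hdv a (h a (Finset.mem_insert_self _ _))
      refine ⟨s * t, fun hh => (hm.mem_or_mem hh).elim hs ht, fun x hx => ?_⟩
      rcases Finset.mem_insert.mp hx with rfl | hx
      · rw [mul_assoc]; exact ht'.mul_left s
      · rw [mul_comm s, mul_assoc]; exact (hs' x hx).mul_left t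
  obtain ⟨s, hs, hs'⟩ := key T (fun x hx => hT ▸ Ideal.subset_span hx)
  refine ⟨c, c.2, s, hs, fun x hx => ?_⟩
  have : P ≤ Submodule.comap (LinearMap.mul R R s : R →ₗ[R] R) (Ideal.span {(c : R)}) := by
    refine hT.ge.trans (Submodule.span_le.mpr fun y hy => ?_)
    exact Ideal.mem_span_singleton.mpr (hs' y hy)
  exact Ideal.mem_span_singleton.mp (this hx)

/-- invertible integral ideals -/
def Inv {R : Type u} [CommRing R] (I : Ideal R) : Prop := ∃ (J : Ideal R) (a : R), a ≠ 0 ∧ I * J = Ideal.span {a}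

theorem inv_of_H1 {R : Type u} [CommRing R] (hR : Good R) {P : Ideal R} (hP : H1 P) : Inv P := by
  have := hR.dom
  obtain ⟨a, ha, ha0⟩ := Submodule.exists_mem_ne_zero_of_ne_bot hP.ne_bot
  let J : Ideal R := (Ideal.span {a}).colon (P : Set R)
  have hJ : ∀ r, r ∈ J ↔ ∀ x ∈ P, a ∣ r * x := by
    intro r
    simp only [J, Submodule.mem_colon, SetLike.mem_coe, smul_eq_mul, Ideal.mem_span_singleton]
  refine ⟨J, a, ha0, le_antisymm ?_ ?_⟩
  · rw [Ideal.mul_le]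
    intro r hr s hs
    rw [mul_comm, Ideal.mem_span_singleton]
    exact (hJ s).mp hs r hr
  · rw [Ideal.span_singleton_le_iff_mem]
    by_contra hn
    let C : Ideal R := (P * J).colon {a}
    have hC : ∀ r, r ∈ C ↔ r * a ∈ P * J := by
      intro r
      simp only [C, Submodule.mem_colon_singleton, smul_eq_mul]
    have hCt : C ≠ ⊤ := by
      intro h
      rw [Ideal.eq_top_iff_one, hC, one_mul] at h
      exact hn h
    obtain ⟨m, hm, hCm⟩ := Ideal.exists_le_maximal C hCt
    obtain ⟨c, hc, s, hs, hcs⟩ := loc_gen hR hP m hm.isPrime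
    apply hs
    apply hCm
    rw [hC]
    obtain ⟨d, hd⟩ := hcs a ha
    rw [hd]
    refine Ideal.mul_mem_mul hc ?_
    rw [hJ]
    intro x hx
    have hc0 : c ≠ 0 := by
      rintro rfl
      rw [zero_mul, mul_eq_zero] at hd
      exact hs ((hd.resolve_right ha0) ▸ m.zero_mem)
    have hsx := hcs x hx
    obtain ⟨e, he⟩ := hsx
    exact ⟨e, mul_left_cancel₀ hc0 (by linear_combination (-x) * hd + a * he)⟩
end PD

namespace PD
set_option linter.unusedSectionVars false
open scoped TensorProduct
section
variable {R : Type u} [CommRing R] [IsDomain R]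

theorem Inv.span {a : R} (ha : a ≠ 0) : Inv (Ideal.span {a}) := ⟨⊤, a, ha, by simp⟩

theorem Inv.top : Inv (⊤ : Ideal R) := ⟨⊤, 1, one_ne_zero, by simp⟩

theorem Inv.mul {I J : Ideal R} (hI : Inv I) (hJ : Inv J) : Inv (I * J) := by
  obtain ⟨I', a, ha, h1⟩ := hI
  obtain ⟨J', b, hb, h2⟩ := hJ
  refine ⟨I' * J', a * b, mul_ne_zero ha hb, ?_⟩
  rw [mul_mul_mul_comm, h1, h2, Ideal.span_singleton_mul_span_singleton]

theorem Inv.of_mul_left {I J : Ideal R} (h : Inv (I * J)) : Inv I := by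
  obtain ⟨I', a, ha, h1⟩ := h
  exact ⟨J * I', a, ha, by rw [← mul_assoc, h1]⟩

theorem Inv.of_mul_right {I J : Ideal R} (h : Inv (I * J)) : Inv J := by
  rw [mul_comm] at h; exact h.of_mul_left

theorem Inv.pow {I : Ideal R} (hI : Inv I) (n : ℕ) : Inv (I ^ n) := by
  induction n with
  | zero => rw [pow_zero, Ideal.one_eq_top]; exact Inv.top
  | succ n ih => rw [pow_succ]; exact ih.mul hI

theorem Inv.of_pow {I : Ideal R} {n : ℕ} (hn : 1 ≤ n) (h : Inv (I ^ n)) : Inv I := by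
  obtain ⟨m, rfl⟩ := Nat.exists_eq_add_of_le' hn
  rw [pow_succ] at h
  exact h.of_mul_right

theorem Inv.ne_bot {I : Ideal R} (hI : Inv I) : I ≠ ⊥ := by
  rintro rfl
  obtain ⟨I', a, ha, h1⟩ := hI
  rw [Ideal.bot_mul, eq_comm, Ideal.span_singleton_eq_bot] at h1
  exact ha h1

theorem Inv.cancel {I A B : Ideal R} (hI : Inv I) (h : I * A = I * B) : A = B := by
  obtain ⟨I', a, ha, h1⟩ := hI
  apply (Ideal.span_singleton_mul_right_inj ha).mp
  rw [← h1, mul_comm I I', mul_assoc, mul_assoc, h]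

theorem exists_of_le_span {I : Ideal R} {a : R} (h : I ≤ Ideal.span {a}) : ∃ I', I = Ideal.span {a} * I' := by
  refine ⟨Submodule.comap (LinearMap.mul R R a : R →ₗ[R] R) I, le_antisymm ?_ ?_⟩
  · intro x hx
    obtain ⟨y, rfl⟩ := Ideal.mem_span_singleton.mp (h hx)
    exact Ideal.mul_mem_mul (Ideal.mem_span_singleton_self a) hx
  · rw [Ideal.span_singleton_mul_le_iff]
    intro z hz
    exact hz

theorem Inv.dvd {I P : Ideal R} (hP : Inv P) (h : I ≤ P) : ∃ I', I = P * I' := by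
  obtain ⟨J, a, ha, h1⟩ := hP
  obtain ⟨I', hI'⟩ := exists_of_le_span (le_trans (Ideal.mul_mono_left h) h1.le : I * J ≤ _)
  refine ⟨I', ?_⟩
  apply (Ideal.span_singleton_mul_right_inj ha).mp
  rw [mul_left_comm, ← hI', ← h1]
  ring

theorem H1.of_minimal_inv [IsNoetherianRing R] {I P : Ideal R} (hI : Inv I) (hP : P ∈ I.minimalPrimes) : H1 P := by
  have hp : P.IsPrime := hP.1.1
  have hI0 := hI.ne_bot
  obtain ⟨J, a, ha, h1⟩ := hI
  obtain ⟨x, hx, y, hy, hxy⟩ : ∃ x ∈ I, ∃ y ∈ J, x * y ∉ Ideal.span {a} * P := by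
    by_contra hcon
    push Not at hcon
    have h2 : I * J ≤ Ideal.span {a} * P := Ideal.mul_le.mpr hcon
    rw [h1, Ideal.span_singleton_le_iff_mem, Ideal.mem_span_singleton_mul] at h2
    obtain ⟨z, hz, hz'⟩ := h2
    have : z = 1 := mul_left_cancel₀ ha (by rw [hz', mul_one])
    exact hp.ne_top ((Ideal.eq_top_iff_one _).mpr (this ▸ hz))
  obtain ⟨u, hu⟩ := Ideal.mem_span_singleton.mp (h1 ▸ Ideal.mul_mem_mul hx hy)
  have huP : u ∉ P := fun h => hxy (hu ▸ Ideal.mul_mem_mul (Ideal.mem_span_singleton_self a) h)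
  have key : ∀ z ∈ I, x ∣ u * z := by
    intro z hz
    obtain ⟨v, hv⟩ := Ideal.mem_span_singleton.mp (h1 ▸ Ideal.mul_mem_mul hz hy)
    exact ⟨v, mul_left_cancel₀ ha (by linear_combination (-z) * hu + x * hv)⟩
  have hx0 : x ≠ 0 := by
    rintro rfl
    apply hI0
    rw [eq_bot_iff]
    intro z hz
    have := zero_dvd_iff.mp (key z hz)
    rcases mul_eq_zero.mp this with h | h
    · exact absurd (h ▸ P.zero_mem) huP
    · exact h
  refine H1.of_minimal hx0 ⟨⟨hp, (Ideal.span_singleton_le_iff_mem _).mpr (hP.1.2 hx)⟩, fun Q ⟨hQ, hxQ⟩ hQP => ?_⟩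
  refine hP.2 ⟨hQ, fun z hz => ?_⟩ hQP
  have : u * z ∈ Q := Q.mem_of_dvd (key z hz) (hxQ (Ideal.mem_span_singleton_self x))
  exact (hQ.mem_or_mem this).resolve_left (fun h => huP (hQP h))

theorem Inv.induction [IsNoetherianRing R] (hinv : ∀ P : Ideal R, H1 P → Inv P) (p : Ideal R → Prop)
    (htop : p ⊤) (hmul : ∀ P I : Ideal R, H1 P → Inv I → p I → p (P * I)) :
    ∀ I : Ideal R, Inv I → p I := by
  intro I
  induction I using IsNoetherian.induction with
  | hgt I ih =>
  intro hI
  by_cases ht : I = ⊤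
  · rw [ht]; exact htop
  obtain ⟨P, hP⟩ := Ideal.nonempty_minimalPrimes ht
  have hH := H1.of_minimal_inv hI hP
  obtain ⟨I', hI'⟩ := (hinv P hH).dvd hP.1.2
  rw [hI'] at hI ⊢
  refine hmul P I' hH hI.of_mul_right (ih I' ?_ hI.of_mul_right)
  refine lt_of_le_of_ne (hI' ▸ Ideal.mul_le_right) ?_
  intro h
  rw [← h] at hI'
  have hh : I * P = I * ⊤ := by rw [Ideal.mul_top, mul_comm, ← hI']
  have := Inv.cancel (h ▸ hI.of_mul_right) hh
  exact hH.prime.ne_top this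

/-- divisible by `n` in the ideal class group -/
def NDiv (n : ℕ) (I : Ideal R) : Prop := ∃ f : R, f ≠ 0 ∧ ∃ J : Ideal R, Ideal.span {f} * I = J ^ n

theorem NDiv.of_eq {n : ℕ} (hn : 1 ≤ n) {I J : Ideal R} {f g : R} (hf : f ≠ 0) (hg : g ≠ 0)
    (h : Ideal.span {f} * I = Ideal.span {g} * J ^ n) : NDiv n I := by
  obtain ⟨m, rfl⟩ := Nat.exists_eq_add_of_le' hn
  refine ⟨g ^ m * f, mul_ne_zero (pow_ne_zero _ hg) hf, Ideal.span {g} * J, ?_⟩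
  rw [← Ideal.span_singleton_mul_span_singleton, mul_assoc, h, ← Ideal.span_singleton_pow]
  ring

theorem NDiv.top (n : ℕ) : NDiv n (⊤ : Ideal R) := ⟨1, one_ne_zero, ⊤, by simp [← Ideal.one_eq_top]⟩

theorem NDiv.span {n : ℕ} (hn : 1 ≤ n) {a : R} (ha : a ≠ 0) : NDiv n (Ideal.span {a}) :=
  NDiv.of_eq hn (J := ⊤) one_ne_zero ha (by
    simp [← Ideal.one_eq_top])

theorem NDiv.mul {n : ℕ} {I J : Ideal R} (hI : NDiv n I) (hJ : NDiv n J) : NDiv n (I * J) := by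
  obtain ⟨f, hf, A, hA⟩ := hI
  obtain ⟨g, hg, B, hB⟩ := hJ
  exact ⟨f * g, mul_ne_zero hf hg, A * B, by
    rw [← Ideal.span_singleton_mul_span_singleton, mul_mul_mul_comm, hA, hB, mul_pow]⟩

theorem NDiv.pow {n : ℕ} {I : Ideal R} (hI : NDiv n I) (k : ℕ) : NDiv n (I ^ k) := by
  induction k with
  | zero => rw [pow_zero, Ideal.one_eq_top]; exact NDiv.top n
  | succ k ih => rw [pow_succ]; exact ih.mul hI

theorem NDiv.map {n : ℕ} {I : Ideal R} (hI : NDiv n I) {S : Type u} [CommRing S] [IsDomain S]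
    (φ : R →+* S) (hφ : Function.Injective φ) : NDiv n (I.map φ) := by
  obtain ⟨f, hf, A, hA⟩ := hI
  refine ⟨φ f, by rwa [Ne, map_eq_zero_iff _ hφ], A.map φ, ?_⟩
  rw [← Ideal.map_pow, ← hA, Ideal.map_mul, Ideal.map_span, Set.image_singleton]

theorem NDiv.cancel {n : ℕ} (hn : 1 ≤ n) {I V : Ideal R} (hIV : NDiv n (I * V)) (hV : NDiv n V) (hinv : Inv V) :
    NDiv n I := by
  obtain ⟨f, hf, J, hJ⟩ := hIV
  obtain ⟨g, hg, K, hK⟩ := hV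
  have hKi : Inv K := Inv.of_pow hn (hK ▸ (Inv.span hg).mul hinv)
  obtain ⟨K', b, hb, hKK⟩ := hKi
  refine NDiv.of_eq hn (f := f * b ^ n) (g := g) (J := J * K') (mul_ne_zero hf (pow_ne_zero _ hb)) hg ?_
  rw [← Ideal.span_singleton_mul_span_singleton, ← Ideal.span_singleton_pow, ← hKK, mul_pow, mul_pow, ← hK, ← hJ]
  ring

theorem NDiv.of_primes [IsNoetherianRing R] (hinv : ∀ P : Ideal R, H1 P → Inv P) {n : ℕ} {I : Ideal R}
    (hI : Inv I) (h : ∀ P : Ideal R, H1 P → I ≤ P → NDiv n P) : NDiv n I := by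
  revert h
  refine Inv.induction hinv (fun I => (∀ P : Ideal R, H1 P → I ≤ P → NDiv n P) → NDiv n I) ?_ ?_ I hI
  · intro _; exact NDiv.top n
  · intro P I hP _ ih h
    exact (h P hP Ideal.mul_le_left).mul (ih fun Q hQ hIQ => h Q hQ (Ideal.mul_le_right.trans hIQ))
end
end PD

namespace PD
open scoped TensorProduct Polynomial

theorem exists_poly_mem {E A K : Type u} [Field E] [IsAlgClosed E] [Field A] [Field K]
    [Algebra E A] [Algebra E K] [Algebra E[X] A] [IsScalarTower E E[X] A] [Algebra.IsAlgebraic E[X] A]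
    (P : Ideal (A ⊗[E] K)) (hP0 : P ≠ ⊥) :
    ∃ c : K[X], c ≠ 0 ∧ Polynomial.eval₂ (Algebra.TensorProduct.includeRight (R := E) (A := A) (B := K)).toRingHom
      ((algebraMap E[X] A Polynomial.X) ⊗ₜ[E] (1 : K)) c ∈ P := by
  have hdom : IsDomain (A ⊗[E] K) := isDomain_tensor E A K
  obtain ⟨x, hxP, hx0⟩ := Submodule.exists_mem_ne_zero_of_ne_bot hP0
  let ι : K →+* A ⊗[E] K := (Algebra.TensorProduct.includeRight (R := E) (A := A) (B := K)).toRingHom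
  let ev : K[X] →+* A ⊗[E] K := Polynomial.eval₂RingHom ι ((algebraMap E[X] A Polynomial.X) ⊗ₜ[E] (1 : K))
  let _ : Algebra K[X] (A ⊗[E] K) := ev.toAlgebra
  have h1 : ∀ k : K, IsAlgebraic K[X] ((1 : A) ⊗ₜ[E] k) := by
    intro k
    have : (1 : A) ⊗ₜ[E] k = algebraMap K[X] (A ⊗[E] K) (Polynomial.C k) := by
      change _ = ev _
      simp only [ev, Polynomial.coe_eval₂RingHom, Polynomial.eval₂_C]
      rfl
    rw [this]
    exact isAlgebraic_algebraMap _
  have hcomp : ev.comp (Polynomial.mapRingHom (algebraMap E K)) =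
      (Algebra.TensorProduct.includeLeftRingHom (R := E) (A := A) (B := K)).comp (algebraMap E[X] A) := by
    apply Polynomial.ringHom_ext
    · intro e
      simp only [ev, RingHom.comp_apply, Polynomial.coe_mapRingHom, Polynomial.map_C, Polynomial.coe_eval₂RingHom,
        Polynomial.eval₂_C]
      have : algebraMap E[X] A (Polynomial.C e) = algebraMap E A e := by
        rw [IsScalarTower.algebraMap_apply E E[X] A]; rfl
      rw [this]
      change (1 : A) ⊗ₜ[E] (algebraMap E K e) = (algebraMap E A e) ⊗ₜ[E] (1 : K)
      rw [Algebra.algebraMap_eq_smul_one, Algebra.algebraMap_eq_smul_one, TensorProduct.smul_tmul]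
    · simp only [ev, RingHom.comp_apply, Polynomial.coe_mapRingHom, Polynomial.map_X, Polynomial.coe_eval₂RingHom,
        Polynomial.eval₂_X]
      rfl
  have h2 : ∀ a : A, IsAlgebraic K[X] (a ⊗ₜ[E] (1 : K)) := by
    intro a
    obtain ⟨p, hp0, hp⟩ := Algebra.IsAlgebraic.isAlgebraic (R := E[X]) a
    refine ⟨p.map (Polynomial.mapRingHom (algebraMap E K)), ?_, ?_⟩
    · rwa [Ne, Polynomial.map_eq_zero_iff]
      exact Polynomial.map_injective _ (algebraMap E K).injective
    · rw [Polynomial.aeval_def, Polynomial.eval₂_map]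
      change Polynomial.eval₂ (ev.comp _) _ _ = 0
      rw [hcomp]
      have : a ⊗ₜ[E] (1 : K) = Algebra.TensorProduct.includeLeftRingHom (R := E) (A := A) (B := K) a := rfl
      rw [this, ← Polynomial.hom_eval₂, ← Polynomial.aeval_def, hp, map_zero]
  have hall : ∀ x : A ⊗[E] K, IsAlgebraic K[X] x := by
    intro x
    induction x using TensorProduct.induction_on with
    | zero => exact isAlgebraic_zero
    | tmul a k =>
      have : a ⊗ₜ[E] k = (a ⊗ₜ[E] (1 : K)) * ((1 : A) ⊗ₜ[E] k) := by simp
      rw [this]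
      exact (h2 a).mul (h1 k)
    | add a b ha hb => exact ha.add hb
  obtain ⟨c, hc0, hc⟩ := (hall x).exists_nonzero_dvd (mem_nonZeroDivisors_of_ne_zero hx0)
  exact ⟨c, hc0, P.mem_of_dvd hc hxP⟩

theorem alg_quot {E A K κ : Type u} [Field E] [IsAlgClosed E] [Field A] [Field K]
    [Algebra E A] [Algebra E K] [Algebra E[X] A] [IsScalarTower E E[X] A] [Algebra.IsAlgebraic E[X] A]
    [FaithfulSMul E[X] A]
    (P : Ideal (A ⊗[E] K)) (hP0 : P ≠ ⊥) [CommRing κ] [IsDomain κ] [Algebra K κ]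
    (g : A ⊗[E] K →+* κ) (hg : Function.Surjective g) (hgP : ∀ x ∈ P, g x = 0)
    (hgK : ∀ k : K, g ((1 : A) ⊗ₜ k) = algebraMap K κ k) : Algebra.IsAlgebraic K κ := by
  obtain ⟨c, hc0, hc⟩ := exists_poly_mem P hP0
  let α : A →+* κ := g.comp (Algebra.TensorProduct.includeLeftRingHom (R := E) (A := A) (B := K))
  let t : A := algebraMap E[X] A Polynomial.X
  have ht : IsAlgebraic K (α t) := by
    refine ⟨c, hc0, ?_⟩
    have := hgP _ hc
    rw [Polynomial.hom_eval₂] at this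
    rw [Polynomial.aeval_def]
    have hh : algebraMap K κ = g.comp (Algebra.TensorProduct.includeRight (R := E) (A := A) (B := K)).toRingHom :=
      RingHom.ext fun k => (hgK k).symm
    rw [hh]
    exact this
  let C := integralClosure K κ
  have : Algebra.IsAlgebraic K C := inferInstance
  have htC : α t ∈ C := ht.isIntegral
  have hEC : ∀ p : E[X], α (algebraMap E[X] A p) ∈ C := by
    intro p
    induction p using Polynomial.induction_on' with
    | add p q hp hq => rw [map_add, map_add]; exact add_mem hp hq
    | monomial n e =>
      rw [← Polynomial.C_mul_X_pow_eq_monomial, map_mul, map_pow, map_mul, map_pow]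
      refine mul_mem ?_ (pow_mem htC n)
      have : algebraMap E[X] A (Polynomial.C e) = algebraMap E A e := by
        rw [IsScalarTower.algebraMap_apply E E[X] A]; rfl
      rw [this]
      have h3 : α (algebraMap E A e) = algebraMap K κ (algebraMap E K e) := by
        rw [← hgK]
        change g ((algebraMap E A e) ⊗ₜ[E] (1 : K)) = _
        rw [Algebra.algebraMap_eq_smul_one, Algebra.algebraMap_eq_smul_one, TensorProduct.smul_tmul]
      rw [h3]
      exact C.algebraMap_mem _
  let β : E[X] →+* C := (α.comp (algebraMap E[X] A)).codRestrict C hEC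
  have hβ : (algebraMap C κ).comp β = α.comp (algebraMap E[X] A) := rfl
  have hβi : Function.Injective β := by
    have : Function.Injective ((algebraMap C κ).comp β) := by
      rw [hβ]
      exact α.injective.comp (FaithfulSMul.algebraMap_injective _ _)
    exact Function.Injective.of_comp (f := algebraMap C κ) this
  have hα : ∀ a, IsAlgebraic K (α a) := by
    intro a
    have : IsAlgebraic C (α a) := by
      obtain ⟨p, hp0, hp⟩ := Algebra.IsAlgebraic.isAlgebraic (R := E[X]) a
      refine ⟨p.map β, ?_, ?_⟩
      · rwa [Ne, Polynomial.map_eq_zero_iff hβi]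
      · rw [Polynomial.aeval_def, Polynomial.eval₂_map, hβ, ← Polynomial.hom_eval₂, ← Polynomial.aeval_def, hp, map_zero]
    exact this.restrictScalars K
  refine ⟨fun y => ?_⟩
  obtain ⟨x, rfl⟩ := hg y
  induction x using TensorProduct.induction_on with
  | zero => rw [map_zero]; exact isAlgebraic_zero
  | tmul a k =>
    have : a ⊗ₜ[E] k = (a ⊗ₜ[E] (1 : K)) * ((1 : A) ⊗ₜ[E] k) := by simp
    rw [this, map_mul, hgK]
    exact (hα a).mul (isAlgebraic_algebraMap _)
  | add a b ha hb => rw [map_add]; exact ha.add hb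

theorem maximal_of_prime {E A K : Type u} [Field E] [IsAlgClosed E] [Field A] [Field K]
    [Algebra E A] [Algebra E K] [Algebra E[X] A] [IsScalarTower E E[X] A] [Algebra.IsAlgebraic E[X] A]
    [FaithfulSMul E[X] A] (P : Ideal (A ⊗[E] K)) (hP0 : P ≠ ⊥) (hP : P.IsPrime) : P.IsMaximal := by
  let _ : Algebra K ((A ⊗[E] K) ⧸ P) := ((Ideal.Quotient.mk P).comp
    (Algebra.TensorProduct.includeRight (R := E) (A := A) (B := K)).toRingHom).toAlgebra
  have := alg_quot P hP0 (Ideal.Quotient.mk P) Ideal.Quotient.mk_surjective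
    (fun x hx => Ideal.Quotient.eq_zero_iff_mem.mpr hx) (fun k => rfl)
  have : Algebra.IsIntegral K ((A ⊗[E] K) ⧸ P) := inferInstance
  exact Ideal.Quotient.maximal_of_isField P (isField_of_isIntegral_of_isField' (R := K) (Field.toIsField K))

theorem dedekind_tensor {E A K : Type u} [Field E] [IsAlgClosed E] [CharZero E] [Field A] [Field K]
    [Algebra E A] [Algebra E K] [Algebra E[X] A] [IsScalarTower E E[X] A] [Algebra.IsAlgebraic E[X] A]
    [FaithfulSMul E[X] A] [Algebra.EssFiniteType E K] : IsDedekindDomain (A ⊗[E] K) := by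
  have hg : Good (A ⊗[E] K) := Good.tensor
  have := hg.dom
  have := hg.noeth
  have := hg.normal
  have : Ring.DimensionLEOne (A ⊗[E] K) := ⟨fun {P} h0 hP => maximal_of_prime P h0 hP⟩
  exact { }
end PD

namespace PD
open scoped TensorProduct Polynomial

theorem norm_NDiv {R R' : Type u} [CommRing R] [CommRing R'] [IsDedekindDomain R] [IsDedekindDomain R']
    [Algebra R R'] [Module.Finite R R'] [Module.IsTorsionFree R R'] [CharZero R] 
    (P : Ideal R) (Q : Ideal R') [P.IsMaximal] [Q.IsMaximal] (hPQ : P = Q.under R)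
    (hsurj : Function.Surjective ((Ideal.Quotient.mk Q).comp (algebraMap R R'))) {n : ℕ}
    (hQ : NDiv n Q) : NDiv n P := by
  have : Q.LiesOver P := ⟨hPQ⟩
  have : CharZero (FractionRing R) := inferInstance
  have : PerfectField (FractionRing R) := inferInstance
  have h1 := Ideal.relNorm_eq_pow_of_isMaximal Q P
  have h2 : Q.inertiaDeg R = 1 := by
    rw [Ideal.inertiaDeg_eq_of_isMaximal P Q]
    let _ : Field (R ⧸ P) := Ideal.Quotient.field P
    have hb : Function.Bijective (Algebra.linearMap (R ⧸ P) (R' ⧸ Q)) := by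
      constructor
      · exact (algebraMap (R ⧸ P) (R' ⧸ Q)).injective
      · intro y
        obtain ⟨x, rfl⟩ := hsurj y
        exact ⟨Ideal.Quotient.mk P x, rfl⟩
    have := (LinearEquiv.ofBijective _ hb).finrank_eq
    rw [← this, Module.finrank_self]
  rw [h2, pow_one] at h1
  obtain ⟨f, hf, J, hJ⟩ := hQ
  have hN : Ideal.span {Algebra.intNorm R R' f} = Ideal.relNorm R (Ideal.span {f}) := (Ideal.relNorm_singleton R f).symm
  refine ⟨Algebra.intNorm R R' f, ?_, Ideal.relNorm R J, ?_⟩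
  · intro h
    rw [h, Ideal.span_singleton_eq_bot.mpr rfl, eq_comm, Ideal.relNorm_eq_bot_iff, Ideal.span_singleton_eq_bot] at hN
    exact hf hN
  · rw [hN, ← h1, ← map_mul, hJ, map_pow]

theorem c2 {E L A K K' κ : Type u} [Field E] [Field L] [Field A] [Field K] [Field K'] [Field κ]
    [Algebra E L] [Algebra E A] [Algebra E K] [Algebra E K'] [Algebra E κ] [Algebra K K'] [IsScalarTower E K K']
    (j : L →ₐ[E] A) (φ : L →ₐ[E] K') (hgen : Algebra.adjoin K (Set.range φ) = ⊤)
    (α : A →ₐ[E] κ) (ι : K' →ₐ[E] κ) (hαι : ∀ l, α (j l) = ι (φ l))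
    (P : Ideal (A ⊗[E] K))
    (hP : ∀ x, x ∈ P ↔ Algebra.TensorProduct.productMap α (ι.comp (IsScalarTower.toAlgHom E K K')) x = 0)
    (hPL : P ≤ (P.comap (tmap K j)).map (tmap K j))
    (Q : Ideal (A ⊗[E] K'))
    (hQ : Q = ((KaehlerDifferential.ideal E L).map (tmap L j)).map 
      (Algebra.TensorProduct.map (AlgHom.id E A) φ)) :
    P = Q.comap (Algebra.TensorProduct.map (AlgHom.id E A) (IsScalarTower.toAlgHom E K K')) ∧
    Function.Surjective ((Ideal.Quotient.mk Q).comp 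
      (Algebra.TensorProduct.map (AlgHom.id E A) (IsScalarTower.toAlgHom E K K')).toRingHom) := by
  let ρ := Algebra.TensorProduct.map (AlgHom.id E A) (IsScalarTower.toAlgHom E K K')
  have hQ' : Q = Ideal.span (Set.range fun l : L => (1 : A) ⊗ₜ[E] (φ l) - (j l) ⊗ₜ[E] (1 : K')) := by
    rw [hQ, ← KaehlerDifferential.span_range_eq_ideal, Ideal.map_span, Ideal.map_span, ← Set.range_comp,
      ← Set.range_comp]
    congr 2
    ext l
    simp
  have hrel : ∀ l, Ideal.Quotient.mk Q ((1 : A) ⊗ₜ[E] (φ l)) = Ideal.Quotient.mk Q ((j l) ⊗ₜ[E] (1 : K')) := by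
    intro l
    rw [Ideal.Quotient.eq, hQ']
    exact Ideal.subset_span ⟨l, rfl⟩
  constructor
  · apply le_antisymm
    · refine hPL.trans (Ideal.map_le_iff_le_comap.mpr ?_)
      intro y hy
      rw [Ideal.mem_comap, hP] at hy
      rw [Ideal.mem_comap, Ideal.mem_comap]
      let μ : L ⊗[E] K →ₐ[E] K' := Algebra.TensorProduct.productMap φ (IsScalarTower.toAlgHom E K K')
      have h1 : ι (μ y) = 0 := by
        rw [← hy]
        clear hy
        induction y using TensorProduct.induction_on with
        | zero => simp
        | tmul l k => simp [μ, hαι]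
        | add a b ha hb => rw [map_add, map_add, ha, hb, map_add, map_add]
      have h2 : μ y = 0 := by simpa using h1
      have h3 : Ideal.Quotient.mk Q (ρ (tmap K j y)) = Ideal.Quotient.mk Q ((1 : A) ⊗ₜ[E] (μ y)) := by
        clear hy h1 h2
        induction y using TensorProduct.induction_on with
        | zero => simp
        | tmul l k =>
          have e1 : ρ (tmap K j (l ⊗ₜ k)) = ((j l) ⊗ₜ[E] (1 : K')) * ((1 : A) ⊗ₜ[E] algebraMap K K' k) := by
            simp [ρ]
          have e2 : (1 : A) ⊗ₜ[E] (μ (l ⊗ₜ k)) = ((1 : A) ⊗ₜ[E] (φ l)) * ((1 : A) ⊗ₜ[E] algebraMap K K' k) := by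
            simp [μ]
          rw [e1, e2, map_mul, map_mul, hrel]
        | add a b ha hb => rw [map_add, map_add, map_add, ha, hb, map_add, TensorProduct.tmul_add, map_add]
      rw [h2, TensorProduct.tmul_zero, map_zero] at h3
      exact Ideal.Quotient.eq_zero_iff_mem.mp h3
    · intro x hx
      rw [hP]
      let ψ : A ⊗[E] K' →ₐ[E] κ := Algebra.TensorProduct.productMap α ι
      have h1 : Q ≤ RingHom.ker ψ := by
        rw [hQ', Ideal.span_le]
        rintro _ ⟨l, rfl⟩
        simp [ψ, hαι, RingHom.mem_ker]
      have h2 : ψ (ρ x) = 0 := h1 hx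
      rw [← h2]
      clear h2 hx
      induction x using TensorProduct.induction_on with
      | zero => simp
      | tmul l k => simp [ψ, ρ]
      | add a b ha hb => rw [map_add, ha, hb, map_add, map_add]
  · let q : A ⊗[E] K →+* (A ⊗[E] K') ⧸ Q := (Ideal.Quotient.mk Q).comp ρ.toRingHom
    have hq : ∀ a k, q (a ⊗ₜ k) = Ideal.Quotient.mk Q (a ⊗ₜ (algebraMap K K' k)) := fun a k => rfl
    have key : ∀ k' : K', ∃ x, q x = Ideal.Quotient.mk Q ((1 : A) ⊗ₜ k') := by
      intro k'
      have hk : k' ∈ Algebra.adjoin K (Set.range φ) := by rw [hgen]; trivial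
      induction hk using Algebra.adjoin_induction with
      | mem x hx =>
        obtain ⟨l, rfl⟩ := hx
        exact ⟨(j l) ⊗ₜ 1, by rw [hq, hrel, map_one]⟩
      | algebraMap k => exact ⟨1 ⊗ₜ k, hq _ _⟩
      | add x y _ _ hx hy =>
        obtain ⟨a, ha⟩ := hx
        obtain ⟨b, hb⟩ := hy
        exact ⟨a + b, by rw [map_add, ha, hb, TensorProduct.tmul_add, map_add]⟩
      | mul x y _ _ hx hy =>
        obtain ⟨a, ha⟩ := hx
        obtain ⟨b, hb⟩ := hy
        exact ⟨a * b, by rw [map_mul, ha, hb, ← map_mul, Algebra.TensorProduct.tmul_mul_tmul, one_mul]⟩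
    intro y
    obtain ⟨y, rfl⟩ := Ideal.Quotient.mk_surjective y
    induction y using TensorProduct.induction_on with
    | zero => exact ⟨0, by simp⟩
    | tmul a k' =>
      obtain ⟨x, hx⟩ := key k'
      refine ⟨(a ⊗ₜ 1) * x, ?_⟩
      change q _ = _
      rw [map_mul, hx, hq, map_one, ← map_mul, Algebra.TensorProduct.tmul_mul_tmul, one_mul, mul_one]
    | add a b ha hb =>
      obtain ⟨u, hu⟩ := ha
      obtain ⟨v, hv⟩ := hb
      exact ⟨u + v, by rw [map_add, hu, hv, map_add]⟩
end PD

namespace PD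
open scoped TensorProduct Polynomial

theorem finite_tensor {E A K K' : Type u} [Field E] [Field A] [Field K] [Field K']
    [Algebra E A] [Algebra E K] [Algebra E K'] [Algebra K K'] [IsScalarTower E K K'] [FiniteDimensional K K'] 
    [Algebra (A ⊗[E] K) (A ⊗[E] K')]
    (hal : ∀ a k, algebraMap (A ⊗[E] K) (A ⊗[E] K') (a ⊗ₜ k) = a ⊗ₜ algebraMap K K' k) :
    Module.Finite (A ⊗[E] K) (A ⊗[E] K') := by
  classical
  obtain ⟨s, hs⟩ := (Module.finite_def (R := K) (M := K')).mp inferInstance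
  refine ⟨⟨s.image (fun k' => (1 : A) ⊗ₜ k'), ?_⟩⟩
  rw [eq_top_iff]
  rintro x -
  have key : ∀ k' : K', (1 : A) ⊗ₜ[E] k' ∈ Submodule.span (A ⊗[E] K) 
      ((s.image (fun k' => (1 : A) ⊗ₜ[E] k') : Finset _) : Set (A ⊗[E] K')) := by
    intro k'
    have hk : k' ∈ Submodule.span K (s : Set K') := by rw [hs]; trivial
    induction hk using Submodule.span_induction with
    | mem x hx => exact Submodule.subset_span (by simpa using ⟨x, hx, rfl⟩)
    | zero => rw [TensorProduct.tmul_zero]; exact zero_mem _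
    | add x y _ _ hx hy => rw [TensorProduct.tmul_add]; exact add_mem hx hy
    | smul c x _ hx =>
      have : (1 : A) ⊗ₜ[E] (c • x) = ((1 : A) ⊗ₜ[E] c) • ((1 : A) ⊗ₜ[E] x) := by
        rw [Algebra.smul_def ((1 : A) ⊗ₜ[E] c), hal, Algebra.TensorProduct.tmul_mul_tmul, one_mul, Algebra.smul_def]
      rw [this]
      exact Submodule.smul_mem _ _ hx
  induction x using TensorProduct.induction_on with
  | zero => exact zero_mem _
  | tmul a k' =>
    have : a ⊗ₜ[E] k' = (a ⊗ₜ[E] (1 : K)) • ((1 : A) ⊗ₜ[E] k') := by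
      rw [Algebra.smul_def (a ⊗ₜ[E] (1 : K)), hal, Algebra.TensorProduct.tmul_mul_tmul, map_one, one_mul, mul_one]
    rw [this]
    exact Submodule.smul_mem _ _ (key k')
  | add x y hx hy => exact add_mem hx hy

theorem c3 {E L A K K' κ : Type u} [Field E] [IsAlgClosed E] [CharZero E] [Field L] [Field A] [IsAlgClosed A]
    [Field K] [Field K'] [Field κ]
    [Algebra E L] [Algebra E A] [Algebra L A] [IsScalarTower E L A]
    [Algebra E K] [Algebra E K'] [Algebra E κ] [Algebra K K'] [IsScalarTower E K K']
    [FiniteDimensional K K'] [Algebra.EssFiniteType E K] [Algebra.EssFiniteType E L]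
    [Algebra E[X] A] [IsScalarTower E E[X] A] [Algebra.IsAlgebraic E[X] A] [FaithfulSMul E[X] A]
    (F0 : Type u) [Field F0] [Algebra E[X] F0]
    [IsFractionRing E[X] F0] [Algebra E F0] [IsScalarTower E E[X] F0]
    [Algebra E[X] L] [IsScalarTower E E[X] L] [Algebra F0 L]
    [IsScalarTower E[X] F0 L] [FiniteDimensional F0 L]
    (φ : L →ₐ[E] K') (hgen : Algebra.adjoin K (Set.range φ) = ⊤)
    (α : A →ₐ[E] κ) (ι : K' →ₐ[E] κ) (hαι : ∀ l, α (algebraMap L A l) = ι (φ l))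
    (P : Ideal (A ⊗[E] K)) (hPm : P.IsMaximal)
    (hP : ∀ x, x ∈ P ↔ Algebra.TensorProduct.productMap α (ι.comp (IsScalarTower.toAlgHom E K K')) x = 0)
    (hPL : P ≤ (P.comap (tmap K (IsScalarTower.toAlgHom E L A))).map (tmap K (IsScalarTower.toAlgHom E L A)))
    (n : ℕ) (hn : 1 ≤ n) : NDiv n P := by
  obtain ⟨m, rfl⟩ := Nat.exists_eq_add_of_le' hn
  let j := IsScalarTower.toAlgHom E L A
  let ρ := Algebra.TensorProduct.map (AlgHom.id E A) (IsScalarTower.toAlgHom E K K')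
  let σ := Algebra.TensorProduct.map (AlgHom.id E A) φ
  obtain ⟨Q, hQ⟩ : ∃ Q : Ideal (A ⊗[E] K'), Q = ((KaehlerDifferential.ideal E L).map (tmap L j)).map σ := ⟨_, rfl⟩
  obtain ⟨hPQ, hsurj⟩ := c2 j φ hgen α ι hαι P hP hPL Q hQ
  have hess : Algebra.EssFiniteType E K' := Algebra.EssFiniteType.comp E K K'
  have hD : IsDedekindDomain (A ⊗[E] K) := dedekind_tensor
  have hD' : IsDedekindDomain (A ⊗[E] K') := dedekind_tensor
  have hDL : IsDomain (A ⊗[E] L) := isDomain_tensor E A L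
  have hQm : Q.IsMaximal := by
    let q := (Ideal.Quotient.mk Q).comp ρ.toRingHom
    have hk : RingHom.ker q = P := by
      rw [hPQ]
      ext x
      rw [RingHom.mem_ker, Ideal.mem_comap]
      exact Ideal.Quotient.eq_zero_iff_mem
    have e := RingHom.quotientKerEquivOfSurjective (f := q) hsurj
    have hf : IsField ((A ⊗[E] K) ⧸ (RingHom.ker q)) :=
      (Ideal.Quotient.maximal_ideal_iff_isField_quotient _).mp (by rw [hk]; exact hPm)
    exact Ideal.Quotient.maximal_of_isField Q (e.symm.toMulEquiv.isField hf)
  have hQn : NDiv (m + 1) Q := by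
    obtain ⟨f, J, hf, hJ⟩ := d2 (E := E) (L := L) (Ω := A) F0 m
    rw [hQ]
    refine NDiv.map ⟨f, hf, J, hJ⟩ σ.toRingHom ?_
    exact Module.Flat.lTensor_preserves_injective_linearMap (M := A) φ.toLinearMap φ.injective
  let _ : Algebra (A ⊗[E] K) (A ⊗[E] K') := ρ.toRingHom.toAlgebra
  have hinj : Function.Injective (algebraMap (A ⊗[E] K) (A ⊗[E] K')) :=
    Module.Flat.lTensor_preserves_injective_linearMap (M := A) (IsScalarTower.toAlgHom E K K').toLinearMap
      (algebraMap K K').injective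
  have : Module.Finite (A ⊗[E] K) (A ⊗[E] K') := finite_tensor (fun a k => rfl)
  have : Module.IsTorsionFree (A ⊗[E] K) (A ⊗[E] K') := by
    have : FaithfulSMul (A ⊗[E] K) (A ⊗[E] K') := (faithfulSMul_iff_algebraMap_injective _ _).mpr hinj
    infer_instance
  have : CharZero (A ⊗[E] K) := charZero_of_injective_algebraMap (algebraMap E (A ⊗[E] K)).injective
  exact norm_NDiv P Q hPQ hsurj hQn
end PD

namespace PD
open scoped TensorProduct Polynomial

theorem exists_finset_range {E A K : Type u} [Field E] [Field A] [Field K]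
    [Algebra E A] [Algebra E K] (T : Finset (A ⊗[E] K)) :
    ∃ W : Finset A, ∀ (L : IntermediateField E A), (W : Set A) ⊆ L → 
      ∀ x ∈ T, ∃ y : L ⊗[E] K, tmap K (IsScalarTower.toAlgHom E L A) y = x := by
  classical
  have h1 : ∀ x : A ⊗[E] K, ∃ W : Finset A, ∀ (L : IntermediateField E A), (W : Set A) ⊆ L → 
      ∃ y : L ⊗[E] K, tmap K (IsScalarTower.toAlgHom E L A) y = x := by
    intro x
    induction x using TensorProduct.induction_on with
    | zero => exact ⟨∅, fun L _ => ⟨0, map_zero _⟩⟩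
    | tmul a k => exact ⟨{a}, fun L hL => ⟨(⟨a, hL (by simp)⟩ : L) ⊗ₜ k, by simp⟩⟩
    | add a b ha hb =>
      obtain ⟨W, hW⟩ := ha
      obtain ⟨W', hW'⟩ := hb
      refine ⟨W ∪ W', fun L hL => ?_⟩
      rw [Finset.coe_union, Set.union_subset_iff] at hL
      obtain ⟨y, hy⟩ := hW L hL.1
      obtain ⟨z, hz⟩ := hW' L hL.2
      exact ⟨y + z, by rw [map_add, hy, hz]⟩
  choose W hW using h1
  refine ⟨T.biUnion W, fun L hL x hx => hW x L (Set.Subset.trans ?_ hL)⟩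
  intro a ha
  simp only [Finset.coe_biUnion, Set.mem_iUnion]
  exact ⟨x, hx, ha⟩

theorem c4 {E A K κ : Type u} [Field E] [IsAlgClosed E] [CharZero E] [Field A] [IsAlgClosed A]
    [Field K] [Field κ]
    [Algebra E A] [Algebra E K] [Algebra E κ] [Algebra K κ] [IsScalarTower E K κ]
    [Algebra.EssFiniteType E K] 
    [Algebra E[X] A] [IsScalarTower E E[X] A] [Algebra.IsAlgebraic E[X] A] [FaithfulSMul E[X] A]
    (g : A ⊗[E] K →ₐ[E] κ) (hg : Function.Surjective g) 
    (hgK : ∀ k : K, g ((1 : A) ⊗ₜ k) = algebraMap K κ k)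
    (P : Ideal (A ⊗[E] K)) (hP0 : P ≠ ⊥) (hPm : P.IsMaximal) (hPg : ∀ x, x ∈ P ↔ g x = 0)
    (n : ℕ) (hn : 1 ≤ n) : NDiv n P := by
  classical
  have halg : Algebra.IsAlgebraic K κ := alg_quot P hP0 g.toRingHom hg (fun x hx => (hPg x).mp hx) hgK
  have hD : IsDedekindDomain (A ⊗[E] K) := dedekind_tensor
  obtain ⟨T, hT⟩ := (IsNoetherian.noetherian P : P.FG)
  obtain ⟨W, hW⟩ := exists_finset_range T
  let t : A := algebraMap E[X] A Polynomial.X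
  let S : Finset A := insert t W
  let L : IntermediateField E A := IntermediateField.adjoin E (S : Set A)
  have hSL : (S : Set A) ⊆ L := IntermediateField.subset_adjoin E _
  have hWL : (W : Set A) ⊆ L := fun x hx => hSL (by simp [S, hx])
  have htL : t ∈ L := hSL (by simp [S])
  have hess : Algebra.EssFiniteType E L := IntermediateField.essFiniteType_iff.mpr ⟨S, rfl⟩
  let _ : Algebra E[X] L := (Polynomial.aeval (R := E) (⟨t, htL⟩ : L)).toRingHom.toAlgebra
  have hEXL : ∀ p, algebraMap E[X] L p = Polynomial.aeval (R := E) (⟨t, htL⟩ : L) p := fun p => rfl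
  have hEXA : ∀ p, algebraMap E[X] A p = Polynomial.aeval (R := E) t p := by
    intro p
    have h : IsScalarTower.toAlgHom E E[X] A = Polynomial.aeval (R := E) t := by
      apply Polynomial.algHom_ext
      simp [t]
    exact congrArg (fun f => f p) h
  have hLA : ∀ p, algebraMap L A (algebraMap E[X] L p) = algebraMap E[X] A p := by
    intro p
    rw [hEXL, hEXA, ← Polynomial.aeval_algebraMap_apply]
    rfl
  have : IsScalarTower E E[X] L := .of_algebraMap_eq fun r => by rw [hEXL]; simp
  have : IsScalarTower E[X] L A := .of_algebraMap_eq fun p => (hLA p).symm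
  have : FaithfulSMul E[X] L := (faithfulSMul_iff_algebraMap_injective _ _).mpr (by
    intro p q h
    apply FaithfulSMul.algebraMap_injective E[X] A
    rw [← hLA, ← hLA, h])
  have halgL : Algebra.IsAlgebraic E[X] L := ⟨fun l => 
    (isAlgebraic_algebraMap_iff (algebraMap L A).injective).mp (Algebra.IsAlgebraic.isAlgebraic (R := E[X]) (algebraMap L A l))⟩
  let F0 := FractionRing E[X]
  let _ : Algebra F0 L := FractionRing.liftAlgebra E[X] L
  have : IsScalarTower E[X] F0 L := FractionRing.isScalarTower_liftAlgebra E[X] L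
  have : IsScalarTower E F0 L := by
    refine .of_algebraMap_eq fun r => ?_
    rw [IsScalarTower.algebraMap_apply E E[X] F0, ← IsScalarTower.algebraMap_apply E[X] F0 L, 
      ← IsScalarTower.algebraMap_apply E E[X] L]
  have : Algebra.EssFiniteType F0 L := Algebra.EssFiniteType.of_comp E F0 L
  have : Algebra.IsAlgebraic F0 L := Algebra.IsAlgebraic.extendScalars (R := E[X]) (S := F0) (IsFractionRing.injective E[X] F0)
  have : FiniteDimensional F0 L := Algebra.finite_of_essFiniteType_of_isAlgebraic
  let α : A →ₐ[E] κ := g.comp Algebra.TensorProduct.includeLeft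
  let K' : IntermediateField K κ := IntermediateField.adjoin K (α '' (S : Set A))
  have : FiniteDimensional K K' := IntermediateField.finiteDimensional_adjoin (fun x _ => (halg.isAlgebraic x).isIntegral)
  have hLK : ∀ l : L, α l ∈ K' := by
    intro l
    have : L ≤ (K'.restrictScalars E).comap α := by
      rw [IntermediateField.adjoin_le_iff]
      intro x hx
      exact IntermediateField.subset_adjoin K _ ⟨x, hx, rfl⟩
    exact this l.2
  let φ : L →ₐ[E] K' := (α.comp L.val).codRestrict (K'.toSubalgebra.restrictScalars E) hLK
  let ι : K' →ₐ[E] κ := K'.val.restrictScalars E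
  have hφ : ∀ l : L, (φ l : κ) = α l := fun l => rfl
  have hgen : Algebra.adjoin K (Set.range φ) = ⊤ := by
    rw [eq_top_iff]
    rintro ⟨k, hk⟩ -
    have h1 : k ∈ Algebra.adjoin K (α '' (S : Set A)) := by
      rw [← IntermediateField.adjoin_toSubalgebra]; exact hk
    have h2 : Algebra.adjoin K (α '' (S : Set A)) ≤ (Algebra.adjoin K (Set.range φ)).map K'.val := by
      rw [Algebra.adjoin_le_iff]
      rintro _ ⟨s, hs, rfl⟩
      exact ⟨φ ⟨s, hSL hs⟩, Algebra.subset_adjoin ⟨_, rfl⟩, rfl⟩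
    obtain ⟨z, hz, hzk⟩ := h2 h1
    have : z = ⟨k, hk⟩ := Subtype.ext hzk
    rw [← this]
    exact hz
  refine c3 F0 φ hgen α ι (fun l => rfl) P hPm (fun x => ?_) ?_ n hn
  · rw [hPg]
    have : g = Algebra.TensorProduct.productMap α (ι.comp (IsScalarTower.toAlgHom E K K')) := by
      apply Algebra.TensorProduct.ext'
      intro a k
      have e : a ⊗ₜ[E] k = (a ⊗ₜ[E] (1 : K)) * ((1 : A) ⊗ₜ[E] k) := by simp
      rw [Algebra.TensorProduct.productMap_apply_tmul, e, map_mul, hgK]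
      rfl
    rw [← this]
  · refine hT.ge.trans (Ideal.span_le.mpr fun x hx => ?_)
    obtain ⟨y, hy⟩ := hW L hWL x hx
    rw [← hy]
    refine Ideal.mem_map_of_mem _ ?_
    rw [Ideal.mem_comap, hy]
    exact hT ▸ Ideal.subset_span hx

theorem cNDiv {E A K : Type u} [Field E] [IsAlgClosed E] [CharZero E] [Field A] [IsAlgClosed A]
    [Field K] [Algebra E A] [Algebra E K] [Algebra.EssFiniteType E K] 
    [Algebra E[X] A] [IsScalarTower E E[X] A] [Algebra.IsAlgebraic E[X] A] [FaithfulSMul E[X] A]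
    (P : Ideal (A ⊗[E] K)) (hP0 : P ≠ ⊥) (hP : P.IsPrime) 
    (n : ℕ) (hn : 1 ≤ n) : NDiv n P := by
  have hPm := maximal_of_prime P hP0 hP
  let _ : Field ((A ⊗[E] K) ⧸ P) := Ideal.Quotient.field P
  let _ : Algebra K ((A ⊗[E] K) ⧸ P) := ((Ideal.Quotient.mk P).comp
    (Algebra.TensorProduct.includeRight (R := E) (A := A) (B := K)).toRingHom).toAlgebra
  have : IsScalarTower E K ((A ⊗[E] K) ⧸ P) := .of_algebraMap_eq fun e => by
    change Ideal.Quotient.mk P ((algebraMap E A e) ⊗ₜ[E] (1 : K)) = Ideal.Quotient.mk P ((1 : A) ⊗ₜ[E] (algebraMap E K e))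
    rw [Algebra.algebraMap_eq_smul_one, Algebra.algebraMap_eq_smul_one, TensorProduct.smul_tmul]
  exact c4 (κ := (A ⊗[E] K) ⧸ P) (Ideal.Quotient.mkₐ E P) (Ideal.Quotient.mkₐ_surjective E P) (fun k => rfl) P hP0 hPm
    (fun x => Ideal.Quotient.eq_zero_iff_mem.symm) n hn
end PD

namespace PD
open scoped TensorProduct Polynomial

theorem step_a {S R : Type u} [CommRing S] [CommRing R] [IsDomain S] [IsNoetherianRing S] [IsDomain R]
    (φ : S →+* R) (hφ : Function.Injective φ) {n : ℕ}
    (hpr : ∀ p : Ideal S, p.IsPrime → (p.map φ).IsPrime)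
    (hS : ∀ p : Ideal S, H1 p → NDiv n p) (P : Ideal R) (hP : H1 P) (y : S) (hy : y ≠ 0) (hyP : φ y ∈ P) :
    NDiv n P := by
  have := hP.prime
  have hle : Ideal.span {y} ≤ P.comap φ := by
    rw [Ideal.span_singleton_le_iff_mem]; exact hyP
  obtain ⟨p, hp, hpP⟩ := Ideal.exists_minimalPrimes_le hle
  have hp1 := H1.of_minimal hy hp
  have h2 : p.map φ = P := by
    refine hP.min _ (hpr p hp1.prime) (Ideal.map_le_iff_le_comap.mpr hpP) ?_
    rw [Ne, Ideal.map_eq_bot_iff_of_injective hφ]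
    exact hp1.ne_bot
  rw [← h2]
  exact (hS p hp1).map φ hφ

theorem inv_dedekind {R : Type u} [CommRing R] [IsDedekindDomain R] (I : Ideal R) (hI : I ≠ ⊥) : Inv I := by
  obtain ⟨a, ha, ha0⟩ := Submodule.exists_mem_ne_zero_of_ne_bot hI
  have : I ∣ Ideal.span {a} := by
    rw [Ideal.dvd_iff_le, Ideal.span_singleton_le_iff_mem]; exact ha
  obtain ⟨J, hJ⟩ := this
  exact ⟨J, a, ha0, hJ.symm⟩

theorem exists_common {R S : Type u} [CommRing R] [CommRing S] [Algebra R S] (M : Submonoid R) [IsLocalization M S]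
    (hM : M ≤ nonZeroDivisors R) (T : Finset R) (J : Ideal R)
    (h : ∀ x ∈ T, algebraMap R S x ∈ J.map (algebraMap R S)) : ∃ m ∈ M, ∀ x ∈ T, m * x ∈ J := by
  classical
  induction T using Finset.induction_on with
  | empty => exact ⟨1, M.one_mem, by simp⟩
  | insert a T _ ih =>
    obtain ⟨m, hm, hmT⟩ := ih (fun x hx => h x (Finset.mem_insert_of_mem hx))
    obtain ⟨⟨z, s⟩, hz⟩ := (IsLocalization.mem_map_algebraMap_iff M S).mp (h a (Finset.mem_insert_self _ _))
    rw [← map_mul] at hz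
    have hz' : a * s = z := IsLocalization.injective S hM hz
    refine ⟨m * s, M.mul_mem hm s.2, fun x hx => ?_⟩
    rcases Finset.mem_insert.mp hx with rfl | hx
    · have : m * s * x = m * z := by rw [← hz']; ring
      rw [this]; exact J.mul_mem_left _ z.2
    · have : m * s * x = s * (m * x) := by ring
      rw [this]; exact J.mul_mem_left _ (hmT x hx)

theorem step_b {S R Q : Type u} [CommRing S] [CommRing R] [IsDomain S] [IsNoetherianRing S]
    [CommRing Q] [IsDedekindDomain Q] [Algebra R Q] (hR : Good R)
    (φ : S →+* R) (hφ : Function.Injective φ) [IsLocalization ((nonZeroDivisors S).map φ) Q] {n : ℕ} (hn : 1 ≤ n)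
    (hpr : ∀ p : Ideal S, p.IsPrime → (p.map φ).IsPrime)
    (hS : ∀ p : Ideal S, H1 p → NDiv n p) 
    (hQ : ∀ p : Ideal Q, p ≠ ⊥ → p.IsPrime → NDiv n p)
    (P : Ideal R) (hP : H1 P) : NDiv n P := by
  have := hR.dom
  have := hR.noeth
  by_cases hex : ∃ y : S, y ≠ 0 ∧ φ y ∈ P
  · obtain ⟨y, hy, hyP⟩ := hex
    exact step_a φ hφ hpr hS P hP y hy hyP
  push Not at hex
  set M := (nonZeroDivisors S).map φ with hMdef
  have hM : M ≤ nonZeroDivisors R := by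
    rintro _ ⟨s, hs, rfl⟩
    refine mem_nonZeroDivisors_of_ne_zero ?_
    rw [Ne, map_eq_zero_iff _ hφ]
    exact nonZeroDivisors.ne_zero hs
  have hinj : Function.Injective (algebraMap R Q) := IsLocalization.injective Q hM
  have hdisj : Disjoint (M : Set R) P := by
    rw [Set.disjoint_left]
    rintro _ ⟨s, hs, rfl⟩ h
    exact hex s (nonZeroDivisors.ne_zero hs) h
  have hPQ := hP.localize hM Q hdisj
  obtain ⟨f, hf, J, hJ⟩ := hQ _ hPQ.ne_bot hPQ.prime
  obtain ⟨⟨a, m⟩, ham⟩ := IsLocalization.surj M f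
  have hmu : IsUnit (algebraMap R Q m) := IsLocalization.map_units Q m
  have hspan : Ideal.span {f} = Ideal.span {algebraMap R Q a} := by
    rw [← ham]
    exact (Ideal.span_singleton_mul_right_unit hmu f).symm
  have ha : a ≠ 0 := by
    rintro rfl
    rw [map_zero] at ham
    exact hf (hmu.mul_left_eq_zero.mp ham)
  have hJ0 : J ≠ ⊥ := by
    rintro rfl
    have h0 : (⊥ : Ideal Q) ^ n = ⊥ := zero_pow (by omega)
    rw [h0] at hJ
    rcases mul_eq_zero.mp hJ with h | h
    · exact hf (by simpa using h)
    · exact hPQ.ne_bot h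
  have key : ∀ J : Ideal Q, Inv J → ∃ J1 : Ideal R, Inv J1 ∧ J1.map (algebraMap R Q) = J := by
    refine Inv.induction (fun P hP => inv_dedekind P hP.ne_bot) _ ⟨⊤, Inv.top, Ideal.map_top _⟩ ?_
    rintro p I hp hI ⟨I1, hI1, rfl⟩
    refine ⟨p.under R * I1, (inv_of_H1 hR (hp.comap hM Q)).mul hI1, ?_⟩
    rw [Ideal.map_mul, IsLocalization.map_under M Q]
  obtain ⟨J1, hJ1, rfl⟩ := key J (inv_dedekind J hJ0)
  have hIQ : (Ideal.span {a} * P).map (algebraMap R Q) = (J1 ^ n).map (algebraMap R Q) := by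
    rw [Ideal.map_mul, Ideal.map_span, Set.image_singleton, ← hspan, hJ, Ideal.map_pow]
  have hI : Inv (Ideal.span {a} * P) := (Inv.span ha).mul (inv_of_H1 hR hP)
  obtain ⟨T, hT⟩ := (IsNoetherian.noetherian (Ideal.span {a} * P) : (Ideal.span {a} * P).FG)
  obtain ⟨s, hs, hsT⟩ := exists_common (S := Q) M hM T (J1 ^ n) (by
    intro x hx
    rw [← hIQ]
    exact Ideal.mem_map_of_mem _ (hT ▸ Ideal.subset_span hx))
  have hs0 : s ≠ 0 := nonZeroDivisors.ne_zero (hM hs)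
  have hle : Ideal.span {s} * (Ideal.span {a} * P) ≤ J1 ^ n := by
    rw [← hT, Ideal.span_mul_span', Ideal.span_le]
    rintro _ ⟨x, hx, y, hy, rfl⟩
    rw [Set.mem_singleton_iff] at hx
    rw [hx]
    exact hsT y hy
  obtain ⟨Z, hZ⟩ := (hJ1.pow n).dvd hle
  have hsI : Inv (Ideal.span {s} * (Ideal.span {a} * P)) := (Inv.span hs0).mul hI
  have hZI : Inv Z := Inv.of_mul_right (hZ ▸ hsI)
  have hsu : IsUnit (algebraMap R Q s) := IsLocalization.map_units Q ⟨s, hs⟩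
  have hZt : Z.map (algebraMap R Q) = ⊤ := by
    refine Inv.cancel (I := (J1 ^ n).map (algebraMap R Q)) ?_ ?_
    · apply inv_dedekind
      rw [Ne, Ideal.map_eq_bot_iff_of_injective hinj]
      exact (hJ1.pow n).ne_bot
    · rw [← Ideal.map_mul, ← hZ, Ideal.map_mul, hIQ, Ideal.map_span, Set.image_singleton,
        Ideal.span_singleton_eq_top.mpr hsu, mul_comm]
  have hZM : ∃ z ∈ M, z ∈ Z := by
    have h1 : (1 : Q) ∈ Z.map (algebraMap R Q) := by rw [hZt]; trivial
    obtain ⟨⟨z, t⟩, hz⟩ := (IsLocalization.mem_map_algebraMap_iff M Q).mp h1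
    rw [one_mul] at hz
    have := hinj hz
    exact ⟨t, t.2, this ▸ z.2⟩
  obtain ⟨_, ⟨y, hy, rfl⟩, hyZ⟩ := hZM
  have hZN : NDiv n Z := NDiv.of_primes (fun P hP => inv_of_H1 hR hP) hZI (fun P' hP' hZP' =>
    step_a φ hφ hpr hS P' hP' y (nonZeroDivisors.ne_zero hy) (hZP' hyZ))
  have hJN : NDiv n (J1 ^ n) := ⟨1, one_ne_zero, J1, by simp⟩
  have hN : NDiv n (P * (Ideal.span {s} * Ideal.span {a})) := by
    have : P * (Ideal.span {s} * Ideal.span {a}) = J1 ^ n * Z := by rw [← hZ]; ring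
    rw [this]
    exact hJN.mul hZN
  exact NDiv.cancel hn hN ((NDiv.span hn hs0).mul (NDiv.span hn ha)) ((Inv.span hs0).mul (Inv.span ha))
end PD

namespace PD
open scoped TensorProduct Polynomial

theorem dedekind_of_ringEquiv {R R' : Type u} [CommRing R] [CommRing R'] (e : R ≃+* R') (h : IsDedekindDomain R) :
    IsDedekindDomain R' := by
  have := e.symm.toMulEquiv.isDomain
  have h1 : IsNoetherianRing R' := isNoetherianRing_of_ringEquiv R e
  have h2 : IsIntegrallyClosed R' := IsIntegrallyClosed.of_equiv e
  have h3 : Ring.DimensionLEOne R' := by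
    refine ⟨?_⟩
    intro p hp hpp
    have h4 : (p.comap e).IsMaximal := by
      refine Ring.DimensionLEOne.maximalOfPrime ?_ (Ideal.comap_isPrime e p)
      intro h
      apply hp
      rw [← Ideal.map_comap_of_surjective e e.surjective p, h, Ideal.map_bot]
    have := Ideal.map_isMaximal_of_equiv e (p := p.comap e)
    rwa [Ideal.map_comap_of_surjective e e.surjective p] at this
  exact {}

def AllN (n : ℕ) (R : Type u) [CommRing R] : Prop := ∀ P : Ideal R, H1 P → NDiv n P

theorem H1.comap_equiv {R R' : Type u} [CommRing R] [CommRing R'] (e : R ≃+* R') {P : Ideal R'} (h : H1 P) :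
    H1 (P.comap e) := by
  have := h.prime
  refine ⟨Ideal.comap_isPrime e P, ?_, ?_⟩
  · intro hb
    apply h.ne_bot
    rw [← Ideal.map_comap_of_surjective e e.surjective P, hb, Ideal.map_bot]
  · intro Q hQ hQP hQ0
    have h1 : Q.map e = P := by
      refine h.min _ (Ideal.map_isPrime_of_equiv e) ?_ ?_
      · exact Ideal.map_le_iff_le_comap.mpr hQP
      · intro hb
        exact hQ0 ((Ideal.map_eq_bot_iff_of_injective (f := e) e.injective).mp hb)
    rw [← h1, Ideal.comap_map_of_bijective e e.bijective]

theorem AllN.of_ringEquiv {R R' : Type u} [CommRing R] [CommRing R'] [IsDomain R] (e : R ≃+* R') {n : ℕ}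
    (h : AllN n R) : AllN n R' := by
  have := e.symm.toMulEquiv.isDomain
  intro P hP
  have h1 := (h _ (hP.comap_equiv e)).map e.toRingHom e.injective
  have h2 : Ideal.map e.toRingHom (Ideal.comap e P) = P := Ideal.map_comap_of_surjective e e.surjective P
  rwa [h2] at h1

theorem prime_extend {E A S : Type u} [Field E] [IsAlgClosed E] [Field A] [Algebra E A]
    [CommRing S] [Algebra E S] (p : Ideal S) (hp : p.IsPrime) :
    (p.map (Algebra.TensorProduct.includeLeft : S →ₐ[E] S ⊗[E] A).toRingHom).IsPrime := by
  have h := Algebra.TensorProduct.rTensor_ker (R := E) (C := A) (Ideal.Quotient.mkₐ E p) (Ideal.Quotient.mkₐ_surjective E p)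
  have hk : RingHom.ker (Ideal.Quotient.mkₐ E p) = p := Ideal.Quotient.mkₐ_ker E p
  rw [hk] at h
  have h' : p.map (Algebra.TensorProduct.includeLeft : S →ₐ[E] S ⊗[E] A).toRingHom = 
    RingHom.ker (Algebra.TensorProduct.map (Ideal.Quotient.mkₐ E p) (AlgHom.id E A)) := h.symm
  rw [h']
  have := isDomain_tensor E (S ⧸ p) A
  exact RingHom.ker_isPrime _

theorem step_c {E A S : Type u} [Field E] [IsAlgClosed E] [CharZero E] [Field A] [IsAlgClosed A]
    [Algebra E A] [Algebra E[X] A] [IsScalarTower E E[X] A] [Algebra.IsAlgebraic E[X] A] [FaithfulSMul E[X] A]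
    [CommRing S] [Algebra E S] [IsDomain S] [IsNoetherianRing S] [Algebra.EssFiniteType E S]
    (hG : Good (S ⊗[E] A)) (n : ℕ) (hn : 1 ≤ n) (hS : AllN n S) : AllN n (S ⊗[E] A) := by
  let K := FractionRing S
  have : Algebra.EssFiniteType E K := inferInstance
  have hD0 : IsDedekindDomain (A ⊗[E] K) := dedekind_tensor
  let e : (A ⊗[E] K) ≃+* (K ⊗[E] A) := (Algebra.TensorProduct.comm E A K).toRingEquiv
  have hD : IsDedekindDomain (K ⊗[E] A) := dedekind_of_ringEquiv e hD0
  let _ : Algebra (S ⊗[E] A) (K ⊗[E] A) :=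
    (Algebra.TensorProduct.map (IsScalarTower.toAlgHom E S K) (AlgHom.id E A)).toRingHom.toAlgebra
  have hal : ∀ (p : S) (r : A), algebraMap (S ⊗[E] A) (K ⊗[E] A) (p ⊗ₜ r) = 
    algebraMap S K p ⊗ₜ r := fun p r => rfl
  have : IsScalarTower S (S ⊗[E] A) (K ⊗[E] A) :=
    IsScalarTower.of_algebraMap_eq (R := S) (S := S ⊗[E] A) (A := K ⊗[E] A) fun p => by
    change algebraMap S K p ⊗ₜ (1 : A) =
      algebraMap (S ⊗[E] A) (K ⊗[E] A) (p ⊗ₜ (1 : A))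
    rw [hal]
  have hloc := IsLocalization.tensorProduct_tensorProduct E A (nonZeroDivisors S) K (by
    ext r; change algebraMap (S ⊗[E] A) (K ⊗[E] A) (1 ⊗ₜ r) = _
    rw [hal, map_one]; rfl)
  let φ : S →+* S ⊗[E] A := (Algebra.TensorProduct.includeLeft : S →ₐ[E] S ⊗[E] A).toRingHom
  have hφ : Function.Injective φ :=
    Algebra.TensorProduct.includeLeft_injective (S := S) (algebraMap E A).injective
  have hloc' : IsLocalization ((nonZeroDivisors S).map φ) (K ⊗[E] A) := hloc
  refine step_b (Q := K ⊗[E] A) hG φ hφ hn (fun p hp => prime_extend p hp) hS ?_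
  intro p hp0 hp
  have h1 : NDiv n (p.comap e) := by
    refine cNDiv _ ?_ (Ideal.comap_isPrime e p) n hn
    intro h
    apply hp0
    rw [← Ideal.map_comap_of_surjective e e.surjective p, h, Ideal.map_bot]
  have h2 := h1.map e.toRingHom e.injective
  have h3 : Ideal.map e.toRingHom (Ideal.comap e p) = p := Ideal.map_comap_of_surjective e e.surjective p
  rwa [h3] at h2

theorem step_d {F E A B : Type u} [Field F] [IsAlgClosed F] [CharZero F] [Field E] [IsAlgClosed E] [CharZero E] [Field A] [IsAlgClosed A]
    [Field B] [Algebra F B] [Algebra.EssFiniteType F B] [Algebra F E] [Algebra F A]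
    [Algebra E A] [IsScalarTower F E A] [Algebra E[X] A] [IsScalarTower E E[X] A] [Algebra.IsAlgebraic E[X] A] [FaithfulSMul E[X] A]
    (n : ℕ) (hn : 1 ≤ n) (hS : AllN n (E ⊗[F] B)) : AllN n (A ⊗[F] B) := by
  have hGS : Good (E ⊗[F] B) := Good.tensor
  have hGR : Good (A ⊗[F] B) := Good.tensor
  have := hGS.dom
  have := hGS.noeth
  let e1 : A ⊗[E] (E ⊗[F] B) ≃ₐ[E] A ⊗[F] B := Algebra.TensorProduct.cancelBaseChange F E E A B
  let e2 : (E ⊗[F] B) ⊗[E] A ≃ₐ[E] A ⊗[F] B := (Algebra.TensorProduct.comm E _ _).trans e1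
  have hG' : Good ((E ⊗[F] B) ⊗[E] A) := hGR.of_ringEquiv e2.symm.toRingEquiv
  have := hG'.dom
  exact (step_c hG' n hn hS).of_ringEquiv e2.toRingEquiv
end PD

namespace PD
open scoped TensorProduct Polynomial

theorem alg_of_range {k M A : Type u} [Field k] [Field M] [Field A] [Algebra k A] [Algebra M A]
    (h : ∀ x : k, ∃ y : M, algebraMap M A y = algebraMap k A x) [Algebra.IsAlgebraic k A] :
    Algebra.IsAlgebraic M A := by
  refine ⟨fun a => ?_⟩
  obtain ⟨p, hp0, hp⟩ := Algebra.IsAlgebraic.isAlgebraic (R := k) a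
  have hl : p.map (algebraMap k A) ∈ Polynomial.lifts (algebraMap M A) := by
    rw [Polynomial.lifts_iff_coeff_lifts]
    intro i
    obtain ⟨y, hy⟩ := h (p.coeff i)
    exact ⟨y, by rw [hy, Polynomial.coeff_map]⟩
  obtain ⟨q, hq⟩ := (Polynomial.mem_lifts _).mp hl
  refine ⟨q, ?_, ?_⟩
  · rintro rfl
    rw [Polynomial.map_zero] at hq
    exact hp0 ((Polynomial.map_eq_zero (algebraMap k A)).mp hq.symm)
  · rw [← Polynomial.eval_map_algebraMap, hq, Polynomial.eval_map_algebraMap, hp]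

theorem AllN.of_field (n : ℕ) (R : Type u) [Field R] : AllN n R := by
  intro P hP
  rcases Ideal.eq_bot_or_top P with h | h
  · exact absurd h hP.ne_bot
  · exact absurd h hP.prime.ne_top

theorem claim_step {F E A B : Type u} [Field F] [IsAlgClosed F] [CharZero F] [Field E] [IsAlgClosed E] [Field A] [IsAlgClosed A]
    [Field B] [Algebra F B] [Algebra.EssFiniteType F B] [Algebra F E] [Algebra F A]
    [Algebra E A] [IsScalarTower F E A] (t : A) (ht : Transcendental E t)
    (hA : Algebra.IsAlgebraic (IntermediateField.adjoin E {t}) A)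
    (n : ℕ) (hn : 1 ≤ n) (hS : AllN n (E ⊗[F] B)) : AllN n (A ⊗[F] B) := by
  have : CharZero E := charZero_of_injective_algebraMap (algebraMap F E).injective
  let K' := IntermediateField.adjoin E {t}
  let y : K' := ⟨t, IntermediateField.mem_adjoin_simple_self E t⟩
  have hy : IntermediateField.adjoin E {y} = ⊤ := by
    apply IntermediateField.lift_injective K'
    rw [IntermediateField.lift_adjoin_simple, IntermediateField.lift_top]
  have hyt : Transcendental E y := by
    intro h
    exact ht (h.algebraMap (A := A))
  let _ : Algebra E[X] K' := (Polynomial.aeval y (R := E)).toRingHom.toAlgebra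
  have : IsFractionRing E[X] K' := isFractionRing_aeval y hy hyt
  let _ : Algebra E[X] A := (Polynomial.aeval t (R := E)).toRingHom.toAlgebra
  have : IsScalarTower E E[X] A := .of_algebraMap_eq fun r => by
    change _ = Polynomial.aeval t _; simp
  have : IsScalarTower E[X] K' A := .of_algebraMap_eq fun r => by
    change Polynomial.aeval t r = algebraMap K' A (Polynomial.aeval y r)
    rw [← Polynomial.aeval_algebraMap_apply]
    rfl
  have : Algebra.IsAlgebraic E[X] A := IsFractionRing.comap_isAlgebraic_iff (K := K').mpr hA
  have : FaithfulSMul E[X] A := (faithfulSMul_iff_algebraMap_injective _ _).mpr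
    (transcendental_iff_injective.mp ht)
  exact step_d (E := E) n hn hS

theorem claim {F B : Type u} [Field F] [IsAlgClosed F] [CharZero F] [Field B] [Algebra F B] [Algebra.EssFiniteType F B] 
    (n : ℕ) (hn : 1 ≤ n) (m : ℕ) : ∀ (k A : Type u) [Field k] [Field A] [IsAlgClosed A] [Algebra F k] [Algebra F A] [Algebra k A]
    [IsScalarTower F k A] [Algebra.IsAlgebraic k A] (g : Fin m → k) (_ : IntermediateField.adjoin F (Set.range g) = ⊤),
    AllN n (A ⊗[F] B) := by
  induction m with
  | zero =>
    intro k A _ _ _ _ _ _ _ _ g hg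
    have : Algebra.IsAlgebraic F A := by
      refine alg_of_range (k := k) (M := F) (A := A) fun x => ?_
      have hx : x ∈ IntermediateField.adjoin F (Set.range g) := by rw [hg]; trivial
      rw [Set.range_eq_empty, IntermediateField.adjoin_empty] at hx
      obtain ⟨y, rfl⟩ := IntermediateField.mem_bot.mp hx
      exact ⟨y, IsScalarTower.algebraMap_apply F k A y⟩
    have hb : Function.Bijective (algebraMap F A) := IsAlgClosed.algebraMap_bijective_of_isIntegral
    let e : F ≃ₐ[F] A := AlgEquiv.ofBijective (Algebra.ofId F A) hb
    let e2 : B ≃ₐ[F] A ⊗[F] B := (Algebra.TensorProduct.lid F B).symm.trans (Algebra.TensorProduct.congr e AlgEquiv.refl)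
    exact (AllN.of_field n B).of_ringEquiv e2.toRingEquiv
  | succ m ih =>
    intro k A _ _ _ _ _ _ _ _ g hg
    let k' : IntermediateField F k := IntermediateField.adjoin F (Set.range fun i : Fin m => g i.succ)
    have hgk : ∀ i : Fin m, g i.succ ∈ k' := fun i => IntermediateField.subset_adjoin F _ ⟨i, rfl⟩
    let g' : Fin m → k' := fun i => ⟨g i.succ, hgk i⟩
    have hg' : IntermediateField.adjoin F (Set.range g') = ⊤ := by
      apply IntermediateField.lift_injective k'
      rw [IntermediateField.lift_adjoin, IntermediateField.lift_top, ← Set.range_comp]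
      rfl
    let E : IntermediateField k' A := algebraicClosure k' A
    have hEc : IsAlgClosed E := (algebraicClosure.isAlgClosure k' A).isAlgClosed
    have : IsScalarTower F k' A := inferInstance
    have : IsScalarTower F k' E := inferInstance
    have : IsScalarTower F E A := .of_algebraMap_eq fun r => by
      rw [IsScalarTower.algebraMap_apply F k' E, IsScalarTower.algebraMap_apply F k A]
      rfl
    have hE : AllN n (E ⊗[F] B) := ih k' E g' hg'
    let t : A := algebraMap k A (g 0)
    have hmem : ∀ (M : IntermediateField E A), t ∈ M → ∀ x : k, algebraMap k A x ∈ M := by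
      intro M htM x
      have hx : x ∈ IntermediateField.adjoin F (Set.range g) := by rw [hg]; trivial
      have hle : IntermediateField.adjoin F (Set.range g) ≤ (M.restrictScalars F).comap (IsScalarTower.toAlgHom F k A) := by
        rw [IntermediateField.adjoin_le_iff]
        rintro _ ⟨i, rfl⟩
        refine Fin.cases ?_ (fun j => ?_) i
        · exact htM
        · have h1 : algebraMap k A (g j.succ) = algebraMap E A (algebraMap k' E (g' j)) := rfl
          change algebraMap k A (g j.succ) ∈ M
          rw [h1]
          exact M.algebraMap_mem _
      exact hle hx
    by_cases ht : Transcendental E t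
    · refine claim_step (E := E) t ht ?_ n hn hE
      refine alg_of_range (k := k) fun x => ?_
      exact ⟨⟨_, hmem _ (IntermediateField.mem_adjoin_simple_self E t) x⟩, rfl⟩
    · have htb : t ∈ (⊥ : IntermediateField E A) := by
        rw [IntermediateField.mem_bot]
        have hti : IsAlgebraic E t := not_not.mp ht
        have htE : t ∈ E := mem_algebraicClosure_iff.mpr (hti.restrictScalars k')
        exact ⟨⟨t, htE⟩, rfl⟩
      have : Algebra.IsAlgebraic E A := by
        refine alg_of_range (k := k) fun x => ?_
        obtain ⟨y, hy⟩ := IntermediateField.mem_bot.mp (hmem _ htb x)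
        exact ⟨y, hy⟩
      have : Algebra.IsAlgebraic k' A := Algebra.IsAlgebraic.trans k' E A
      exact ih k' A g' hg'
end PD

namespace PD
open scoped TensorProduct Polynomial
open nonZeroDivisors

theorem isUnit_of_inv {R : Type u} [CommRing R] [IsDomain R] {I : Ideal R} (h : Inv I) :
    IsUnit (I : FractionalIdeal R⁰ (FractionRing R)) := by
  obtain ⟨J, a, ha, hIJ⟩ := h
  have ha' : algebraMap R (FractionRing R) a ≠ 0 := by
    rw [Ne, map_eq_zero_iff _ (IsFractionRing.injective R (FractionRing R))]; exact ha
  have h1 : (I : FractionalIdeal R⁰ (FractionRing R)) * (J : FractionalIdeal R⁰ (FractionRing R)) = FractionalIdeal.spanSingleton R⁰ (algebraMap R _ a) := by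
    rw [← FractionalIdeal.coeIdeal_mul, hIJ, FractionalIdeal.coeIdeal_span_singleton]
  refine IsUnit.of_mul_eq_one ((J : FractionalIdeal R⁰ (FractionRing R)) * FractionalIdeal.spanSingleton R⁰ (algebraMap R _ a)⁻¹) ?_
  rw [← mul_assoc, h1, FractionalIdeal.spanSingleton_mul_spanSingleton, mul_inv_cancel₀ ha', FractionalIdeal.spanSingleton_one]

theorem inv_of_isUnit {R : Type u} [CommRing R] [IsDomain R] {I : Ideal R} 
    (h : IsUnit (I : FractionalIdeal R⁰ (FractionRing R))) : Inv I := by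
  obtain ⟨V, hV⟩ := h.exists_right_inv
  obtain ⟨a, J, ha, rfl⟩ := FractionalIdeal.exists_eq_spanSingleton_mul V
  have ha' : algebraMap R (FractionRing R) a ≠ 0 := by
    rw [Ne, map_eq_zero_iff _ (IsFractionRing.injective R (FractionRing R))]; exact ha
  refine ⟨J, a, ha, ?_⟩
  apply FractionalIdeal.coeIdeal_injective (K := FractionRing R)
  change ((I * J : Ideal R) : FractionalIdeal R⁰ (FractionRing R)) = ((Ideal.span {a} : Ideal R) : FractionalIdeal R⁰ (FractionRing R))
  rw [FractionalIdeal.coeIdeal_mul, FractionalIdeal.coeIdeal_span_singleton]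
  have h2 : FractionalIdeal.spanSingleton R⁰ (algebraMap R (FractionRing R) a) * 
     FractionalIdeal.spanSingleton R⁰ (algebraMap R (FractionRing R) a)⁻¹ = 1 := by
    rw [FractionalIdeal.spanSingleton_mul_spanSingleton, mul_inv_cancel₀ ha', FractionalIdeal.spanSingleton_one]
  calc _ = (FractionalIdeal.spanSingleton R⁰ (algebraMap R (FractionRing R) a) * 
     FractionalIdeal.spanSingleton R⁰ (algebraMap R (FractionRing R) a)⁻¹) * (I * J) := by rw [h2, one_mul]
    _ = FractionalIdeal.spanSingleton R⁰ (algebraMap R (FractionRing R) a) * (I * 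
     (FractionalIdeal.spanSingleton R⁰ (algebraMap R (FractionRing R) a)⁻¹ * J)) := by ring
    _ = _ := by rw [hV, mul_one]

theorem classGroup_div {R : Type u} [CommRing R] [IsDomain R] (n : ℕ) (hn : 1 ≤ n)
    (h : ∀ I : Ideal R, Inv I → NDiv n I) (c : ClassGroup R) : ∃ d : ClassGroup R, d ^ n = c := by
  refine ClassGroup.induction (FractionRing R) (P := fun c => ∃ d : ClassGroup R, d ^ n = c) ?_ c
  intro U
  have hnum : IsUnit ((U : FractionalIdeal R⁰ (FractionRing R)).num : FractionalIdeal R⁰ (FractionRing R)) :=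
    FractionalIdeal.isUnit_num.mpr U.isUnit
  set I := (U : FractionalIdeal R⁰ (FractionRing R)).num with hI
  have hInv := inv_of_isUnit hnum
  obtain ⟨f, hf, J, hJ⟩ := h I hInv
  have hJinv : Inv J := by
    refine Inv.of_pow (n := n) ?_ ?_
    · omega
    · rw [← hJ]; exact (Inv.span hf).mul hInv
  obtain ⟨V, hV⟩ := isUnit_of_inv hJinv
  refine ⟨ClassGroup.mk (FractionRing R) V, ?_⟩
  rw [← map_pow]
  have e1 : ClassGroup.mk (FractionRing R) (V ^ n) = ClassGroup.mk (FractionRing R) hnum.unit := by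
    rw [ClassGroup.mk_eq_mk_of_coe_ideal (I' := J ^ n) (J' := I)]
    · exact ⟨1, f, one_ne_zero, hf, by rw [hJ]; simp⟩
    · rw [Units.val_pow_eq_pow_val, hV, FractionalIdeal.coeIdeal_pow]
    · rfl
  rw [e1, eq_comm, ClassGroup.mk_eq_mk]
  have hd : algebraMap R (FractionRing R) (U : FractionalIdeal R⁰ (FractionRing R)).den ≠ 0 :=
    IsFractionRing.to_map_ne_zero_of_mem_nonZeroDivisors (U : FractionalIdeal R⁰ (FractionRing R)).den.prop
  refine ⟨Units.mk0 _ hd, ?_⟩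
  ext1
  rw [Units.val_mul, coe_toPrincipalIdeal, Units.val_mk0, mul_comm]
  exact FractionalIdeal.den_mul_self_eq_num' _ _ _

theorem pic_pow {R : Type u} [CommRing R] (N : Type u) [AddCommGroup N] [Module R N] [Module.Invertible R N] (n : ℕ) :
    ∃ h : Module.Invertible R (PiTensorProduct R (fun _ : Fin n => N)),
      CommRing.Pic.mk R (PiTensorProduct R (fun _ : Fin n => N)) = CommRing.Pic.mk R N ^ n := by
  induction n with
  | zero =>
    have e : PiTensorProduct R (fun _ : Fin 0 => N) ≃ₗ[R] R := PiTensorProduct.isEmptyEquiv (Fin 0)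
    have h : Module.Invertible R (PiTensorProduct R (fun _ : Fin 0 => N)) := .congr e.symm
    refine ⟨h, ?_⟩
    rw [pow_zero, CommRing.Pic.mk_eq_one_iff]
    exact ⟨e⟩
  | succ n ih =>
    obtain ⟨h, ih⟩ := ih
    let e1 : PiTensorProduct R (fun _ : Fin 1 => N) ≃ₗ[R] N := PiTensorProduct.subsingletonEquiv (s := fun _ : Fin 1 => N) 0
    let e : PiTensorProduct R (fun _ : Fin n => N) ⊗[R] N ≃ₗ[R] PiTensorProduct R (fun _ : Fin (n + 1) => N) :=
      (LinearEquiv.lTensor _ e1.symm).trans (TensorPower.mulEquiv (R := R) (M := N) (n := n) (m := 1))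
    have h' : Module.Invertible R (PiTensorProduct R (fun _ : Fin (n + 1) => N)) := .congr e
    refine ⟨h', ?_⟩
    rw [pow_succ, ← ih, ← CommRing.Pic.mk_tensor]
    exact CommRing.Pic.mk_eq_mk_iff.mpr ⟨e.symm⟩

theorem pic_final {R : Type u} [CommRing R] [IsDomain R] (n : ℕ) (hn : 1 ≤ n)
    (h : ∀ I : Ideal R, Inv I → NDiv n I) (M : Type u) [AddCommGroup M] [Module R M] [Module.Invertible R M] :
    ∃ (N : Type u) (_ : AddCommGroup N) (_ : Module R N) (_ : Module.Invertible R N),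
      Nonempty (PiTensorProduct R (fun _ : Fin n => N) ≃ₗ[R] M) := by
  let e := ClassGroup.equivPic R
  obtain ⟨d, hd⟩ := classGroup_div n hn h (e.symm (CommRing.Pic.mk R M))
  have h1 : (e d) ^ n = CommRing.Pic.mk R M := by rw [← map_pow, hd, MulEquiv.apply_symm_apply]
  refine ⟨(e d).AsModule, inferInstance, inferInstance, inferInstance, ?_⟩
  obtain ⟨h2, h3⟩ := pic_pow (R := R) (e d).AsModule n
  rw [CommRing.Pic.mk_eq_self, h1] at h3
  exact CommRing.Pic.mk_eq_mk_iff.mp h3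
end PD

/-- Let `F` be an algebraically closed field of characteristic `0`, `F₁, F₂` finitely
generated field extensions of `F`, and `F̄₁` an algebraic closure of `F₁` (as an `F`-algebra).
Then the Picard group of `F̄₁ ⊗[F] F₂` is divisible: for every invertible module `M` over
`F̄₁ ⊗[F] F₂` and every `n ≥ 1` there is an invertible module `N` whose `n`-fold tensor
power is isomorphic to `M`. -/
theorem pic_of_algClosure_tensorProduct_divisible
    (F F₁ F₂ F₁bar : Type u) [Field F] [IsAlgClosed F] [CharZero F]
    [Field F₁] [Field F₂] [Algebra F F₁] [Algebra F F₂]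
    (hfg₁ : (⊤ : IntermediateField F F₁).FG) (hfg₂ : (⊤ : IntermediateField F F₂).FG)
    [Field F₁bar] [Algebra F₁ F₁bar] [IsAlgClosure F₁ F₁bar]
    [Algebra F F₁bar] [IsScalarTower F F₁ F₁bar]
    (M : InvertibleModule (F₁bar ⊗[F] F₂)) (n : ℕ) (hn : 1 ≤ n) :
    ∃ N : InvertibleModule (F₁bar ⊗[F] F₂),
      Nonempty ((PiTensorProduct (F₁bar ⊗[F] F₂) (fun _ : Fin n => N.carrier))
        ≃ₗ[F₁bar ⊗[F] F₂] M.carrier) := by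
  have hess : Algebra.EssFiniteType F F₂ := IntermediateField.fg_top_iff.mp hfg₂
  have hac : IsAlgClosed F₁bar := IsAlgClosure.isAlgClosed F₁
  have halg : Algebra.IsAlgebraic F₁ F₁bar := IsAlgClosure.isAlgebraic
  have hG : PD.Good (F₁bar ⊗[F] F₂) := PD.Good.tensor
  have := hG.dom
  have := hG.noeth
  obtain ⟨s, hs⟩ := hfg₁
  have hall : PD.AllN n (F₁bar ⊗[F] F₂) := by
    refine PD.claim n hn s.card F₁ F₁bar (fun i => (s.equivFin.symm i : F₁)) ?_
    rw [← hs]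
    congr 1
    ext x
    constructor
    · rintro ⟨i, rfl⟩
      exact (s.equivFin.symm i).2
    · intro hx
      exact ⟨s.equivFin ⟨x, hx⟩, by simp⟩
  have hI : ∀ I : Ideal (F₁bar ⊗[F] F₂), PD.Inv I → PD.NDiv n I := fun I hI =>
    PD.NDiv.of_primes (fun P hP => PD.inv_of_H1 hG hP) hI (fun P hP _ => hall P hP)
  obtain ⟨eM⟩ := M.equiv
  have hM : Module.Invertible (F₁bar ⊗[F] F₂) M.carrier := .left eM
  obtain ⟨N, i1, i2, i3, ⟨e⟩⟩ := PD.pic_final n hn hI M.carrier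
  exact ⟨{ carrier := N, inverse := Module.Dual (F₁bar ⊗[F] F₂) N,
           equiv := ⟨(TensorProduct.comm _ _ _).trans (Module.Invertible.linearEquiv (F₁bar ⊗[F] F₂) N)⟩ }, ⟨e⟩⟩
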